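/- arXiv:1406.3522 — 12 statements merged into one kernel-verified Lean document; each statement's English description precedes it below -/
import Mathlib

section
/- Let H be a complex Hilbert space and n a positive integer. If a self-adjoint bounded operator x on H satisfies x = ∑_{i=1}^n Q_i P_i for some orthogonal projections P_1,…,P_n, Q_1,…,Q_n on H, then −(n/8)·1 ≤ x ≤ n·1 (i.e., for every vector e ∈ H, −(n/8)·‖e‖² ≤ ⟨x e, e⟩ ≤ n·‖e‖²). -/
open scoped ComplexInnerProductSpace

section

variable {H : Type*} [NormedAddCommGroup H] [InnerProductSpace ℂ H]

/-- If `u` and `v` are images of `e` under orthogonal projections, then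
`-‖e‖² / 8 ≤ Re ⟪u, v⟫`, because `Re ⟪u, v⟫ + ‖e‖² / 8 = ‖u + v - e / 2‖² / 2`. -/
lemma neg_norm_sq_div_eight_le_re_inner {e u v : H} (hu : (⟪u, e⟫).re = ‖u‖ ^ 2)
    (hv : (⟪v, e⟫).re = ‖v‖ ^ 2) : -(‖e‖ ^ 2 / 8) ≤ (⟪u, v⟫).re := by
  have h := norm_sub_sq (𝕜 := ℂ) ((2 : ℂ) • (u + v)) e
  rw [inner_smul_left, inner_add_left, norm_smul, mul_pow, norm_add_sq (𝕜 := ℂ) u v] at h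
  simp at h
  nlinarith [sq_nonneg ‖(2 : ℂ) • (u + v) - e‖]

/-- If `u` and `v` are images of `e` under orthogonal projections, then
`Re ⟪u, v⟫ ≤ ‖e‖²`. -/
lemma re_inner_le_norm_sq {e u v : H} (hu : (⟪u, e⟫).re = ‖u‖ ^ 2)
    (hv : (⟪v, e⟫).re = ‖v‖ ^ 2) : (⟪u, v⟫).re ≤ ‖e‖ ^ 2 := by
  have huv := norm_sub_sq (𝕜 := ℂ) u v
  have hue := norm_sub_sq (𝕜 := ℂ) u e
  have hve := norm_sub_sq (𝕜 := ℂ) v e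
  simp only [RCLike.re_to_complex] at huv hue hve
  linarith [sq_nonneg ‖u - v‖, sq_nonneg ‖u - e‖, sq_nonneg ‖v - e‖]

lemma re_inner_apply_self_of_projection [CompleteSpace H] {P : H →L[ℂ] H}
    (hP : ContinuousLinearMap.adjoint P = P ∧ P ∘L P = P) (e : H) :
    (⟪P e, e⟫).re = ‖P e‖ ^ 2 := by
  have h : ⟪P e, e⟫ = ⟪P e, P e⟫ := by
    rw [← ContinuousLinearMap.adjoint_inner_left, hP.1, ← ContinuousLinearMap.comp_apply, hP.2]
  rw [h, ← RCLike.re_to_complex, inner_self_eq_norm_sq]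

end

/-- If a self-adjoint bounded operator `x` on a complex Hilbert space `H`
is a sum `x = ∑ Qᵢ Pᵢ` of `n` compositions of pairs of orthogonal projections, then
`-(n/8)·1 ≤ x ≤ n·1`, i.e. `-(n/8)·‖e‖² ≤ ⟨x e, e⟩ ≤ n·‖e‖²` for every `e ∈ H`. -/
theorem sums_of_compositions_bounds_complex
    {H : Type*} [NormedAddCommGroup H] [InnerProductSpace ℂ H] [CompleteSpace H]
    (n : ℕ) (hn : 0 < n)
    (x : H →L[ℂ] H) (hx : ContinuousLinearMap.adjoint x = x)
    (P Q : Fin n → H →L[ℂ] H)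
    (hP : ∀ i, ContinuousLinearMap.adjoint (P i) = P i ∧ P i ∘L P i = P i)
    (hQ : ∀ i, ContinuousLinearMap.adjoint (Q i) = Q i ∧ Q i ∘L Q i = Q i)
    (hsum : x = ∑ i, Q i ∘L P i) :
    ∀ e : H, -((n : ℝ) / 8) * ‖e‖ ^ 2 ≤ (⟪x e, e⟫).re ∧
      (⟪x e, e⟫).re ≤ (n : ℝ) * ‖e‖ ^ 2 := by
  intro e
  have hxe : (⟪x e, e⟫).re = ∑ i, (⟪P i e, Q i e⟫).re := by
    rw [hsum, sum_apply, sum_inner, Complex.re_sum]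
    refine Finset.sum_congr rfl fun i _ => ?_
    rw [ContinuousLinearMap.comp_apply, ← ContinuousLinearMap.adjoint_inner_left, (hQ i).1]
  have hPe i := re_inner_apply_self_of_projection (hP i) e
  have hQe i := re_inner_apply_self_of_projection (hQ i) e
  rw [hxe]
  constructor
  · have h := Finset.card_nsmul_le_sum Finset.univ (fun i => (⟪P i e, Q i e⟫).re) _
      fun i _ => neg_norm_sq_div_eight_le_re_inner (hPe i) (hQe i)
    rw [Finset.card_univ, Fintype.card_fin, nsmul_eq_mul] at h
    linarith
  · have h := Finset.sum_le_card_nsmul Finset.univ (fun i => (⟪P i e, Q i e⟫).re) _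
      fun i _ => re_inner_le_norm_sq (hPe i) (hQe i)
    rwa [Finset.card_univ, Fintype.card_fin, nsmul_eq_mul] at h
end

section
/- Let H be a real Hilbert space and n a positive integer. If a self-adjoint bounded operator x on H satisfies x = ∑_{i=1}^n Q_i P_i for some orthogonal projections P_1,…,P_n, Q_1,…,Q_n on H, then −(n/8)·1 ≤ x ≤ n·1 (i.e., for every vector e ∈ H, −(n/8)·‖e‖² ≤ ⟨x e, e⟩ ≤ n·‖e‖²). -/
open scoped RealInnerProductSpace

/-- A symmetric idempotent `T` satisfies `⟪T e, e⟫ = ⟪T e, T e⟫`. -/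
theorem inner_apply_self_of_adjoint_eq_of_comp_self
    {H : Type*} [NormedAddCommGroup H] [InnerProductSpace ℝ H] [CompleteSpace H]
    {T : H →L[ℝ] H} (hT : ContinuousLinearMap.adjoint T = T ∧ T ∘L T = T) (e : H) :
    ⟪T e, e⟫ = ⟪T e, T e⟫ := by
  have h := ContinuousLinearMap.adjoint_inner_left T e (T e)
  rwa [hT.1, ← ContinuousLinearMap.comp_apply, hT.2] at h

/-- Numerical range bounds for the composition of two orthogonal projections. -/
theorem inner_comp_apply_self_bounds
    {H : Type*} [NormedAddCommGroup H] [InnerProductSpace ℝ H] [CompleteSpace H]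
    {P Q : H →L[ℝ] H} (hP : ContinuousLinearMap.adjoint P = P ∧ P ∘L P = P)
    (hQ : ContinuousLinearMap.adjoint Q = Q ∧ Q ∘L Q = Q) (e : H) :
    -(1 / 8) * ‖e‖ ^ 2 ≤ ⟪(Q ∘L P) e, e⟫ ∧ ⟪(Q ∘L P) e, e⟫ ≤ ‖e‖ ^ 2 := by
  have hPe := inner_apply_self_of_adjoint_eq_of_comp_self hP e
  have hQe := inner_apply_self_of_adjoint_eq_of_comp_self hQ e
  have hQP : ⟪(Q ∘L P) e, e⟫ = ⟪P e, Q e⟫ := by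
    have h := ContinuousLinearMap.adjoint_inner_left Q e (P e)
    rwa [hQ.1] at h
  rw [hQP, ← real_inner_self_eq_norm_sq]
  have h₁ : 0 ≤ ⟪(2 : ℝ) • P e + (2 : ℝ) • Q e - e, (2 : ℝ) • P e + (2 : ℝ) • Q e - e⟫ :=
    real_inner_self_nonneg
  have h₂ : 0 ≤ ⟪P e - Q e, P e - Q e⟫ := real_inner_self_nonneg
  have h₃ : 0 ≤ ⟪P e - e, P e - e⟫ := real_inner_self_nonneg
  have h₄ : 0 ≤ ⟪Q e - e, Q e - e⟫ := real_inner_self_nonneg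
  simp only [inner_sub_left, inner_sub_right, inner_add_left, inner_add_right,
    real_inner_smul_left, real_inner_smul_right, real_inner_comm (P e) e,
    real_inner_comm (Q e) e, real_inner_comm (P e) (Q e)] at h₁ h₂ h₃ h₄ ⊢
  constructor <;> linarith [real_inner_comm (P e) e, real_inner_comm (Q e) e,
    real_inner_comm (P e) (Q e)]

/-- If a self-adjoint bounded operator `x` on a real Hilbert space `H`
is a sum `x = ∑ Qᵢ Pᵢ` of `n` compositions of pairs of orthogonal projections, then
`-(n/8)·1 ≤ x ≤ n·1`, i.e. `-(n/8)·‖e‖² ≤ ⟨x e, e⟩ ≤ n·‖e‖²` for every `e ∈ H`. -/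
theorem sums_of_compositions_bounds_real
    {H : Type*} [NormedAddCommGroup H] [InnerProductSpace ℝ H] [CompleteSpace H]
    (n : ℕ) (hn : 0 < n)
    (x : H →L[ℝ] H) (hx : ContinuousLinearMap.adjoint x = x)
    (P Q : Fin n → H →L[ℝ] H)
    (hP : ∀ i, ContinuousLinearMap.adjoint (P i) = P i ∧ P i ∘L P i = P i)
    (hQ : ∀ i, ContinuousLinearMap.adjoint (Q i) = Q i ∧ Q i ∘L Q i = Q i)
    (hsum : x = ∑ i, Q i ∘L P i) :
    ∀ e : H, -((n : ℝ) / 8) * ‖e‖ ^ 2 ≤ ⟪x e, e⟫ ∧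
      ⟪x e, e⟫ ≤ (n : ℝ) * ‖e‖ ^ 2 := by
  intro e
  have hxe : ⟪x e, e⟫ = ∑ i, ⟪(Q i ∘L P i) e, e⟫ := by
    rw [hsum, sum_apply, sum_inner]
  rw [hxe]
  constructor
  · calc -((n : ℝ) / 8) * ‖e‖ ^ 2 = ∑ _i : Fin n, -(1 / 8) * ‖e‖ ^ 2 := by
          simp only [Finset.sum_const, Finset.card_univ, Fintype.card_fin, nsmul_eq_mul]
          ring
      _ ≤ _ := Finset.sum_le_sum fun i _ => (inner_comp_apply_self_bounds (hP i) (hQ i) e).1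
  · calc _ ≤ ∑ _i : Fin n, ‖e‖ ^ 2 :=
          Finset.sum_le_sum fun i _ => (inner_comp_apply_self_bounds (hP i) (hQ i) e).2
      _ = (n : ℝ) * ‖e‖ ^ 2 := by simp
end

section
/- For every even positive integer n there exist orthogonal projections P_1,…,P_n, Q_1,…,Q_n on the two-dimensional complex Hilbert space ℂ² such that ∑_{i=1}^n Q_i P_i equals the diagonal matrix diag(−n/8, 3n/8). In particular ∑_{i=1}^n Q_i P_i is self-adjoint and has −n/8 as an eigenvalue, so the lower bound −(n/8)·1 in the inequality −(n/8)·1 ≤ ∑ Q_i P_i is attained and cannot be improved for even n. -/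
/-- The matrix with diagonal `1/4, 3/4` and off-diagonal entries `s/4`; for `s = ±√3` it is the
projection onto the line at angle `±π/3`. -/
noncomputable def lineProj (s : ℝ) : Matrix (Fin 2) (Fin 2) ℂ :=
  !![1 / 4, (s : ℂ) / 4; (s : ℂ) / 4, 3 / 4]

lemma lineProj_isHermitian (s : ℝ) : (lineProj s).IsHermitian := by
  ext i j
  fin_cases i <;> fin_cases j <;> simp [lineProj, Matrix.conjTranspose_apply]

lemma lineProj_mul_self {s : ℝ} (hs : s ^ 2 = 3) : lineProj s * lineProj s = lineProj s := by
  have h : (s : ℂ) ^ 2 = 3 := by exact_mod_cast hs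
  ext i j
  fin_cases i <;> fin_cases j <;> simp [lineProj, Matrix.mul_apply] <;> grind

lemma lineProj_neg_mul_add {s : ℝ} (hs : s ^ 2 = 3) :
    lineProj (-s) * lineProj s + lineProj s * lineProj (-s) =
      Matrix.diagonal ![-1 / 4, 3 / 4] := by
  have h : (s : ℂ) ^ 2 = 3 := by exact_mod_cast hs
  ext i j
  fin_cases i <;> fin_cases j <;> simp [lineProj] <;> grind

/-- For every even positive integer `n` there are orthogonal projections
`P₁,…,Pₙ, Q₁,…,Qₙ` on `ℂ²` (Hermitian idempotent `2×2` matrices) with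
`∑ Qᵢ Pᵢ = diag(-n/8, 3n/8)`; in particular the lower bound `-(n/8)·1` is attained. -/
theorem lower_bound_attained_even
    (n : ℕ) (hn : 0 < n) (heven : Even n) :
    ∃ P Q : Fin n → Matrix (Fin 2) (Fin 2) ℂ,
      (∀ i, (P i).IsHermitian ∧ P i * P i = P i) ∧
      (∀ i, (Q i).IsHermitian ∧ Q i * Q i = Q i) ∧
      ∑ i, Q i * P i = Matrix.diagonal ![-(n : ℂ) / 8, 3 * (n : ℂ) / 8] := by
  obtain ⟨k, rfl⟩ := heven
  have hs : √(3 : ℝ) ^ 2 = 3 := Real.sq_sqrt (by norm_num)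
  have hs' : (-√(3 : ℝ)) ^ 2 = 3 := by rw [neg_sq, hs]
  refine ⟨Fin.append (fun _ => lineProj √3) (fun _ => lineProj (-√3)),
    Fin.append (fun _ => lineProj (-√3)) (fun _ => lineProj √3), ?_, ?_, ?_⟩
  · intro i
    refine Fin.addCases (fun j => ?_) (fun j => ?_) i <;>
      simp only [Fin.append_left, Fin.append_right, lineProj_isHermitian,
        lineProj_mul_self hs, lineProj_mul_self hs', and_self]
  · intro i
    refine Fin.addCases (fun j => ?_) (fun j => ?_) i <;>
      simp only [Fin.append_left, Fin.append_right, lineProj_isHermitian,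
        lineProj_mul_self hs, lineProj_mul_self hs', and_self]
  · simp only [Fin.sum_univ_add, Fin.append_left, Fin.append_right, Finset.sum_const,
      Finset.card_univ, Fintype.card_fin]
    rw [← smul_add, lineProj_neg_mul_add hs]
    ext i j
    fin_cases i <;> fin_cases j <;> simp <;> ring
end

section
/- Let H be an infinite-dimensional complex Hilbert space and let n ≥ 4 be an even integer. If a self-adjoint bounded operator x on H satisfies −((n−4)²/(8n))·1 ≤ x ≤ (n−2)·1, then there exist orthogonal projections P_1,…,P_n, Q_1,…,Q_n on H such that x = ∑_{i=1}^n Q_i P_i. -/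
open scoped ComplexInnerProductSpace

/-- Angles for which the matrix entries of a product of two rotated rank-one projections of the
plane are `p / 2` and `φ p / 2`. -/
theorem exists_continuousOn_angles {c₀ : ℝ} (h0 : 0 ≤ c₀) (h1 : c₀ < 1 / 2) :
    ∃ α β φ : ℝ → ℝ,
      ContinuousOn α (Set.Icc (c₀ ^ 2 - c₀) 2) ∧ ContinuousOn β (Set.Icc (c₀ ^ 2 - c₀) 2) ∧
      Continuous φ ∧ (∀ p ∈ Set.Icc (c₀ ^ 2 - c₀) 2,
        φ p ∈ Set.Icc 0 (c₀ ^ 2 + c₀) ∧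
        2 * (Real.cos (α p) * Real.cos (β p) * Real.cos (α p - β p)) = p ∧
        2 * (Real.sin (α p) * Real.sin (β p) * Real.cos (α p - β p)) = φ p) := by
  set φ : ℝ → ℝ := fun p => min (c₀ ^ 2 + c₀) (2 - p) with hφ
  have hφc : Continuous φ := by fun_prop
  set c : ℝ → ℝ := fun p => √((p + φ p) / 2) with hc
  set d : ℝ → ℝ := fun p => (p - φ p) / (2 * c p) with hd
  have hcc : Continuous c := by fun_prop
  have hφ_mem : ∀ p ∈ Set.Icc (c₀ ^ 2 - c₀) 2, φ p ∈ Set.Icc 0 (c₀ ^ 2 + c₀) := fun p hp =>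
    ⟨le_min (by positivity) (by linarith [hp.2]), min_le_left _ _⟩
  have hsum : ∀ p ∈ Set.Icc (c₀ ^ 2 - c₀) 2, 2 * c₀ ^ 2 ≤ p + φ p := by
    intro p hp
    rcases min_choice (c₀ ^ 2 + c₀) (2 - p) with h | h <;> simp only [hφ, h]
    · linarith [hp.1]
    · nlinarith
  have hsum2 : ∀ p, p + φ p ≤ 2 := fun p => by linarith [min_le_right (c₀ ^ 2 + c₀) (2 - p)]
  have hc2 : ∀ p ∈ Set.Icc (c₀ ^ 2 - c₀) 2, c p ^ 2 = (p + φ p) / 2 := fun p hp =>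
    Real.sq_sqrt (by nlinarith [hsum p hp])
  have hc1 : ∀ p, c p ≤ 1 := fun p => Real.sqrt_le_one.2 (by linarith [hsum2 p])
  have hpar : ∀ p ∈ Set.Icc (c₀ ^ 2 - c₀) 2, (p - φ p) ^ 2 ≤ 2 * (p + φ p) := by
    intro p hp
    rcases min_choice (c₀ ^ 2 + c₀) (2 - p) with h | h <;> simp only [hφ, h]
    · nlinarith [mul_nonneg (sub_nonneg.2 hp.1)
        (show 0 ≤ (c₀ + 1) * (c₀ + 2) - p by nlinarith [hp.2])]
    · have : 0 ≤ p := by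
        have := min_eq_right_iff.1 h
        nlinarith
      nlinarith [hp.2]
  have hcd : ∀ p ∈ Set.Icc (c₀ ^ 2 - c₀) 2, c p * d p = (p - φ p) / 2 := by
    intro p hp
    by_cases hz : c p = 0
    · have h2 := hc2 p hp
      have h3 := hpar p hp
      rw [hz] at h2 ⊢
      have : (p - φ p) ^ 2 = 0 := le_antisymm (by nlinarith) (sq_nonneg _)
      rw [pow_eq_zero_iff two_ne_zero] at this
      simp [this]
    · simp only [hd]
      field_simp
  have hd1 : ∀ p ∈ Set.Icc (c₀ ^ 2 - c₀) 2, d p ∈ Set.Icc (-1) 1 := by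
    intro p hp
    by_cases hz : c p = 0
    · simp [hd, hz]
    · have hpos : 0 < c p ^ 2 := by positivity
      rw [Set.mem_Icc, ← abs_le, ← sq_le_one_iff_abs_le_one]
      have h2 : (c p * d p) ^ 2 ≤ c p ^ 2 := by
        rw [hcd p hp, hc2 p hp]; nlinarith [hpar p hp]
      rw [mul_pow] at h2
      nlinarith
  have hdc : ContinuousOn d (Set.Icc (c₀ ^ 2 - c₀) 2) := by
    rcases h0.eq_or_lt with rfl | hpos
    · refine ContinuousOn.congr (f := c) hcc.continuousOn fun p hp => ?_
      have hφ0 : φ p = 0 := le_antisymm (by simpa using (hφ_mem p hp).2) (hφ_mem p hp).1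
      have hcp : c p = √(p / 2) := by simp [hc, hφ0]
      simp only [hd, hcp, hφ0, sub_zero, ← div_div]
      exact Real.div_sqrt
    · refine ContinuousOn.div (by fun_prop) (by fun_prop) fun p hp => ?_
      have : 0 < c p := Real.sqrt_pos.2 (by nlinarith [hsum p hp])
      positivity
  have hacc : ContinuousOn (fun p => Real.arccos (c p)) (Set.Icc (c₀ ^ 2 - c₀) 2) :=
    (Real.continuous_arccos.comp hcc).continuousOn
  have hacd : ContinuousOn (fun p => Real.arccos (d p)) (Set.Icc (c₀ ^ 2 - c₀) 2) :=
    Real.continuous_arccos.comp_continuousOn hdc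
  refine ⟨fun p => (Real.arccos (d p) + Real.arccos (c p)) / 2,
    fun p => (Real.arccos (d p) - Real.arccos (c p)) / 2, φ,
    (hacd.add hacc).div_const 2, (hacd.sub hacc).div_const 2, hφc, fun p hp => ?_⟩
  have hc0 : 0 ≤ c p := Real.sqrt_nonneg _
  set a := (Real.arccos (d p) + Real.arccos (c p)) / 2 with ha
  set b := (Real.arccos (d p) - Real.arccos (c p)) / 2 with hb
  have hab : Real.cos (a - b) = c p := by
    rw [show a - b = Real.arccos (c p) by rw [ha, hb]; ring,
      Real.cos_arccos (by linarith) (hc1 p)]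
  have hab' : Real.cos (a + b) = d p := by
    rw [show a + b = Real.arccos (d p) by rw [ha, hb]; ring,
      Real.cos_arccos (hd1 p hp).1 (hd1 p hp).2]
  have e1 := hc2 p hp
  have e2 := hcd p hp
  have e3 := Real.cos_sub a b
  have e4 := Real.cos_add a b
  rw [hab] at e3
  rw [hab'] at e4
  have hcos : Real.cos a * Real.cos b = (c p + d p) / 2 := by linarith
  have hsin : Real.sin a * Real.sin b = (c p - d p) / 2 := by linarith
  refine ⟨hφ_mem p hp, ?_, ?_⟩
  · rw [hab, hcos]; linarith
  · rw [hab, hsin]; linarith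

/-- Operator form of `exists_continuousOn_angles`, obtained from the continuous functional
calculus. -/
theorem exists_cos_sin_of_isSelfAdjoint {K : Type*} [NormedAddCommGroup K]
    [InnerProductSpace ℂ K] [CompleteSpace K] {c₀ : ℝ} (h0 : 0 ≤ c₀) (h1 : c₀ < 1 / 2)
    {p : K →L[ℂ] K} (hp : IsSelfAdjoint p)
    (hl : algebraMap ℝ (K →L[ℂ] K) (c₀ ^ 2 - c₀) ≤ p) (hu : p ≤ algebraMap ℝ (K →L[ℂ] K) 2) :
    ∃ C S D T q : K →L[ℂ] K,
      IsSelfAdjoint C ∧ IsSelfAdjoint S ∧ IsSelfAdjoint D ∧ IsSelfAdjoint T ∧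
      C * C + S * S = 1 ∧ D * D + T * T = 1 ∧
      (2 : ℝ) • (D * D * C * C + D * T * S * C) = p ∧
      (2 : ℝ) • (T * D * C * S + T * T * S * S) = q ∧
      IsSelfAdjoint q ∧ 0 ≤ q ∧ q ≤ algebraMap ℝ (K →L[ℂ] K) (c₀ ^ 2 + c₀) := by
  obtain ⟨α, β, φ, hα, hβ, hφ, h⟩ := exists_continuousOn_angles h0 h1
  have hsp : spectrum ℝ p ⊆ Set.Icc (c₀ ^ 2 - c₀) 2 := fun r hr =>
    ⟨(algebraMap_le_iff_le_spectrum hp).1 hl r hr, (le_algebraMap_iff_spectrum_le hp).1 hu r hr⟩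
  set Φ := cfcHom (R := ℝ) hp
  let a : C(spectrum ℝ p, ℝ) := ⟨(spectrum ℝ p).domRestrict α, (hα.mono hsp).domRestrict⟩
  let b : C(spectrum ℝ p, ℝ) := ⟨(spectrum ℝ p).domRestrict β, (hβ.mono hsp).domRestrict⟩
  let C : C(spectrum ℝ p, ℝ) := ⟨fun r => Real.cos (a r), by fun_prop⟩
  let S : C(spectrum ℝ p, ℝ) := ⟨fun r => Real.sin (a r), by fun_prop⟩
  let D : C(spectrum ℝ p, ℝ) := ⟨fun r => Real.cos (b r), by fun_prop⟩
  let T : C(spectrum ℝ p, ℝ) := ⟨fun r => Real.sin (b r), by fun_prop⟩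
  let q : C(spectrum ℝ p, ℝ) := ⟨fun r => φ r, by fun_prop⟩
  have hq : cfc φ p = Φ q := cfc_apply φ p hp hφ.continuousOn
  have hid : p = Φ ((ContinuousMap.id ℝ).restrict (spectrum ℝ p)) := (cfcHom_id hp).symm
  have hCS : C * C + S * S = 1 := by
    ext r
    have := Real.cos_sq_add_sin_sq (a r)
    rw [sq, sq] at this
    exact this
  have hDT : D * D + T * T = 1 := by
    ext r
    have := Real.cos_sq_add_sin_sq (b r)
    rw [sq, sq] at this
    exact this
  have hpe : (2 : ℝ) • (D * D * C * C + D * T * S * C) =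
      (ContinuousMap.id ℝ).restrict (spectrum ℝ p) := by
    ext r
    have := (h r (hsp r.2)).2.1
    rw [Real.cos_sub] at this
    change 2 * (Real.cos (β r) * Real.cos (β r) * Real.cos (α r) * Real.cos (α r) +
      Real.cos (β r) * Real.sin (β r) * Real.sin (α r) * Real.cos (α r)) = (r : ℝ)
    linear_combination this
  have hqe : (2 : ℝ) • (T * D * C * S + T * T * S * S) = q := by
    ext r
    have := (h r (hsp r.2)).2.2
    rw [Real.cos_sub] at this
    change 2 * (Real.sin (β r) * Real.cos (β r) * Real.cos (α r) * Real.sin (α r) +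
      Real.sin (β r) * Real.sin (β r) * Real.sin (α r) * Real.sin (α r)) = φ r
    linear_combination this
  have hsa : ∀ f : C(spectrum ℝ p, ℝ), IsSelfAdjoint (Φ f) := cfcHom_predicate hp
  refine ⟨Φ C, Φ S, Φ D, Φ T, Φ q, hsa C, hsa S, hsa D, hsa T, ?_, ?_, ?_, ?_, hsa q,
    ?_, ?_⟩
  · rw [← map_mul, ← map_mul, ← map_add, hCS, map_one]
  · rw [← map_mul, ← map_mul, ← map_add, hDT, map_one]
  · conv_rhs => rw [hid, ← hpe]
    simp only [map_smul, map_add, map_mul]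
  · rw [← hqe]
    simp only [map_smul, map_add, map_mul]
  · rw [← hq]
    exact cfc_nonneg fun r hr => (h r (hsp hr)).1.1
  · rw [← hq]
    exact cfc_le_algebraMap _ _ _ (fun r hr => (h r (hsp hr)).1.2) hφ.continuousOn hp

/-- A proper edge colouring of the rooted `k`-ary tree, whose vertices are words in `Fin k`: the
colour of a nonempty word is that of the edge to its parent. -/
def treeColor {k : ℕ} : List (Fin k) → Fin (k + 1)
  | [] => 0
  | j :: v => treeColor v + j.succ

theorem treeColor_cons_ne {k : ℕ} (j : Fin k) (v : List (Fin k)) :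
    treeColor (j :: v) ≠ treeColor v := by
  simp [treeColor]

theorem exists_treeColor_cons_eq {k : ℕ} {v : List (Fin k)} {i : Fin (k + 1)}
    (h : i ≠ treeColor v) : ∃ j, treeColor (j :: v) = i := by
  obtain ⟨j, hj⟩ := Fin.exists_succ_eq.2 (sub_ne_zero.2 h)
  exact ⟨j, by simp [treeColor, hj]⟩

theorem treeColor_cons_inj {k : ℕ} {j j' : Fin k} {v : List (Fin k)}
    (h : treeColor (j :: v) = treeColor (j' :: v)) : j = j' := by
  simpa [treeColor] using h

section EdgeSpan

variable {H K : Type*} [NormedAddCommGroup H] [InnerProductSpace ℂ H]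
  [NormedAddCommGroup K] [InnerProductSpace ℂ K]
  {k : ℕ} (U : List (Fin k) → K →ₗᵢ[ℂ] H)

/-- The closed span of the vectors `C h + S h`, with `C h` placed at the parent and `S h` at the
child of an edge of colour `i`. -/
def edgeSpan (C S : List (Fin k) → K →L[ℂ] K) (i : Fin (k + 1)) : Submodule ℂ H :=
  (Submodule.span ℂ {y | ∃ v j h, treeColor (j :: v) = i ∧
    y = U v (C v h) + U (j :: v) (S v h)}).topologicalClosure

instance [CompleteSpace H] (C S : List (Fin k) → K →L[ℂ] K) (i : Fin (k + 1)) :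
    CompleteSpace (edgeSpan U C S i) :=
  inferInstanceAs (CompleteSpace (Submodule.topologicalClosure _))

variable {U}

theorem mem_edgeSpan (C S : List (Fin k) → K →L[ℂ] K) (v : List (Fin k)) (j : Fin k) (h : K) :
    U v (C v h) + U (j :: v) (S v h) ∈ edgeSpan U C S (treeColor (j :: v)) :=
  Submodule.le_topologicalClosure _ (Submodule.subset_span ⟨v, j, h, rfl, rfl⟩)

theorem mem_edgeSpan_orthogonal {C S : List (Fin k) → K →L[ℂ] K} {i : Fin (k + 1)} {y : H}
    (hy : ∀ v j h, treeColor (j :: v) = i → ⟪U v (C v h) + U (j :: v) (S v h), y⟫ = 0) :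
    y ∈ (edgeSpan U C S i)ᗮ := by
  rw [edgeSpan, Submodule.orthogonal_closure, Submodule.mem_orthogonal]
  intro u hu
  induction hu using Submodule.span_induction with
  | mem u hu =>
    obtain ⟨v, j, h, hi, rfl⟩ := hu
    exact hy v j h hi
  | zero => simp
  | add a b _ _ ha hb => rw [inner_add_left, ha, hb, add_zero]
  | smul c a _ ha => rw [inner_smul_left, ha, mul_zero]

variable (hU : ∀ v w, v ≠ w → ∀ a b, ⟪U v a, U w b⟫ = 0)

include hU

/-- Inner product of vectors supported on two edges of the same colour. -/
theorem inner_edge {v v' : List (Fin k)} {j j' : Fin k}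
    (hc : treeColor (j' :: v') = treeColor (j :: v)) (a b a' b' : K) (hne : (v', j') ≠ (v, j)) :
    ⟪U v' a' + U (j' :: v') b', U v a + U (j :: v) b⟫ = 0 := by
  have h1 : v' ≠ v := by
    rintro rfl
    exact hne (by rw [treeColor_cons_inj hc])
  have h2 : v' ≠ j :: v := by
    rintro rfl
    exact treeColor_cons_ne _ _ hc
  have h3 : j' :: v' ≠ v := by
    rintro rfl
    exact treeColor_cons_ne _ _ hc.symm
  have h4 : j' :: v' ≠ j :: v := fun h => h1 (List.cons.inj h).2
  rw [inner_add_left, inner_add_right, inner_add_right, hU _ _ h1, hU _ _ h2, hU _ _ h3,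
    hU _ _ h4]
  simp

theorem inner_edge_self (v : List (Fin k)) (j : Fin k) (a b a' b' : K) :
    ⟪U v a' + U (j :: v) b', U v a + U (j :: v) b⟫ = ⟪a', a⟫ + ⟪b', b⟫ := by
  have h1 : v ≠ j :: v := (List.cons_ne_self j v).symm
  rw [inner_add_left, inner_add_right, inner_add_right, hU _ _ h1, hU _ _ h1.symm]
  simp

theorem starProjection_edgeSpan_nil [CompleteSpace H]
    (C S : List (Fin k) → K →L[ℂ] K) (a : K) :
    (edgeSpan U C S 0).starProjection (U [] a) = 0 := by
  refine Submodule.eq_starProjection_of_mem_orthogonal (Submodule.zero_mem _)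
    (mem_edgeSpan_orthogonal fun v' j' h hi => ?_)
  have h1 : v' ≠ [] := by
    rintro rfl
    exact treeColor_cons_ne _ _ hi
  rw [sub_zero, inner_add_left, hU _ _ h1, hU _ _ (by simp), add_zero]

variable [CompleteSpace H] [CompleteSpace K] {C S : List (Fin k) → K →L[ℂ] K}
  (hC : ∀ v, IsSelfAdjoint (C v)) (hS : ∀ v, IsSelfAdjoint (S v))
  (hCS : ∀ v, C v * C v + S v * S v = 1)

include hC hS hCS

theorem starProjection_edgeSpan_edge (v : List (Fin k)) (j : Fin k) (a b : K) :
    (edgeSpan U C S (treeColor (j :: v))).starProjection (U v a + U (j :: v) b) =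
      U v (C v (C v a + S v b)) + U (j :: v) (S v (C v a + S v b)) := by
  refine Submodule.eq_starProjection_of_mem_orthogonal (mem_edgeSpan C S v j _)
    (mem_edgeSpan_orthogonal fun v' j' h hi => ?_)
  rw [add_sub_add_comm, ← map_sub, ← map_sub]
  by_cases hne : (v', j') = (v, j)
  · obtain ⟨rfl, rfl⟩ := Prod.mk.inj hne
    rw [inner_edge_self hU]
    have e1 := (ContinuousLinearMap.isSelfAdjoint_iff_isSymmetric.1 (hC v')) h
    have e2 := (ContinuousLinearMap.isSelfAdjoint_iff_isSymmetric.1 (hS v')) h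
    simp only [ContinuousLinearMap.coe_coe] at e1 e2
    rw [e1, e2, ← inner_add_right]
    have e3 := DFunLike.congr_fun (hCS v') (C v' a + S v' b)
    rw [add_apply, one_apply_eq_self, mul_apply_eq_comp, mul_apply_eq_comp] at e3
    rw [map_sub, map_sub, sub_add_sub_comm, e3, sub_self, inner_zero_right]
  · exact inner_edge hU hi _ _ _ _ hne

variable {D T : List (Fin k) → K →L[ℂ] K} (hD : ∀ v, IsSelfAdjoint (D v))
  (hT : ∀ v, IsSelfAdjoint (T v)) (hDT : ∀ v, D v * D v + T v * T v = 1)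

include hD hT hDT

theorem sum_starProjection_edge (v : List (Fin k)) (j : Fin k) (a b : K) :
    (edgeSpan U D T (treeColor (j :: v))).starProjection
        ((edgeSpan U C S (treeColor (j :: v))).starProjection (U v a + U (j :: v) b)) +
      (edgeSpan U D (-T) (treeColor (j :: v))).starProjection
        ((edgeSpan U C (-S) (treeColor (j :: v))).starProjection (U v a + U (j :: v) b)) =
      U v (((2 : ℝ) • (D v * D v * C v * C v + D v * T v * S v * C v)) a) +
      U (j :: v) (((2 : ℝ) • (T v * D v * C v * S v + T v * T v * S v * S v)) b) := by
  rw [starProjection_edgeSpan_edge hU hC hS hCS, starProjection_edgeSpan_edge hU hD hT hDT,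
    starProjection_edgeSpan_edge hU hC (S := -S) (fun v => (hS v).neg)
      (fun v => by simpa using hCS v),
    starProjection_edgeSpan_edge hU hD (S := -T) (fun v => (hT v).neg)
      (fun v => by simpa using hDT v)]
  rw [add_add_add_comm, ← map_add, ← map_add]
  simp only [Pi.neg_apply, neg_apply, map_add, map_neg, neg_neg, two_smul,
    add_apply, mul_apply_eq_comp]
  abel

theorem sum_starProjection_edgeSpan {p q : List (Fin k) → K →L[ℂ] K}
    (hp : ∀ v, (2 : ℝ) • (D v * D v * C v * C v + D v * T v * S v * C v) = p v)
    (hq : ∀ v, (2 : ℝ) • (T v * D v * C v * S v + T v * T v * S v * S v) = q v)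
    {x : H →L[ℂ] H} {y q₀ : List (Fin k) → K →L[ℂ] K}
    (hx : ∀ v h, x (U v h) = U v (y v h)) (hy : ∀ v, y v = (k : ℝ) • p v + q₀ v)
    (hq₀ : q₀ [] = 0) (hq₁ : ∀ j v, q₀ (j :: v) = q v)
    (htot : (⨆ v, LinearMap.range (U v).toLinearMap).topologicalClosure = ⊤) :
    x = ∑ i, ((edgeSpan U D T i).starProjection ∘L (edgeSpan U C S i).starProjection +
      (edgeSpan U D (-T) i).starProjection ∘L (edgeSpan U C (-S) i).starProjection) := by
  have hedge := sum_starProjection_edge hU hC hS hCS hD hT hDT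
  simp only [hp, hq] at hedge
  have key : ∀ v h, x (U v h) = (∑ i, ((edgeSpan U D T i).starProjection ∘L
      (edgeSpan U C S i).starProjection + (edgeSpan U D (-T) i).starProjection ∘L
        (edgeSpan U C (-S) i).starProjection)) (U v h) := by
    intro v h
    simp only [sum_apply, add_apply,
      ContinuousLinearMap.comp_apply]
    rw [← Finset.add_sum_erase _ _ (Finset.mem_univ (treeColor v)),
      Finset.sum_congr rfl (g := fun _ => U v (p v h)), hx, hy]
    · rw [Finset.sum_const, Finset.card_erase_of_mem (Finset.mem_univ _)]
      have h0 : (edgeSpan U D T (treeColor v)).starProjection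
          ((edgeSpan U C S (treeColor v)).starProjection (U v h)) +
          (edgeSpan U D (-T) (treeColor v)).starProjection
          ((edgeSpan U C (-S) (treeColor v)).starProjection (U v h)) = U v (q₀ v h) := by
        cases v with
        | nil =>
          rw [treeColor, starProjection_edgeSpan_nil hU, starProjection_edgeSpan_nil hU, hq₀]
          simp
        | cons j v =>
          have := hedge v j 0 h
          simpa [hq₁] using this
      rw [h0, Finset.card_univ, Fintype.card_fin, Nat.add_sub_cancel,
        add_apply, map_add, smul_apply,
        Nat.cast_smul_eq_nsmul, map_nsmul, add_comm]
    · intro i hi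
      obtain ⟨j, rfl⟩ := exists_treeColor_cons_eq (by simpa using hi : i ≠ treeColor v)
      simpa using hedge v j h 0
  have hle : (⨆ v, LinearMap.range (U v).toLinearMap).topologicalClosure ≤
      LinearMap.eqLocus x.toLinearMap (∑ i, ((edgeSpan U D T i).starProjection ∘L
      (edgeSpan U C S i).starProjection + (edgeSpan U D (-T) i).starProjection ∘L
        (edgeSpan U C (-S) i).starProjection)).toLinearMap := by
    refine Submodule.topologicalClosure_minimal _ (iSup_le fun v => ?_)
      (isClosed_eq (ContinuousLinearMap.continuous _) (ContinuousLinearMap.continuous _))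
    rintro _ ⟨h, rfl⟩
    exact key v h
  ext z
  exact hle (htot ▸ Submodule.mem_top : z ∈ _)

end EdgeSpan

section Orbits

variable {N : Type*} [NormedAddCommGroup N] [InnerProductSpace ℂ N]

theorem eq_zero_of_aeval_apply_eq_zero {y : N →L[ℂ] N}
    (hy : ∀ (c : ℂ) (v : N), y v = c • v → v = 0) {p : Polynomial ℂ} (hp : p ≠ 0) {v : N}
    (hv : Polynomial.aeval y p v = 0) : v = 0 := by
  have hprod : ∀ (s : Multiset ℂ) (w : N),
      Polynomial.aeval y (s.map fun a => Polynomial.X - Polynomial.C a).prod w = 0 → w = 0 := by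
    intro s
    induction s using Multiset.induction with
    | empty => simp
    | cons a s ih =>
      intro w hw
      rw [Multiset.map_cons, Multiset.prod_cons, map_mul, mul_apply_eq_comp] at hw
      refine ih w (hy a _ ?_)
      simpa [sub_eq_zero, Algebra.algebraMap_eq_smul_one] using hw
  rw [(IsAlgClosed.splits p).eq_prod_roots, map_mul, mul_apply_eq_comp] at hv
  refine hprod p.roots v ((smul_eq_zero_iff_right (Polynomial.leadingCoeff_ne_zero.2 hp)).1 ?_)
  simpa [Algebra.algebraMap_eq_smul_one] using hv

theorem linearIndependent_pow_apply {y : N →L[ℂ] N}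
    (hy : ∀ (c : ℂ) (v : N), y v = c • v → v = 0) {v : N} (hv : v ≠ 0) :
    LinearIndependent ℂ fun k : ℕ => (y ^ k) v := by
  let L : Polynomial ℂ →ₗ[ℂ] N :=
    { toFun := fun p => Polynomial.aeval y p v
      map_add' := by simp
      map_smul' := by simp }
  have hL : LinearMap.ker L = ⊥ := by
    rw [LinearMap.ker_eq_bot']
    intro p hp
    by_contra hne
    exact hv (eq_zero_of_aeval_apply_eq_zero hy hne hp)
  simpa [L, Function.comp_def] using (Polynomial.basisMonomials ℂ).linearIndependent.map' L hL

variable [CompleteSpace N]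

theorem infinite_spectrum_of_forall_eq_zero [Nontrivial N] {y : N →L[ℂ] N}
    (hsa : IsSelfAdjoint y) (hy : ∀ (c : ℂ) (v : N), y v = c • v → v = 0) :
    (spectrum ℝ y).Infinite := by
  intro hfin
  obtain ⟨v, hv⟩ := exists_ne (0 : N)
  set p : Polynomial ℝ := ∏ r ∈ hfin.toFinset, (Polynomial.X - Polynomial.C r) with hp
  have hp0 : p.Monic := Polynomial.monic_prod_of_monic _ _ fun r _ => Polynomial.monic_X_sub_C r
  have hz : Polynomial.aeval y p = 0 := by
    rw [← cfc_polynomial p y hsa, ← cfc_zero ℝ y]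
    refine cfc_congr fun r hr => ?_
    rw [hp, Polynomial.eval_prod]
    exact Finset.prod_eq_zero (hfin.mem_toFinset.2 hr) (by simp)
  refine hv (eq_zero_of_aeval_apply_eq_zero hy (p := p.map (algebraMap ℝ ℂ))
    ((hp0.map _).ne_zero) ?_)
  rw [Polynomial.aeval_map_algebraMap, hz, zero_apply]

/-- A self-adjoint operator without eigenvectors has infinitely many mutually orthogonal orbits. -/
theorem exists_seq_orthogonal_orbits [Nontrivial N] {y : N →L[ℂ] N}
    (hsa : IsSelfAdjoint y) (hy : ∀ (c : ℂ) (v : N), y v = c • v → v = 0) :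
    ∃ v : ℕ → N, (∀ n, v n ≠ 0) ∧
      ∀ n m, n ≠ m → ∀ i j : ℕ, ⟪(y ^ i) (v n), (y ^ j) (v m)⟫ = 0 := by
  have : Infinite (spectrum ℝ y) := (infinite_spectrum_of_forall_eq_zero hsa hy).to_subtype
  obtain ⟨O, hOi, hOo, hOd⟩ := exists_seq_infinite_isOpen_pairwise_disjoint (spectrum ℝ y)
  set Φ := cfcHom (R := ℝ) hsa
  have hOc : ∀ n, (O n)ᶜ.Nonempty := fun n => by
    obtain ⟨a, ha⟩ := (hOi (n + 1)).nonempty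
    exact ⟨a, (Set.disjoint_left.1 (hOd (Nat.succ_ne_self n)) ha)⟩
  let f : ℕ → C(spectrum ℝ y, ℝ) := fun n =>
    ⟨fun r => Metric.infDist r (O n)ᶜ, Metric.continuous_infDist_pt _⟩
  have hf0 : ∀ n, f n ≠ 0 := fun n h => by
    obtain ⟨a, ha⟩ := (hOi n).nonempty
    have h0 : Metric.infDist a (O n)ᶜ = 0 := DFunLike.congr_fun h a
    exact ((hOo n).isClosed_compl.mem_iff_infDist_zero (hOc n)).2 h0 ha
  have hff : ∀ n m, n ≠ m → f n * f m = 0 := fun n m hnm => by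
    ext r
    change Metric.infDist r (O n)ᶜ * Metric.infDist r (O m)ᶜ = 0
    by_cases hr : r ∈ O n
    · rw [Metric.infDist_zero_of_mem (s := (O m)ᶜ) (Set.disjoint_left.1 (hOd hnm) hr), mul_zero]
    · rw [Metric.infDist_zero_of_mem (s := (O n)ᶜ) hr, zero_mul]
  have hw : ∀ n, ∃ w, Φ (f n) w ≠ 0 := fun n => by
    by_contra! h
    refine hf0 n (cfcHom_injective hsa ?_)
    rw [map_zero]
    exact ContinuousLinearMap.ext h
  choose w hw using hw
  refine ⟨fun n => Φ (f n) (w n), hw, fun n m hnm i j => ?_⟩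
  have hid : y = Φ ((ContinuousMap.id ℝ).restrict (spectrum ℝ y)) := (cfcHom_id hsa).symm
  set X := (ContinuousMap.id ℝ).restrict (spectrum ℝ y)
  have hs : IsSelfAdjoint (Φ (X ^ i * f n)) := cfcHom_predicate hsa _
  have e : ∀ (l k : ℕ), (y ^ l) (Φ (f k) (w k)) = Φ (X ^ l * f k) (w k) := fun l k => by
    rw [map_mul, map_pow, ← hid, mul_apply_eq_comp]
  rw [e, e]
  have := ContinuousLinearMap.isSelfAdjoint_iff_isSymmetric.1 hs (w n) (Φ (X ^ j * f m) (w m))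
  simp only [ContinuousLinearMap.coe_coe] at this
  rw [this, ← mul_apply_eq_comp, ← map_mul,
    show X ^ i * f n * (X ^ j * f m) = X ^ i * X ^ j * (f n * f m) by ring, hff n m hnm]
  simp

theorem exists_orthonormal_array [Nontrivial N] {y : N →L[ℂ] N}
    (hsa : IsSelfAdjoint y) (hy : ∀ (c : ℂ) (v : N), y v = c • v → v = 0) :
    ∃ e : ℕ → ℕ → N, (∀ k n, ‖e k n‖ = 1) ∧
      (∀ k n k' n', (k, n) ≠ (k', n') → ⟪e k n, e k' n'⟫ = 0) ∧
      ∀ k n, y (e k n) ∈ Submodule.span ℂ (Set.range fun k' => e k' n) := by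
  obtain ⟨v, hv, horth⟩ := exists_seq_orthogonal_orbits hsa hy
  have hli := fun n => linearIndependent_pow_apply hy (hv n)
  have hspan : ∀ n, Submodule.span ℂ (Set.range fun k =>
      InnerProductSpace.gramSchmidtNormed ℂ (fun k : ℕ => (y ^ k) (v n)) k) =
      Submodule.span ℂ (Set.range fun k : ℕ => (y ^ k) (v n)) := fun n => by
    rw [InnerProductSpace.span_gramSchmidtNormed_range, InnerProductSpace.span_gramSchmidt]
  refine ⟨fun k n => InnerProductSpace.gramSchmidtNormed ℂ (fun k : ℕ => (y ^ k) (v n)) k,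
    fun k n => InnerProductSpace.gramSchmidtNormed_unit_length k (hli n), ?_, ?_⟩
  · intro k n k' n' hne
    by_cases hn : n = n'
    · subst hn
      exact (InnerProductSpace.gramSchmidtNormed_orthonormal (hli n)).2
        (fun h => hne (by rw [h]))
    · have hle : Submodule.span ℂ (Set.range fun k : ℕ => (y ^ k) (v n)) ⟂
          Submodule.span ℂ (Set.range fun k : ℕ => (y ^ k) (v n')) := by
        rw [Submodule.isOrtho_span]
        rintro _ ⟨i, rfl⟩ _ ⟨j, rfl⟩
        exact horth n n' hn i j
      refine hle.inner_eq ?_ ?_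
      · rw [← hspan]; exact Submodule.subset_span ⟨k, rfl⟩
      · rw [← hspan]; exact Submodule.subset_span ⟨k', rfl⟩
  · intro k n
    rw [hspan]
    have hk : InnerProductSpace.gramSchmidtNormed ℂ (fun k : ℕ => (y ^ k) (v n)) k ∈
        Submodule.span ℂ (Set.range fun k : ℕ => (y ^ k) (v n)) := by
      rw [← hspan]; exact Submodule.subset_span ⟨k, rfl⟩
    have hle : Submodule.span ℂ (Set.range fun k : ℕ => (y ^ k) (v n)) ≤
        (Submodule.span ℂ (Set.range fun k : ℕ => (y ^ k) (v n))).comap y.toLinearMap := by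
      rw [Submodule.span_le]
      rintro _ ⟨i, rfl⟩
      refine Submodule.subset_span ⟨i + 1, ?_⟩
      simp [pow_succ', mul_apply_eq_comp]
    exact hle hk

end Orbits

/-- `exists_orthonormal_array` inside an invariant closed subspace. -/
theorem exists_orthonormal_array_mem {H : Type*} [NormedAddCommGroup H] [InnerProductSpace ℂ H]
    [CompleteSpace H] {x : H →L[ℂ] H} (hx : IsSelfAdjoint x)
    (M : Submodule ℂ H) [CompleteSpace M] (hM : ∀ z ∈ M, x z ∈ M) (hne : M ≠ ⊥)
    (hev : ∀ (c : ℂ), ∀ v ∈ M, x v = c • v → v = 0) :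
    ∃ e : ℕ → ℕ → H, (∀ k n, e k n ∈ M) ∧ (∀ k n, ‖e k n‖ = 1) ∧
      (∀ k n k' n', (k, n) ≠ (k', n') → ⟪e k n, e k' n'⟫ = 0) ∧
      ∀ k n, x (e k n) ∈ Submodule.span ℂ (Set.range fun k' => e k' n) := by
  have : Nontrivial M := (Submodule.nontrivial_iff_ne_bot).2 hne
  let y : M →L[ℂ] M := (x ∘L M.subtypeL).codRestrict M fun z => hM z z.2
  have hcoe : ∀ z : M, ((y z : M) : H) = x z := fun z => rfl
  have hsa : IsSelfAdjoint y := by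
    rw [ContinuousLinearMap.isSelfAdjoint_iff_isSymmetric]
    intro a b
    exact ContinuousLinearMap.isSelfAdjoint_iff_isSymmetric.1 hx (a : H) (b : H)
  obtain ⟨e, h1, h2, h3⟩ := exists_orthonormal_array hsa fun c v hv =>
    Subtype.ext (hev c v v.2 (by rw [← hcoe, hv]; rfl))
  refine ⟨fun k n => e k n, fun k n => (e k n).2, h1, h2, fun k n => ?_⟩
  have := Submodule.mem_map_of_mem (f := M.subtype) (h3 k n)
  rw [Submodule.map_span, ← Set.range_comp] at this
  exact this

theorem exists_maximal_pairwise {α : Type*} {A : α → Prop} {r : α → α → Prop} {S₀ : Set α}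
    (hA : ∀ a ∈ S₀, A a) (hr : S₀.Pairwise r) :
    ∃ S, S₀ ⊆ S ∧ (∀ a ∈ S, A a) ∧ S.Pairwise r ∧
      ∀ a, A a → (∀ b ∈ S, r a b ∧ r b a) → a ∈ S := by
  obtain ⟨S, hS₀, hS⟩ := zorn_subset_nonempty {S : Set α | (∀ a ∈ S, A a) ∧ S.Pairwise r}
    (fun c hc hchain _ => ⟨⋃₀ c, ⟨fun a ⟨s, hs, ha⟩ => (hc hs).1 a ha,
      (Set.pairwise_sUnion hchain.directedOn).2 fun s hs => (hc hs).2⟩,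
      fun s hs => Set.subset_sUnion_of_mem hs⟩) S₀ ⟨hA, hr⟩
  refine ⟨S, hS₀, hS.prop.1, hS.prop.2, fun a ha hra => ?_⟩
  refine hS.le_of_ge (y := insert a S) ⟨?_, ?_⟩ (Set.subset_insert a S) (Set.mem_insert a S)
  · rintro b (rfl | hb)
    exacts [ha, hS.prop.1 b hb]
  · exact hS.prop.2.insert fun b hb _ => hra b hb

section Levels

universe u

variable {H : Type u} [NormedAddCommGroup H] [InnerProductSpace ℂ H]

/-- An orthonormal array whose columns span `x`-invariant subspaces. -/
structure IsInvariantArray (x : H →L[ℂ] H) (B : ℕ → ℕ → H) : Prop where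
  norm_eq_one : ∀ k n, ‖B k n‖ = 1
  inner_eq_zero : ∀ k n k' n', (k, n) ≠ (k', n') → ⟪B k n, B k' n'⟫ = 0
  apply_mem : ∀ k n, x (B k n) ∈ Submodule.span ℂ (Set.range fun k' => B k' n)

theorem exists_maximal_eigenvectors (x : H →L[ℂ] H) :
    ∃ E : Set H, (∀ e ∈ E, ‖e‖ = 1 ∧ ∃ c : ℂ, x e = c • e) ∧
      (E.Pairwise fun a b => ⟪a, b⟫ = 0) ∧
      ∀ (c : ℂ) w, x w = c • w → (∀ e ∈ E, ⟪e, w⟫ = 0) → w = 0 := by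
  obtain ⟨E, -, hA, hr, hmax⟩ := exists_maximal_pairwise (S₀ := (∅ : Set H))
    (A := fun e : H => ‖e‖ = 1 ∧ ∃ c : ℂ, x e = c • e) (r := fun a b => ⟪a, b⟫ = 0)
    (by simp) (by simp)
  refine ⟨E, hA, hr, fun c w hw hE => ?_⟩
  by_contra h0
  have hmem := hmax ((‖w‖ : ℂ)⁻¹ • w) ⟨by simp [norm_smul, h0], c, by
    rw [map_smul, hw, smul_comm]⟩ fun e he => by
      constructor
      · rw [inner_smul_left, inner_eq_zero_symm.1 (hE e he), mul_zero]
      · rw [inner_smul_right, hE e he, mul_zero]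
  have := hE _ hmem
  rw [inner_smul_left, inner_self_eq_norm_sq_to_K] at this
  simp [h0] at this

/-- The eigenvectors of `x` are exhausted either by a finite set or by invariant arrays. -/
theorem exists_finite_eigenvectors_and_arrays (x : H →L[ℂ] H) :
    ∃ (F : Set H) (S : Set (ℕ → ℕ → H)), F.Finite ∧
      (F = ∅ ∨ S = ∅) ∧
      (∀ e ∈ F, ‖e‖ = 1 ∧ ∃ c : ℂ, x e = c • e) ∧ (F.Pairwise fun a b => ⟪a, b⟫ = 0) ∧
      (∀ B ∈ S, IsInvariantArray x B) ∧
      (S.Pairwise fun B B' => ∀ k n k' n', ⟪B k n, B' k' n'⟫ = 0) ∧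
      ∀ (c : ℂ) w, x w = c • w → (∀ e ∈ F, ⟪e, w⟫ = 0) →
        (∀ B ∈ S, ∀ k n, ⟪B k n, w⟫ = 0) → w = 0 := by
  obtain ⟨E, hE, hEo, hmax⟩ := exists_maximal_eigenvectors x
  by_cases hfin : E.Finite
  · exact ⟨E, ∅, hfin, .inr rfl, hE, hEo, by simp,
      by simp, fun c w hw h _ => hmax c w hw h⟩
  have : Infinite E := Set.infinite_coe_iff.2 hfin
  obtain ⟨g⟩ : Nonempty (E × ℕ × ℕ ≃ E) := by
    rw [← Cardinal.eq]
    simp [Cardinal.aleph0_le_mk]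
  have ho : ∀ s t, s ≠ t → ⟪(g s : H), (g t : H)⟫ = 0 := fun s t hst =>
    hEo (g s).2 (g t).2 fun h => hst (g.injective (Subtype.ext h))
  refine ⟨∅, Set.range fun e k n => (g (e, k, n) : H), Set.finite_empty, .inl rfl, by simp,
    by simp, ?_, ?_, ?_⟩
  · rintro _ ⟨e, rfl⟩
    refine ⟨fun k n => (hE _ (g _).2).1, fun k n k' n' h => ho _ _ (by simpa using h), ?_⟩
    intro k n
    obtain ⟨c, hc⟩ := (hE _ (g (e, k, n)).2).2
    rw [hc]
    exact Submodule.smul_mem _ _ (Submodule.subset_span ⟨k, rfl⟩)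
  · rintro _ ⟨e, rfl⟩ _ ⟨e', rfl⟩ hne k n k' n'
    exact ho _ _ fun h => hne (by rw [show e = e' from (Prod.ext_iff.1 h).1])
  · intro c w hw _ h
    refine hmax c w hw fun e he => ?_
    have := h _ ⟨(g.symm ⟨e, he⟩).1, rfl⟩ (g.symm ⟨e, he⟩).2.1 (g.symm ⟨e, he⟩).2.2
    simpa using this

variable [CompleteSpace H]

theorem apply_mem_orthogonal_span {x : H →L[ℂ] H} (hx : IsSelfAdjoint x) {s : Set H}
    (hs : ∀ a ∈ s, x a ∈ Submodule.span ℂ s) {z : H} (hz : z ∈ (Submodule.span ℂ s)ᗮ) :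
    x z ∈ (Submodule.span ℂ s)ᗮ := by
  rw [Submodule.mem_orthogonal]
  intro w hw
  have hle : Submodule.span ℂ s ≤ (Submodule.span ℂ s).comap x.toLinearMap :=
    Submodule.span_le.2 hs
  have := ContinuousLinearMap.isSelfAdjoint_iff_isSymmetric.1 hx w z
  simp only [ContinuousLinearMap.coe_coe] at this
  rw [← this]
  exact Submodule.mem_orthogonal _ _ |>.1 hz _ (hle hw)

theorem exists_total_eigenvectors_and_arrays {x : H →L[ℂ] H} (hx : IsSelfAdjoint x) :
    ∃ (F : Set H) (S : Set (ℕ → ℕ → H)), F.Finite ∧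
      (∀ e ∈ F, ‖e‖ = 1 ∧ ∃ c : ℂ, x e = c • e) ∧ (F.Pairwise fun a b => ⟪a, b⟫ = 0) ∧
      (∀ B ∈ S, IsInvariantArray x B ∧ ∀ k n, ∀ e ∈ F, ⟪e, B k n⟫ = 0) ∧
      (S.Pairwise fun B B' => ∀ k n k' n', ⟪B k n, B' k' n'⟫ = 0) ∧
      ∀ w, (∀ e ∈ F, ⟪e, w⟫ = 0) → (∀ B ∈ S, ∀ k n, ⟪B k n, w⟫ = 0) → w = 0 := by
  obtain ⟨F, S₀, hF, hor, hF1, hFo, hS, hSo, hev⟩ := exists_finite_eigenvectors_and_arrays x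
  obtain ⟨S, hS₀, hSA, hSr, hmax⟩ := exists_maximal_pairwise (S₀ := S₀)
    (A := fun B => IsInvariantArray x B ∧ ∀ k n, ∀ e ∈ F, ⟪e, B k n⟫ = 0)
    (r := fun B B' => ∀ k n k' n', ⟪B k n, B' k' n'⟫ = 0)
    (fun B hB => ⟨hS B hB, fun k n e he => by
      rcases hor with h | h
      · simp [h] at he
      · simp [h] at hB⟩) hSo
  refine ⟨F, S, hF, hF1, hFo, hSA, hSr, ?_⟩
  set s : Set H := F ∪ {z | ∃ B ∈ S, ∃ k n, B k n = z} with hs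
  set M := (Submodule.span ℂ s)ᗮ with hM
  have hmem : ∀ w, w ∈ M ↔ (∀ e ∈ F, ⟪e, w⟫ = 0) ∧ ∀ B ∈ S, ∀ k n, ⟪B k n, w⟫ = 0 := by
    intro w
    rw [hM, Submodule.mem_orthogonal]
    constructor
    · exact fun h => ⟨fun e he => h _ (Submodule.subset_span (.inl he)),
        fun B hB k n => h _ (Submodule.subset_span (.inr ⟨B, hB, k, n, rfl⟩))⟩
    · intro h u hu
      have hle : Submodule.span ℂ s ≤ (Submodule.span ℂ {w})ᗮ := by
        rw [Submodule.span_le]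
        rintro z (hz | ⟨B, hB, k, n, rfl⟩)
        · exact Submodule.mem_orthogonal_singleton_iff_inner_left.2 (h.1 z hz)
        · exact Submodule.mem_orthogonal_singleton_iff_inner_left.2 (h.2 B hB k n)
      exact Submodule.mem_orthogonal_singleton_iff_inner_left.1 (hle hu)
  suffices M = ⊥ from fun w h₁ h₂ => by
    have hw := (hmem w).2 ⟨h₁, h₂⟩
    rwa [this, Submodule.mem_bot] at hw
  by_contra hne
  obtain ⟨e, heM, he1, heo, hex⟩ := exists_orthonormal_array_mem hx M
    (fun z hz => apply_mem_orthogonal_span hx (by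
      rintro z (hz | ⟨B, hB, k, n, rfl⟩)
      · obtain ⟨c, hc⟩ := (hF1 z hz).2
        rw [hc]
        exact Submodule.smul_mem _ _ (Submodule.subset_span (.inl hz))
      · refine Submodule.span_mono ?_ ((hSA B hB).1.apply_mem k n)
        rintro _ ⟨k', rfl⟩
        exact .inr ⟨B, hB, k', n, rfl⟩) hz) hne
    fun c v hv hxv => hev c v hxv ((hmem v).1 hv).1 fun B hB => ((hmem v).1 hv).2 B (hS₀ hB)
  have heS := hmax e ⟨⟨he1, heo, hex⟩, fun k n => ((hmem _).1 (heM k n)).1⟩ fun B hB =>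
    ⟨fun k n k' n' => inner_eq_zero_symm.1 (((hmem _).1 (heM k n)).2 B hB k' n'),
      fun k n k' n' => ((hmem _).1 (heM k' n')).2 B hB k n⟩
  have h0 : ⟪e 0 0, e 0 0⟫ = 0 := ((hmem _).1 (heM 0 0)).2 e heS 0 0
  have h1 := he1 0 0
  rw [inner_self_eq_zero.1 h0, norm_zero] at h1
  exact zero_ne_one h1

/-- A self-adjoint operator on an infinite-dimensional space is block diagonal with infinitely many
blocks of the same size. -/
theorem exists_orthonormal_levels (hinf : ¬ FiniteDimensional ℂ H) {x : H →L[ℂ] H}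
    (hx : IsSelfAdjoint x) :
    ∃ (ι : Type u) (b : ℕ → ι → H), (∀ n i, ‖b n i‖ = 1) ∧
      (∀ n i m j, (n, i) ≠ (m, j) → ⟪b n i, b m j⟫ = 0) ∧
      (∀ n i, x (b n i) ∈ Submodule.span ℂ (Set.range (b n))) ∧
      ∀ w, (∀ n i, ⟪b n i, w⟫ = 0) → w = 0 := by
  obtain ⟨F, S, hF, hF1, hFo, hSA, hSo, htot⟩ := exists_total_eigenvectors_and_arrays hx
  have : Finite F := hF
  have hne : Nonempty S := by
    rw [Set.nonempty_coe_sort, Set.nonempty_iff_ne_empty]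
    rintro rfl
    have hfd : FiniteDimensional ℂ (Submodule.span ℂ F) := FiniteDimensional.span_of_finite ℂ hF
    have htop : Submodule.span ℂ F = ⊤ := by
      rw [← Submodule.orthogonal_eq_bot_iff, Submodule.eq_bot_iff]
      exact fun w hw => htot w (fun e he => (Submodule.mem_orthogonal _ _).1 hw e
        (Submodule.subset_span he)) (by simp)
    rw [htop] at hfd
    exact hinf (Module.Finite.equiv (Submodule.topEquiv (R := ℂ) (M := H)))
  obtain ⟨g⟩ : Nonempty (S × ℕ ≃ F ⊕ S × ℕ) := by
    rw [← Cardinal.eq, Cardinal.mk_sum, Cardinal.lift_id, Cardinal.lift_id]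
    exact (Cardinal.add_eq_right (Cardinal.aleph0_le_mk _)
      ((Cardinal.mk_lt_aleph0 (α := F)).le.trans (Cardinal.aleph0_le_mk _))).symm
  let f : F ⊕ S × ℕ → H := Sum.elim (fun e => e) fun B => B.1.1 B.2 0
  let b : ℕ → S × ℕ → H := fun n i => n.casesOn (f (g i)) fun n => i.1.1 i.2 (n + 1)
  have hb : ∀ n i, (∃ e : F, n = 0 ∧ g i = .inl e ∧ b n i = e) ∨
      ∃ j : S × ℕ, b n i = j.1.1 j.2 n ∧ (n = 0 → g i = .inr j) ∧ (n ≠ 0 → i = j) := by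
    rintro (_ | n) i
    · rcases hg : g i with e | j
      · exact .inl ⟨e, rfl, rfl, by simp [b, f, hg]⟩
      · exact .inr ⟨j, by simp [b, f, hg], by simp, by simp⟩
    · exact .inr ⟨i, rfl, by simp, by simp⟩
  have hcol : ∀ (j : S × ℕ) n, ∃ i, b n i = j.1.1 j.2 n := by
    rintro j (_ | n)
    · exact ⟨g.symm (.inr j), by simp [b, f]⟩
    · exact ⟨j, rfl⟩
  have hcolF : ∀ e : F, ∃ i, b 0 i = e := fun e => ⟨g.symm (.inl e), by simp [b, f]⟩
  refine ⟨S × ℕ, b, fun n i => ?_, fun n i m j hij => ?_, fun n i => ?_, fun w hw => ?_⟩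
  · rcases hb n i with ⟨e, -, -, h⟩ | ⟨j, h, -⟩
    · rw [h]; exact (hF1 e e.2).1
    · rw [h]; exact (hSA _ j.1.2).1.norm_eq_one _ _
  · rcases hb n i with ⟨e, rfl, hi, h⟩ | ⟨s, h, hi, hi'⟩ <;>
      rcases hb m j with ⟨e', rfl, hj, h'⟩ | ⟨t, h', hj, hj'⟩ <;> rw [h, h']
    · refine hFo e.2 e'.2 fun hee => hij ?_
      rw [g.injective (hi.trans ((congrArg Sum.inl (Subtype.ext hee)).trans hj.symm))]
    · exact (hSA _ t.1.2).2 _ _ _ e.2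
    · exact inner_eq_zero_symm.1 ((hSA _ s.1.2).2 _ _ _ e'.2)
    · by_cases hst : s.1 = t.1
      · rw [← hst]
        refine (hSA _ s.1.2).1.inner_eq_zero _ _ _ _ fun hk => hij ?_
        obtain ⟨hk, rfl⟩ := Prod.ext_iff.1 hk
        obtain rfl : s = t := Prod.ext hst hk
        rcases eq_or_ne n 0 with hn | hn
        · rw [g.injective ((hi hn).trans (hj hn).symm)]
        · rw [hi' hn, hj' hn]
      · exact hSo s.1.2 t.1.2 (fun h => hst (Subtype.ext h)) _ _ _ _
  · rcases hb n i with ⟨e, rfl, hi, h⟩ | ⟨s, h, -⟩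
    · obtain ⟨c, hc⟩ := (hF1 e e.2).2
      rw [h, hc, ← h]
      exact Submodule.smul_mem _ _ (Submodule.subset_span ⟨i, rfl⟩)
    · rw [h]
      refine Submodule.span_mono ?_ ((hSA _ s.1.2).1.apply_mem s.2 n)
      rintro _ ⟨k, rfl⟩
      exact hcol (s.1, k) n
  · refine htot w (fun e he => ?_) fun B hB k n => ?_
    · obtain ⟨i, hi⟩ := hcolF ⟨e, he⟩
      have := hw 0 i
      rwa [hi] at this
    · obtain ⟨i, hi⟩ := hcol (⟨B, hB⟩, k) n
      have := hw n i
      rwa [hi] at this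

/-- Coordinate-free form of `exists_orthonormal_levels`. -/
theorem exists_isometries_of_isSelfAdjoint (hinf : ¬ FiniteDimensional ℂ H) {x : H →L[ℂ] H}
    (hx : IsSelfAdjoint x) (V : Type*) [Countable V] [Infinite V] :
    ∃ (ι : Type u) (U : V → lp (fun _ : ι => ℂ) 2 →ₗᵢ[ℂ] H),
      (∀ v w, v ≠ w → ∀ a b, ⟪U v a, U w b⟫ = 0) ∧ (∀ v a, ∃ a', x (U v a) = U v a') ∧
      (⨆ v, LinearMap.range (U v).toLinearMap).topologicalClosure = ⊤ := by
  obtain ⟨ι, b, hb1, hbo, hbx, htot⟩ := exists_orthonormal_levels hinf hx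
  obtain ⟨g⟩ : Nonempty (V ≃ ℕ) := nonempty_equiv_of_countable
  have hon : ∀ n, Orthonormal ℂ (b n) := fun n =>
    ⟨hb1 n, fun i j hij => hbo _ _ _ _ (by simp [hij])⟩
  let U : V → lp (fun _ : ι => ℂ) 2 →ₗᵢ[ℂ] H := fun v =>
    (hon (g v)).orthogonalFamily.linearIsometry
  have hrange : ∀ v, LinearMap.range (U v).toLinearMap =
      (Submodule.span ℂ (Set.range (b (g v)))).topologicalClosure := fun v => by
    rw [(hon (g v)).orthogonalFamily.range_linearIsometry, Submodule.span_range_eq_iSup]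
    exact congrArg _ (iSup_congr fun i => LinearMap.range_toSpanSingleton _)
  have hbU : ∀ v i, b (g v) i ∈ LinearMap.range (U v).toLinearMap := fun v i => by
    rw [hrange]
    exact Submodule.le_topologicalClosure _ (Submodule.subset_span ⟨i, rfl⟩)
  refine ⟨ι, U, fun v w hvw a c => ?_, fun v a => ?_, ?_⟩
  · have hle : LinearMap.range (U v).toLinearMap ⟂ LinearMap.range (U w).toLinearMap := by
      rw [hrange, hrange, Submodule.isOrtho_iff_le, Submodule.orthogonal_closure]
      refine Submodule.topologicalClosure_minimal _ ?_ (Submodule.isClosed_orthogonal _)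
      rw [← Submodule.isOrtho_iff_le, Submodule.isOrtho_span]
      rintro _ ⟨i, rfl⟩ _ ⟨j, rfl⟩
      exact hbo _ _ _ _ (by simp [hvw])
    exact hle.inner_eq ⟨a, rfl⟩ ⟨c, rfl⟩
  · have hle : (Submodule.span ℂ (Set.range (b (g v)))).topologicalClosure ≤
        ((Submodule.span ℂ (Set.range (b (g v)))).topologicalClosure).comap x.toLinearMap := by
      refine Submodule.topologicalClosure_minimal _ (Submodule.span_le.2 ?_)
        ((Submodule.isClosed_topologicalClosure _).preimage x.continuous)
      rintro _ ⟨i, rfl⟩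
      exact Submodule.le_topologicalClosure _ (hbx (g v) i)
    have := hle ((hrange v).le ⟨a, rfl⟩)
    rw [Submodule.mem_comap, ← hrange] at this
    obtain ⟨a', ha'⟩ := this
    exact ⟨a', ha'.symm⟩
  · rw [Submodule.topologicalClosure_eq_top_iff, Submodule.eq_bot_iff]
    intro w hw
    refine htot w fun n i => (Submodule.mem_orthogonal _ _).1 hw _ ?_
    obtain ⟨v, rfl⟩ := g.surjective n
    exact Submodule.mem_iSup_of_mem v (hbU v i)

end Levels

section TreeOperators

variable {K : Type*} [NormedAddCommGroup K] [InnerProductSpace ℂ K] [CompleteSpace K]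

theorem algebraMap_le_iff_inner {T : K →L[ℂ] K} (hT : IsSelfAdjoint T) {c : ℝ} :
    algebraMap ℝ (K →L[ℂ] K) c ≤ T ↔ ∀ e, c * ‖e‖ ^ 2 ≤ (⟪T e, e⟫).re := by
  rw [ContinuousLinearMap.le_def, ContinuousLinearMap.isPositive_def',
    and_iff_right (hT.sub (.algebraMap _ (.all c)))]
  refine forall_congr' fun e => ?_
  rw [ContinuousLinearMap.reApplyInnerSelf_apply, sub_apply, inner_sub_left, map_sub, sub_nonneg,
    Algebra.algebraMap_eq_smul_one, smul_apply, one_apply_eq_self, ← Complex.coe_smul,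
    inner_smul_left, Complex.conj_ofReal, RCLike.re_eq_complex_re, Complex.re_ofReal_mul,
    ← RCLike.re_eq_complex_re, inner_self_eq_norm_sq]

theorem le_algebraMap_iff_inner {T : K →L[ℂ] K} (hT : IsSelfAdjoint T) {c : ℝ} :
    T ≤ algebraMap ℝ (K →L[ℂ] K) c ↔ ∀ e, (⟪T e, e⟫).re ≤ c * ‖e‖ ^ 2 := by
  rw [← neg_le_neg_iff, ← map_neg, algebraMap_le_iff_inner hT.neg]
  simp

/-- The operators realizing `sum_starProjection_edgeSpan`, constructed from the root outwards. -/
theorem exists_tree_operators {k : ℕ} (hk : k ≠ 0) {y : List (Fin k) → K →L[ℂ] K}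
    (hy : ∀ v, IsSelfAdjoint (y v))
    (hl : ∀ v e, -(((k : ℝ) - 1) ^ 2 / (4 * (k + 1))) * ‖e‖ ^ 2 ≤ (⟪y v e, e⟫).re)
    (hu : ∀ v e, (⟪y v e, e⟫).re ≤ (2 * k) * ‖e‖ ^ 2) :
    ∃ p q q₀ C S D T : List (Fin k) → K →L[ℂ] K,
      (∀ v, IsSelfAdjoint (C v)) ∧ (∀ v, IsSelfAdjoint (S v)) ∧
      (∀ v, C v * C v + S v * S v = 1) ∧
      (∀ v, IsSelfAdjoint (D v)) ∧ (∀ v, IsSelfAdjoint (T v)) ∧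
      (∀ v, D v * D v + T v * T v = 1) ∧
      (∀ v, (2 : ℝ) • (D v * D v * C v * C v + D v * T v * S v * C v) = p v) ∧
      (∀ v, (2 : ℝ) • (T v * D v * C v * S v + T v * T v * S v * S v) = q v) ∧
      (∀ v, y v = (k : ℝ) • p v + q₀ v) ∧ q₀ [] = 0 ∧ ∀ j v, q₀ (j :: v) = q v := by
  have hk1 : (1 : ℝ) ≤ k := by exact_mod_cast Nat.one_le_iff_ne_zero.2 hk
  have hk0 : (k : ℝ) ≠ 0 := by positivity
  obtain ⟨c, hc⟩ : ∃ c : ℝ, c = ((k : ℝ) - 1) / (2 * (k + 1)) := ⟨_, rfl⟩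
  have hc0 : 0 ≤ c := hc ▸ div_nonneg (by linarith) (by linarith)
  have hc1 : c < 1 / 2 := by
    rw [hc, div_lt_div_iff₀ (by linarith) (by norm_num)]
    linarith
  have hck : -(((k : ℝ) - 1) ^ 2 / (4 * (k + 1))) = k * (c ^ 2 - c) + (c ^ 2 + c) := by
    rw [hc]
    field_simp
    ring
  choose! C S D T q hC hS hD hT hCS hDT hp hq hqsa hq0 hq1 using
    fun (p : K →L[ℂ] K) (h : IsSelfAdjoint p ∧ algebraMap ℝ (K →L[ℂ] K) (c ^ 2 - c) ≤ p ∧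
      p ≤ algebraMap ℝ (K →L[ℂ] K) 2) => exists_cos_sin_of_isSelfAdjoint hc0 hc1 h.1 h.2.1 h.2.2
  let q₀ : List (Fin k) → K →L[ℂ] K :=
    List.rec 0 fun _ v r => q ((k : ℝ)⁻¹ • (y v - r))
  let p : List (Fin k) → K →L[ℂ] K := fun v => (k : ℝ)⁻¹ • (y v - q₀ v)
  have hstep : ∀ v, IsSelfAdjoint (q₀ v) → 0 ≤ q₀ v →
      q₀ v ≤ algebraMap ℝ (K →L[ℂ] K) (c ^ 2 + c) →
      IsSelfAdjoint (p v) ∧ algebraMap ℝ (K →L[ℂ] K) (c ^ 2 - c) ≤ p v ∧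
      p v ≤ algebraMap ℝ (K →L[ℂ] K) 2 := by
    intro v h1 h2 h3
    have hsa : IsSelfAdjoint (p v) := (IsSelfAdjoint.all _).smul ((hy v).sub h1)
    rw [← map_zero (algebraMap ℝ (K →L[ℂ] K)), algebraMap_le_iff_inner h1] at h2
    rw [le_algebraMap_iff_inner h1] at h3
    have hpe : ∀ e, (k : ℝ) * (⟪p v e, e⟫).re = (⟪y v e, e⟫).re - (⟪q₀ v e, e⟫).re := by
      intro e
      have : p v e = ((k : ℝ)⁻¹ : ℂ) • (y v e - q₀ v e) := by
        simp only [p, smul_apply, sub_apply]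
        rw [← Complex.coe_smul, Complex.ofReal_inv]
      rw [this, inner_smul_left, inner_sub_left, ← Complex.ofReal_inv, Complex.conj_ofReal,
        Complex.re_ofReal_mul, mul_inv_cancel_left₀ hk0, Complex.sub_re]
    refine ⟨hsa, (algebraMap_le_iff_inner hsa).2 fun e => ?_,
      (le_algebraMap_iff_inner hsa).2 fun e => ?_⟩
    · refine le_of_mul_le_mul_left ?_ (show (0 : ℝ) < k by linarith)
      have := hl v e
      rw [hck] at this
      linarith [hpe e, h3 e]
    · refine le_of_mul_le_mul_left ?_ (show (0 : ℝ) < k by linarith)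
      linarith [hpe e, h2 e, hu v e]
  have hq₀ : ∀ v, IsSelfAdjoint (q₀ v) ∧ 0 ≤ q₀ v ∧
      q₀ v ≤ algebraMap ℝ (K →L[ℂ] K) (c ^ 2 + c) := by
    intro v
    induction v with
    | nil =>
      refine ⟨.zero _, le_rfl, (le_algebraMap_iff_inner (.zero _)).2 fun e => ?_⟩
      change (⟪(0 : K →L[ℂ] K) e, e⟫).re ≤ _
      rw [zero_apply, inner_zero_left, Complex.zero_re]
      positivity
    | cons j v ih =>
      have h := hstep v ih.1 ih.2.1 ih.2.2
      exact ⟨hqsa _ h, hq0 _ h, hq1 _ h⟩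
  have hgood := fun v => hstep v (hq₀ v).1 (hq₀ v).2.1 (hq₀ v).2.2
  refine ⟨p, fun v => q (p v), q₀, fun v => C (p v), fun v => S (p v), fun v => D (p v),
    fun v => T (p v), fun v => hC _ (hgood v), fun v => hS _ (hgood v), fun v => hCS _ (hgood v),
    fun v => hD _ (hgood v), fun v => hT _ (hgood v), fun v => hDT _ (hgood v),
    fun v => hp _ (hgood v), fun v => hq _ (hgood v), fun v => ?_, rfl, fun _ _ => rfl⟩
  simp only [p]
  rw [smul_inv_smul₀ hk0, sub_add_cancel]

end TreeOperators

/-- On an infinite-dimensional complex Hilbert space, every self-adjoint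
bounded operator `x` with `-((n-4)²/(8n))·1 ≤ x ≤ (n-2)·1` (for even `n ≥ 4`) is a sum of `n`
compositions of pairs of orthogonal projections. -/
theorem representation_sufficient_condition
    {H : Type*} [NormedAddCommGroup H] [InnerProductSpace ℂ H] [CompleteSpace H]
    (hinf : ¬ FiniteDimensional ℂ H)
    (n : ℕ) (hn : 4 ≤ n) (heven : Even n)
    (x : H →L[ℂ] H) (hx : ContinuousLinearMap.adjoint x = x)
    (hlow : ∀ e : H, -((((n : ℝ) - 4) ^ 2) / (8 * n)) * ‖e‖ ^ 2 ≤ (⟪x e, e⟫).re)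
    (hhigh : ∀ e : H, (⟪x e, e⟫).re ≤ ((n : ℝ) - 2) * ‖e‖ ^ 2) :
    ∃ P Q : Fin n → H →L[ℂ] H,
      (∀ i, ContinuousLinearMap.adjoint (P i) = P i ∧ P i ∘L P i = P i) ∧
      (∀ i, ContinuousLinearMap.adjoint (Q i) = Q i ∧ Q i ∘L Q i = Q i) ∧
      x = ∑ i, Q i ∘L P i := by
  obtain ⟨k, rfl⟩ : ∃ k, n = (k + 1) + (k + 1) := by
    obtain ⟨m, rfl⟩ := heven
    exact ⟨m - 1, by omega⟩
  have hk : k ≠ 0 := by omega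
  have : NeZero k := ⟨hk⟩
  obtain ⟨ι, U, hU, hxU, htot⟩ := exists_isometries_of_isSelfAdjoint hinf hx (List (Fin k))
  let y : List (Fin k) → lp (fun _ : ι => ℂ) 2 →L[ℂ] lp (fun _ : ι => ℂ) 2 := fun v =>
    ContinuousLinearMap.adjoint (U v).toContinuousLinearMap ∘L x ∘L (U v).toContinuousLinearMap
  have hxy : ∀ v h, x (U v h) = U v (y v h) := by
    intro v h
    obtain ⟨a, ha⟩ := hxU v h
    have : y v h = a := ext_inner_right ℂ fun b => by
      simp only [y, ContinuousLinearMap.comp_apply, LinearIsometry.coe_toContinuousLinearMap,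
        ContinuousLinearMap.adjoint_inner_left, ha, LinearIsometry.inner_map_map]
    rw [this, ha]
  have hyx : ∀ v e, ⟪y v e, e⟫ = ⟪x (U v e), U v e⟫ := fun v e => by
    rw [hxy, LinearIsometry.inner_map_map]
  have hc1 : -((((k + 1 + (k + 1) : ℕ) : ℝ) - 4) ^ 2 / (8 * (k + 1 + (k + 1) : ℕ))) =
      -(((k : ℝ) - 1) ^ 2 / (4 * (k + 1))) := by
    push_cast
    field_simp
    ring
  have hc2 : ((k + 1 + (k + 1) : ℕ) : ℝ) - 2 = 2 * k := by
    push_cast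
    ring
  rw [hc1] at hlow
  rw [hc2] at hhigh
  obtain ⟨p, q, q₀, C, S, D, T, hC, hS, hCS, hD, hT, hDT, hp, hq, hy, hq₀, hq₁⟩ :=
    exists_tree_operators hk (y := y)
      (fun v => IsSelfAdjoint.adjoint_conj hx (U v).toContinuousLinearMap)
      (fun v e => by rw [hyx, ← (U v).norm_map]; exact hlow _)
      (fun v e => by rw [hyx, ← (U v).norm_map]; exact hhigh _)
  have hsum := sum_starProjection_edgeSpan hU hC hS hCS hD hT hDT hp hq hxy hy hq₀ hq₁ htot
  refine ⟨Fin.append (fun i => (edgeSpan U C S i).starProjection)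
      fun i => (edgeSpan U C (-S) i).starProjection,
    Fin.append (fun i => (edgeSpan U D T i).starProjection)
      fun i => (edgeSpan U D (-T) i).starProjection, fun i => ?_, fun i => ?_, ?_⟩
  · refine Fin.addCases (fun i => ?_) (fun i => ?_) i <;>
      simp only [Fin.append_left, Fin.append_right] <;>
      exact ⟨isSelfAdjoint_starProjection _, Submodule.isIdempotentElem_starProjection _⟩
  · refine Fin.addCases (fun i => ?_) (fun i => ?_) i <;>
      simp only [Fin.append_left, Fin.append_right] <;>
      exact ⟨isSelfAdjoint_starProjection _, Submodule.isIdempotentElem_starProjection _⟩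
  · rw [Fin.sum_univ_add]
    simp only [Fin.append_left, Fin.append_right]
    rw [hsum, Finset.sum_add_distrib]
end

section
/- Let H be an infinite-dimensional complex Hilbert space, let c > 0, and set n = 2·⌈2 + 2c + 2·√(c² + 2c)⌉. Then every self-adjoint bounded operator x on H with ‖x‖ ≤ c can be written as x = ∑_{i=1}^n Q_i P_i for some orthogonal projections P_1,…,P_n, Q_1,…,Q_n on H. -/
section Jordan

variable {A : Type*} [Ring A] [StarRing A]

theorem isSelfAdjoint_and_mul_self_of_star_mul {z e : A} (hz : star z * z = e) (hze : z * e = z) :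
    star (z * star z) = z * star z ∧ z * star z * (z * star z) = z * star z := by
  refine ⟨by simp, ?_⟩
  rw [← mul_assoc, mul_assoc z, hz, hze]

/-- The projections onto the ranges of `c + u * d` and `c - u * d` have an explicit Jordan
product. -/
theorem exists_projections_jordan_product {c d u e : A} (hc : star c = c) (hd : star d = d)
    (hcu : c * u = 0) (hdu : d * (star u * u) = d) (hce : c * e = c) (hde : d * e = d)
    (hcd : c * c + d * d = e) :
    ∃ p q : A, (star p = p ∧ p * p = p) ∧ (star q = q ∧ q * q = q) ∧
      p * q + q * p =
        2 * (c * (c * c - d * d) * c) - 2 * (u * (d * (c * c - d * d) * d) * star u) := by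
  have huc : star u * c = 0 := by simpa [hc] using congrArg star hcu
  have h1 : ∀ y, c * (u * y) = 0 := fun y => by rw [← mul_assoc, hcu, zero_mul]
  have h2 : ∀ y, star u * (c * y) = 0 := fun y => by rw [← mul_assoc, huc, zero_mul]
  have h3 : ∀ y, d * (star u * (u * y)) = d * y := fun y => by
    rw [← mul_assoc (star u), ← mul_assoc, hdu]
  refine ⟨(c + u * d) * star (c + u * d), (c - u * d) * star (c - u * d),
    isSelfAdjoint_and_mul_self_of_star_mul (e := e) ?_ ?_,
    isSelfAdjoint_and_mul_self_of_star_mul (e := e) ?_ ?_, ?_⟩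
  · simp only [star_add, star_mul, hc, hd, add_mul, mul_add, mul_assoc, h1, huc, h3, mul_zero,
      add_zero, zero_add, hcd]
  · rw [add_mul, hce, mul_assoc, hde]
  · simp only [star_sub, star_mul, hc, hd, sub_mul, mul_sub, mul_assoc, h1, huc, h3, mul_zero,
      sub_zero, zero_sub, sub_neg_eq_add, hcd]
  · rw [sub_mul, hce, mul_assoc, hde]
  · simp only [star_sub, star_add, star_mul, hc, hd, sub_mul, mul_sub, add_mul, mul_add, mul_assoc,
      h1, h2, h3, mul_zero]
    noncomm_ring

end Jordan

section Block

/-- The larger root `t` of `t ^ 2 + t = r`. -/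
noncomputable def quadraticRoot (r : ℝ) : ℝ := -1 / 2 + √(1 / 4 + r)

theorem quadraticRoot_sq_add {r : ℝ} (hr : -1 / 4 ≤ r) :
    quadraticRoot r ^ 2 + quadraticRoot r = r := by
  have := Real.sq_sqrt (show 0 ≤ 1 / 4 + r by linarith)
  rw [quadraticRoot]
  linear_combination this

theorem quadraticRoot_mem_Icc {μ c r : ℝ} (hμ : 3 ≤ μ) (hc : 4 * μ * c ≤ (μ - 2) ^ 2)
    (hr : -(c + ((1 / 2 - 1 / μ) ^ 2 + (1 / 2 - 1 / μ))) ≤ r) (hr' : r ≤ c + 1 / 4) :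
    -1 / 4 ≤ r / (μ - 1) ∧ quadraticRoot (r / (μ - 1)) ∈ Set.Icc (-(1 / 2 - 1 / μ)) 1 := by
  have hμ0 : 0 < μ := by linarith
  have hc' : c ≤ μ / 4 - 1 + 1 / μ := by
    rw [← sub_nonneg]
    have : μ / 4 - 1 + 1 / μ - c = ((μ - 2) ^ 2 - 4 * μ * c) / (4 * μ) := by
      field_simp
      ring
    rw [this]
    exact div_nonneg (by linarith) (by linarith)
  have h1 : 1 / μ ≤ 1 / 3 := one_div_le_one_div_of_le (by norm_num) hμ
  have h0 : 0 < 1 / μ := by positivity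
  have hmul : μ * (1 / μ) = 1 := by field_simp
  have hlow : (1 / μ) ^ 2 ≤ 1 / 4 + r / (μ - 1) := by
    rw [← sub_nonneg]
    have : 1 / 4 + r / (μ - 1) - (1 / μ) ^ 2 =
      ((μ - 1) * (1 / 4 - (1 / μ) ^ 2) + r) / (μ - 1) := by
      field_simp [show μ - 1 ≠ 0 by linarith]
      ring
    rw [this]
    refine div_nonneg ?_ (by linarith)
    generalize 1 / μ = k at *
    nlinarith
  have hup : r / (μ - 1) ≤ 2 := by
    rw [div_le_iff₀ (by linarith)]
    linarith
  refine ⟨by nlinarith, ?_, ?_⟩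
  · have := Real.le_sqrt_of_sq_le hlow
    rw [quadraticRoot]
    linarith
  · have : √(1 / 4 + r / (μ - 1)) ≤ 3 / 2 := Real.sqrt_le_iff.2 ⟨by norm_num, by linarith⟩
    rw [quadraticRoot]
    linarith

variable {A : Type*} [CStarAlgebra A]

theorem two_mul_cfc_mul_sub_mul {f g h : ℝ → ℝ} (hf : Continuous f) (hg : Continuous g)
    (hh : Continuous h) (a : A) :
    2 * (cfc h a * (cfc f a * cfc f a - cfc g a * cfc g a) * cfc h a) =
      cfc (fun r => 2 * (h r * (f r * f r - g r * g r) * h r)) a := by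
  have h₄ : Continuous fun r => f r * f r := by fun_prop
  have h₅ : Continuous fun r => g r * g r := by fun_prop
  have h₁ : Continuous fun r => f r * f r - g r * g r := by fun_prop
  have h₂ : Continuous fun r => h r * (f r * f r - g r * g r) := by fun_prop
  have h₃ : Continuous fun r => h r * (f r * f r - g r * g r) * h r := by fun_prop
  rw [← cfc_mul f f a hf.continuousOn hf.continuousOn,
    ← cfc_mul g g a hg.continuousOn hg.continuousOn,
    ← cfc_sub _ _ a h₄.continuousOn h₅.continuousOn,
    ← cfc_mul _ _ a hh.continuousOn h₁.continuousOn,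
    ← cfc_mul _ _ a h₂.continuousOn hh.continuousOn,
    cfc_const_mul 2 _ a h₃.continuousOn, ofNat_smul_eq_nsmul, nsmul_eq_mul, Nat.cast_ofNat]

/-- If `‖x‖ ≤ c` with `4 * μ * c ≤ (μ - 2) ^ 2` and `y` lies in a suitable order interval, then
`x - y` is `μ - 1` times the first part of a Jordan product as in
`exists_projections_jordan_product`, whose second part lies in the same order interval. -/
theorem exists_jordan_block [PartialOrder A] [StarOrderedRing A] {μ c : ℝ} (hμ : 3 ≤ μ)
    (hc : 4 * μ * c ≤ (μ - 2) ^ 2) {x y : A}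
    (hx : IsSelfAdjoint x) (hxc : ‖x‖ ≤ c) (hy : IsSelfAdjoint y)
    (hy₁ : algebraMap ℝ A (-1 / 4) ≤ y)
    (hy₂ : y ≤ algebraMap ℝ A ((1 / 2 - 1 / μ) ^ 2 + (1 / 2 - 1 / μ))) :
    ∃ a d : A, IsSelfAdjoint a ∧ IsSelfAdjoint d ∧ ‖a‖ ≤ 1 ∧ ‖d‖ ≤ 1 ∧ a * a + d * d = 1 ∧
      (μ - 1) • (2 * (a * (a * a - d * d) * a)) = x - y ∧
      IsSelfAdjoint (-(2 * (d * (a * a - d * d) * d))) ∧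
      algebraMap ℝ A (-1 / 4) ≤ -(2 * (d * (a * a - d * d) * d)) ∧
      -(2 * (d * (a * a - d * d) * d)) ≤
        algebraMap ℝ A ((1 / 2 - 1 / μ) ^ 2 + (1 / 2 - 1 / μ)) := by
  set K : ℝ := (1 / 2 - 1 / μ) ^ 2 + (1 / 2 - 1 / μ) with hK
  have hb : IsSelfAdjoint (x - y) := hx.sub hy
  have hx₁ : x ≤ algebraMap ℝ A c :=
    hx.le_algebraMap_norm_self.trans (algebraMap_mono A hxc)
  have hx₂ : -algebraMap ℝ A c ≤ x :=
    (neg_le_neg (algebraMap_mono A hxc)).trans hx.neg_algebraMap_norm_le_self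
  have hspec : ∀ r ∈ spectrum ℝ (x - y), -(c + K) ≤ r ∧ r ≤ c + 1 / 4 := by
    refine fun r hr => ⟨(algebraMap_le_iff_le_spectrum hb).1 ?_ r hr,
      (le_algebraMap_iff_spectrum_le hb).1 ?_ r hr⟩
    · rw [map_neg, map_add, neg_add, ← sub_eq_add_neg]
      exact sub_le_sub hx₂ hy₂
    · rw [map_add, show (1 / 4 : ℝ) = -(-1 / 4) by norm_num, map_neg, ← sub_eq_add_neg]
      exact sub_le_sub hx₁ hy₁
  set t : ℝ → ℝ := fun r => quadraticRoot (r / (μ - 1)) with ht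
  have htc : Continuous t := by
    unfold t quadraticRoot
    fun_prop
  set α : ℝ → ℝ := fun r => √((1 + t r) / 2) with hα
  set δ : ℝ → ℝ := fun r => √((1 - t r) / 2) with hδ
  have hαc : Continuous α := by fun_prop
  have hδc : Continuous δ := by fun_prop
  have hs0 : 1 / μ ≤ 1 / 3 := one_div_le_one_div_of_le (by norm_num) hμ
  have hs1 : 0 < 1 / μ := by positivity
  have htt : ∀ r ∈ spectrum ℝ (x - y), t r ^ 2 + t r = r / (μ - 1) := fun r hr =>
    quadraticRoot_sq_add (quadraticRoot_mem_Icc hμ hc (hspec r hr).1 (hspec r hr).2).1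
  have htm : ∀ r ∈ spectrum ℝ (x - y), t r ∈ Set.Icc (-(1 / 2 - 1 / μ)) 1 := fun r hr =>
    (quadraticRoot_mem_Icc hμ hc (hspec r hr).1 (hspec r hr).2).2
  have hα2 : ∀ r ∈ spectrum ℝ (x - y), α r * α r = (1 + t r) / 2 := fun r hr =>
    Real.mul_self_sqrt (by linarith [(htm r hr).1])
  have hδ2 : ∀ r ∈ spectrum ℝ (x - y), δ r * δ r = (1 - t r) / 2 := fun r hr =>
    Real.mul_self_sqrt (by linarith [(htm r hr).2])
  have hα1 : ∀ r ∈ spectrum ℝ (x - y), ‖α r‖ ≤ 1 := fun r hr => by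
    rw [Real.norm_of_nonneg (Real.sqrt_nonneg _)]
    exact Real.sqrt_le_one.2 (by linarith [(htm r hr).2])
  have hδ1 : ∀ r ∈ spectrum ℝ (x - y), ‖δ r‖ ≤ 1 := fun r hr => by
    rw [Real.norm_of_nonneg (Real.sqrt_nonneg _)]
    exact Real.sqrt_le_one.2 (by linarith [(htm r hr).1])
  clear_value α δ t
  have hz : -(2 * (cfc δ (x - y) * (cfc α (x - y) * cfc α (x - y) -
      cfc δ (x - y) * cfc δ (x - y)) * cfc δ (x - y))) =
      cfc (fun r => t r ^ 2 - t r) (x - y) := by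
    rw [two_mul_cfc_mul_sub_mul hαc hδc hδc _, ← cfc_neg _ (x - y)]
    refine cfc_congr fun r hr => ?_
    linear_combination (-2 * (α r * α r - δ r * δ r)) * hδ2 r hr - (1 - t r) * hα2 r hr +
      (1 - t r) * hδ2 r hr
  refine ⟨cfc α (x - y), cfc δ (x - y), cfc_predicate α _, cfc_predicate δ _,
    norm_cfc_le zero_le_one hα1, norm_cfc_le zero_le_one hδ1, ?_, ?_, ?_, ?_, ?_⟩
  · have hααc : Continuous fun r => α r * α r := by fun_prop
    have hδδc : Continuous fun r => δ r * δ r := by fun_prop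
    rw [← cfc_mul α α (x - y), ← cfc_mul δ δ (x - y),
      ← cfc_add (a := x - y) _ _ hααc.continuousOn hδδc.continuousOn,
      ← cfc_one ℝ (x - y)]
    refine cfc_congr fun r hr => ?_
    simp only [hα2 r hr, hδ2 r hr, Pi.one_apply]
    ring
  · have hcont : Continuous fun r => 2 * (α r * (α r * α r - δ r * δ r) * α r) := by fun_prop
    rw [two_mul_cfc_mul_sub_mul hαc hδc hαc _, ← cfc_smul _ _ (x - y) hcont.continuousOn]
    conv_rhs => rw [← cfc_id ℝ (x - y)]
    refine cfc_congr fun r hr => ?_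
    have hμ1 : μ - 1 ≠ 0 := by linarith
    have := htt r hr
    rw [eq_div_iff hμ1] at this
    simp only [smul_eq_mul, id]
    linear_combination (2 * (μ - 1) * (α r * α r - δ r * δ r)) * hα2 r hr +
      (μ - 1) * (1 + t r) * hα2 r hr - (μ - 1) * (1 + t r) * hδ2 r hr + this
  · rw [hz]
    exact cfc_predicate _ _
  · rw [hz]
    exact algebraMap_le_cfc _ _ _ fun r hr => by nlinarith [sq_nonneg (t r - 1 / 2)]
  · rw [hz]
    refine cfc_le_algebraMap _ _ _ fun r hr => ?_
    have := htm r hr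
    nlinarith [this.1, this.2]

end Block

section HilbertSum

open scoped InnerProductSpace

variable {V K : Type*} [NormedAddCommGroup K] [InnerProductSpace ℂ K]

theorem lp_sum_norm_comp_le (j : V ↪ V) (a : V → K →L[ℂ] K) (ha : ∀ v, ‖a v‖ ≤ 1)
    (f : lp (fun _ : V => K) 2) (s : Finset V) :
    ∑ v ∈ s, ‖a v (f (j v))‖ ^ (2 : ENNReal).toReal ≤ ‖f‖ ^ (2 : ENNReal).toReal := by
  refine le_trans ?_ (lp.sum_rpow_le_norm_rpow (by norm_num) f (s.map j))
  rw [Finset.sum_map]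
  gcongr with v
  exact (a v).le_of_opNorm_le_of_le (ha v) le_rfl |>.trans_eq (one_mul _)

/-- The operator on a Hilbert sum of copies of `K` which pulls back along the injection `j` and then
applies the contractions `a`. -/
noncomputable def lpWeightedComp (j : V ↪ V) (a : V → K →L[ℂ] K) (ha : ∀ v, ‖a v‖ ≤ 1) :
    lp (fun _ : V => K) 2 →L[ℂ] lp (fun _ : V => K) 2 :=
  LinearMap.mkContinuous
    { toFun := fun f => ⟨fun v => a v (f (j v)), memℓp_gen' (lp_sum_norm_comp_le j a ha f)⟩
      map_add' := fun f g => by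
        ext v
        exact map_add (a v) _ _
      map_smul' := fun r f => by
        ext v
        exact map_smul (a v) r _ } 1 fun f => by
    rw [one_mul]
    exact lp.norm_le_of_forall_sum_le (by norm_num) (norm_nonneg _) (lp_sum_norm_comp_le j a ha f)

/-- Pulling back along an injection, as an operator on a Hilbert sum of copies of `K`. -/
noncomputable def lpComp (j : V ↪ V) : lp (fun _ : V => K) 2 →L[ℂ] lp (fun _ : V => K) 2 :=
  lpWeightedComp j (fun _ => 1) fun _ => ContinuousLinearMap.norm_id_le

@[simp]
theorem lpComp_apply (j : V ↪ V) (f : lp (fun _ : V => K) 2) (v : V) :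
    lpComp j f v = f (j v) := rfl

variable [CompleteSpace K]

theorem star_lpWeightedComp_refl (a : V → K →L[ℂ] K) (ha : ∀ v, ‖a v‖ ≤ 1)
    (hs : ∀ v, IsSelfAdjoint (a v)) :
    star (lpWeightedComp (.refl V) a ha) = lpWeightedComp (.refl V) a ha := by
  rw [ContinuousLinearMap.star_eq_adjoint]
  refine ((ContinuousLinearMap.eq_adjoint_iff _ _).2 fun f g => ?_).symm
  rw [lp.inner_eq_tsum, lp.inner_eq_tsum]
  exact tsum_congr fun v => (ContinuousLinearMap.isSelfAdjoint_iff_isSymmetric.1 (hs v)) _ _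

theorem inner_star_lpComp_apply [DecidableEq V] (j : V ↪ V) (f : lp (fun _ : V => K) 2) (v : V)
    (x : K) : ⟪x, star (lpComp j) f v⟫_ℂ = ⟪lpComp j (lp.single 2 v x), f⟫_ℂ := by
  rw [← lp.inner_single_left (G := fun _ : V => K), ContinuousLinearMap.star_eq_adjoint,
    ContinuousLinearMap.adjoint_inner_right]

theorem star_lpComp_apply (j : V ↪ V) (f : lp (fun _ : V => K) 2) (w : V) :
    star (lpComp j) f (j w) = f w := by
  classical
  refine ext_inner_left ℂ fun x => ?_
  rw [inner_star_lpComp_apply, ← lp.inner_single_left (G := fun _ : V => K)]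
  congr 1
  ext i
  simp [Pi.single_apply]

theorem star_lpComp_apply_of_notMem (j : V ↪ V) (f : lp (fun _ : V => K) 2) {v : V}
    (hv : v ∉ Set.range j) : star (lpComp j) f v = 0 := by
  classical
  refine ext_inner_left ℂ fun x => ?_
  have : lpComp j (lp.single 2 v x) = 0 := by
    ext i
    simp [show j i ≠ v from fun h => hv ⟨i, h⟩]
  rw [inner_star_lpComp_apply, inner_zero_right, this, inner_zero_left]

end HilbertSum

section Tree

variable {K : Type*} [NormedAddCommGroup K] [InnerProductSpace ℂ K] [CompleteSpace K] {N : ℕ}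

/-- Operators on the vertices of the forest of words such that each `x v` splits into `N` equal
contributions of the block at `v` and one contribution of the block at the parent of `v`. -/
theorem exists_block_operators {c : ℝ} (hN : 2 ≤ N)
    (hc : 4 * ((N : ℝ) + 1) * c ≤ ((N : ℝ) + 1 - 2) ^ 2)
    (x : List (Fin (N + 1)) → K →L[ℂ] K) (hx : ∀ v, IsSelfAdjoint (x v)) (hxc : ∀ v, ‖x v‖ ≤ c) :
    ∃ a d : List (Fin (N + 1)) → K →L[ℂ] K,
      (∀ v, IsSelfAdjoint (a v)) ∧ (∀ v, IsSelfAdjoint (d v)) ∧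
      (∀ v, ‖a v‖ ≤ 1) ∧ (∀ v, ‖d v‖ ≤ 1) ∧ (∀ v, a v * a v + d v * d v = 1) ∧
      (N : ℝ) • (2 * (a [] * (a [] * a [] - d [] * d []) * a [])) = x [] ∧
      ∀ k w, (N : ℝ) • (2 * (a (k :: w) * (a (k :: w) * a (k :: w) - d (k :: w) * d (k :: w)) *
        a (k :: w))) = x (k :: w) +
          if w.headD 0 = k then 0 else 2 * (d w * (a w * a w - d w * d w) * d w) := by
  set κ : ℝ := (1 / 2 - 1 / ((N : ℝ) + 1)) ^ 2 + (1 / 2 - 1 / ((N : ℝ) + 1)) with hκ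
  have hN' : (3 : ℝ) ≤ N + 1 := by
    have : (2 : ℝ) ≤ N := by exact_mod_cast hN
    linarith
  let Good : (K →L[ℂ] K) → Prop := fun y =>
    IsSelfAdjoint y ∧ algebraMap ℝ (K →L[ℂ] K) (-1 / 4) ≤ y ∧ y ≤ algebraMap ℝ (K →L[ℂ] K) κ
  have hzero : Good 0 := by
    have : 1 / ((N : ℝ) + 1) ≤ 1 / 3 := one_div_le_one_div_of_le (by norm_num) hN'
    refine ⟨.zero _, ?_, ?_⟩
    · rw [← map_zero (algebraMap ℝ (K →L[ℂ] K))]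
      exact algebraMap_mono _ (by norm_num)
    · rw [← map_zero (algebraMap ℝ (K →L[ℂ] K))]
      exact algebraMap_mono _ (add_nonneg (sq_nonneg _) (by linarith))
  have hblock : ∀ v y, ∃ a d : K →L[ℂ] K, Good y →
      IsSelfAdjoint a ∧ IsSelfAdjoint d ∧ ‖a‖ ≤ 1 ∧ ‖d‖ ≤ 1 ∧ a * a + d * d = 1 ∧
      (N : ℝ) • (2 * (a * (a * a - d * d) * a)) = x v - y ∧
      Good (-(2 * (d * (a * a - d * d) * d))) := fun v y => by
    by_cases hy : Good y
    · obtain ⟨a, d, h⟩ := exists_jordan_block hN' hc (hx v) (hxc v) hy.1 hy.2.1 hy.2.2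
      rw [add_sub_cancel_right] at h
      exact ⟨a, d, fun _ => h⟩
    · exact ⟨0, 0, fun h => (hy h).elim⟩
  choose a d had using hblock
  let Y : List (Fin (N + 1)) → K →L[ℂ] K := fun v => List.rec (motive := fun _ => K →L[ℂ] K) 0
    (fun k w y => if w.headD 0 = k then 0 else
      -(2 * (d w y * (a w y * a w y - d w y * d w y) * d w y))) v
  have hY : ∀ v, Good (Y v) := fun v => by
    induction v with
    | nil => exact hzero
    | cons k w ih =>
      change Good (if w.headD 0 = k then 0 else _)
      split_ifs
      · exact hzero
      · exact (had w (Y w) ih).2.2.2.2.2.2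
  have h := fun v => had v (Y v) (hY v)
  refine ⟨fun v => a v (Y v), fun v => d v (Y v), fun v => (h v).1, fun v => (h v).2.1,
    fun v => (h v).2.2.1, fun v => (h v).2.2.2.1, fun v => (h v).2.2.2.2.1, ?_, fun k w => ?_⟩
  · exact (h []).2.2.2.2.2.1.trans (sub_zero _)
  · refine (h (k :: w)).2.2.2.2.2.1.trans ?_
    rw [sub_eq_add_neg]
    congr 1
    change -(if w.headD 0 = k then 0 else _) = _
    split_ifs
    exacts [neg_zero, neg_neg _]

/-- Prepending the letter `k` to a word. -/
def consEmbedding {α : Type*} (k : α) : List α ↪ List α := ⟨List.cons k, List.cons_injective⟩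

/-- A small block diagonal self-adjoint operator, with blocks indexed by words on `N + 1` letters,
is a sum of `N + 1` Jordan products of projections. -/
theorem exists_sum_jordan_products {c : ℝ} (hN : 2 ≤ N)
    (hc : 4 * ((N : ℝ) + 1) * c ≤ ((N : ℝ) + 1 - 2) ^ 2)
    (x : List (Fin (N + 1)) → K →L[ℂ] K) (hx : ∀ v, IsSelfAdjoint (x v)) (hxc : ∀ v, ‖x v‖ ≤ c)
    (X : lp (fun _ : List (Fin (N + 1)) => K) 2 →L[ℂ] lp (fun _ : List (Fin (N + 1)) => K) 2)
    (hX : ∀ f v, X f v = x v (f v)) :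
    ∃ p q : Fin (N + 1) →
        lp (fun _ : List (Fin (N + 1)) => K) 2 →L[ℂ] lp (fun _ : List (Fin (N + 1)) => K) 2,
      (∀ k, star (p k) = p k ∧ p k * p k = p k) ∧ (∀ k, star (q k) = q k ∧ q k * q k = q k) ∧
      X = ∑ k, (p k * q k + q k * p k) := by
  obtain ⟨a, d, ha, hd, ha1, hd1, had, hroot, hchild⟩ := exists_block_operators hN hc x hx hxc
  let ε : Fin (N + 1) → List (Fin (N + 1)) → (K →L[ℂ] K) → K →L[ℂ] K :=
    fun k v y => if v.headD 0 = k then 0 else y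
  have hε : ∀ k v y, IsSelfAdjoint y → IsSelfAdjoint (ε k v y) := fun k v y hy => by
    unfold ε
    split_ifs
    exacts [.zero _, hy]
  have hε1 : ∀ k v y, ‖y‖ ≤ 1 → ‖ε k v y‖ ≤ 1 := fun k v y hy => by
    unfold ε
    split_ifs
    exacts [by simp, hy]
  let C := fun k => lpWeightedComp (.refl _) (fun v => ε k v (a v)) fun v => hε1 k v _ (ha1 v)
  let D := fun k => lpWeightedComp (.refl _) (fun v => ε k v (d v)) fun v => hε1 k v _ (hd1 v)
  let E := fun k => lpWeightedComp (K := K) (.refl _) (fun v => ε k v 1)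
    fun v => hε1 k v _ ContinuousLinearMap.norm_id_le
  have hC : ∀ k f v, C k f v = ε k v (a v) (f v) := fun _ _ _ => rfl
  have hD : ∀ k f v, D k f v = ε k v (d v) (f v) := fun _ _ _ => rfl
  have hE : ∀ k f v, E k f v = ε k v 1 (f v) := fun _ _ _ => rfl
  have hCs : ∀ k, star (C k) = C k := fun k => star_lpWeightedComp_refl _ _ fun v => hε k v _ (ha v)
  have hDs : ∀ k, star (D k) = D k := fun k => star_lpWeightedComp_refl _ _ fun v => hε k v _ (hd v)
  have hEs : ∀ k, star (E k) = E k := fun k =>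
    star_lpWeightedComp_refl _ _ fun v => hε k v _ (.one _)
  let U := fun k => star (lpComp (K := K) (consEmbedding k)) * E k
  have hUcons : ∀ k f w, U k f (k :: w) = ε k w 1 (f w) := fun k f w =>
    star_lpComp_apply (consEmbedding k) (E k f) w
  have hU0 : ∀ k f v, v ∉ Set.range (consEmbedding k) → U k f v = 0 := fun k f v hv =>
    star_lpComp_apply_of_notMem (consEmbedding k) (E k f) hv
  have hUs : ∀ k f v, star (U k) f v = ε k v 1 (f (k :: v)) := fun k f v => by
    rw [star_mul, star_star, hEs]
    rfl
  have hεε : ∀ k v y, ε k v y = if v.headD 0 = k then 0 else y := fun _ _ _ => rfl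
  clear_value U C D E ε
  have hUU : ∀ k, star (U k) * U k = E k := fun k => by
    ext f v
    simp only [mul_apply_eq_comp, hUs, hUcons, hE, hεε]
    split_ifs <;> simp
  have hCC : ∀ k f v, (2 * (C k * (C k * C k - D k * D k) * C k)) f v =
      if v.headD 0 = k then 0 else (2 * (a v * (a v * a v - d v * d v) * a v)) (f v) :=
    fun k f v => by
      simp only [two_mul, add_apply, sub_apply, mul_apply_eq_comp,
        lp.coeFn_add, lp.coeFn_sub, Pi.add_apply, Pi.sub_apply, hC, hD, hεε]
      split_ifs <;> simp
  have hDD : ∀ k f v, (D k * (C k * C k - D k * D k) * D k) f v =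
      if v.headD 0 = k then 0 else (d v * (a v * a v - d v * d v) * d v) (f v) :=
    fun k f v => by
      simp only [sub_apply, mul_apply_eq_comp,
        lp.coeFn_sub, Pi.sub_apply, hC, hD, hεε]
      split_ifs <;> simp
  have hUD : ∀ k f v, (2 * (U k * (D k * (C k * C k - D k * D k) * D k) * star (U k))) f v =
      U k ((D k * (C k * C k - D k * D k) * D k) (star (U k) f)) v +
        U k ((D k * (C k * C k - D k * D k) * D k) (star (U k) f)) v := fun k f v => by
    rw [two_mul, add_apply, lp.coeFn_add, Pi.add_apply, mul_apply_eq_comp, mul_apply_eq_comp]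
  have hJ := fun k => exists_projections_jordan_product (hCs k) (hDs k) (u := U k) (e := E k)
    (by
      ext f v
      rw [mul_apply_eq_comp, hC, hεε]
      split_ifs with h
      · rfl
      · rw [hU0, map_zero]
        · rfl
        · rintro ⟨w, rfl⟩
          exact h rfl)
    (by
      ext f v
      rw [hUU, mul_apply_eq_comp, hD, hD, hE, hεε, hεε]
      split_ifs <;> simp)
    (by
      ext f v
      rw [mul_apply_eq_comp, hC, hC, hE, hεε, hεε]
      split_ifs <;> simp)
    (by
      ext f v
      rw [mul_apply_eq_comp, hD, hD, hE, hεε, hεε]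
      split_ifs <;> simp)
    (by
      ext f v
      simp only [add_apply, mul_apply_eq_comp, lp.coeFn_add, Pi.add_apply,
        hC, hD, hE, hεε]
      split_ifs
      · simp
      · exact congrArg (fun T : K →L[ℂ] K => T (f v)) (had v))
  choose p q hp hq hpq using hJ
  have hsum : ∀ (i : Fin (N + 1)) (z : K), ∑ k, (if i = k then 0 else z) = (N : ℝ) • z :=
    fun i z => by
      rw [Finset.sum_ite, Finset.sum_const_zero, zero_add, Finset.sum_const, Finset.filter_ne,
        Finset.card_erase_of_mem (Finset.mem_univ _), Finset.card_univ, Fintype.card_fin,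
        Nat.add_sub_cancel, Nat.cast_smul_eq_nsmul]
  refine ⟨p, q, hp, hq, ?_⟩
  ext f v
  simp only [hpq]
  rw [hX, sum_apply, lp.coeFn_sum, Finset.sum_apply]
  simp only [sub_apply, lp.coeFn_sub, Pi.sub_apply, Finset.sum_sub_distrib, hCC, hsum]
  cases v with
  | nil =>
    rw [← hroot, Finset.sum_eq_zero, sub_zero]
    · rfl
    · intro k _
      rw [hUD, hU0, add_zero]
      rintro ⟨w, hw⟩
      exact List.cons_ne_nil _ _ hw
  | cons l w =>
    rw [← smul_apply, hchild, add_apply, Finset.sum_eq_single l]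
    · rw [hUD, hUcons, hDD, hUs, hεε]
      split_ifs
      · simp
      · simp [two_mul]
    · intro k _ hk
      rw [hUD, hU0, add_zero]
      rintro ⟨u, hu⟩
      exact hk (List.cons.inj hu).1
    · exact fun h => (h (Finset.mem_univ _)).elim

end Tree

section Cyclic

variable {H : Type*} [NormedAddCommGroup H] [InnerProductSpace ℂ H]

open scoped InnerProductSpace

theorem inner_pow_apply_comm [CompleteSpace H] {x : H →L[ℂ] H} (hx : IsSelfAdjoint x) (k : ℕ)
    (v w : H) : ⟪v, (x ^ k) w⟫_ℂ = ⟪(x ^ k) v, w⟫_ℂ :=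
  ((ContinuousLinearMap.isSelfAdjoint_iff_isSymmetric.1 (hx.pow k)) v w).symm

/-- An infinite-dimensional space with a self-adjoint operator `x` contains an infinite sequence of
nonzero vectors whose cyclic subspaces for `x` are mutually orthogonal. -/
theorem exists_seq_cyclic_orthogonal [CompleteSpace H] (hinf : ¬ FiniteDimensional ℂ H)
    {x : H →L[ℂ] H} (hx : IsSelfAdjoint x) :
    ∃ v : ℕ → H, (∀ n, v n ≠ 0) ∧ ∀ m n, m ≠ n → ∀ k : ℕ, ⟪v m, (x ^ k) (v n)⟫_ℂ = 0 := by
  classical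
  have hinj := cfcHom_injective (R := ℝ) hx
  have hself : ∀ f : C(spectrum ℝ x, ℝ), IsSelfAdjoint (cfcHom hx f) := cfcHom_predicate hx
  rcases finite_or_infinite (spectrum ℝ x) with hfin | hfin
  · let e : spectrum ℝ x → C(spectrum ℝ x, ℝ) := fun s => ⟨Pi.single s 1, by fun_prop⟩
    have hmul : ∀ s, x * cfcHom hx (e s) = (s : ℝ) • cfcHom hx (e s) := fun s => by
      nth_rw 1 [← cfcHom_id (R := ℝ) hx]
      rw [← map_mul, ← map_smul]
      congr 1
      ext t
      rcases eq_or_ne t s with rfl | h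
      · simp [e]
      · simp [e, h]
    have hone : ∃ s : spectrum ℝ x,
        ¬ FiniteDimensional ℂ (LinearMap.range (cfcHom hx (e s)).toLinearMap) := by
      by_contra! h
      have := Fintype.ofFinite (spectrum ℝ x)
      have hsum : ∑ s, cfcHom hx (e s) = 1 := by
        rw [← map_sum, ← map_one (cfcHom (R := ℝ) hx)]
        congr 1
        ext t
        simp [e, Pi.single_apply]
      have htop : ⨆ s, LinearMap.range (cfcHom hx (e s)).toLinearMap = ⊤ := by
        refine eq_top_iff.2 fun y _ => ?_
        have hy := congrArg (fun T : H →L[ℂ] H => T y) hsum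
        simp only [sum_apply, one_apply_eq_self] at hy
        rw [← hy]
        exact sum_mem fun s _ => Submodule.mem_iSup_of_mem s ⟨y, rfl⟩
      refine hinf (Module.finite_def.2 ?_)
      rw [← htop]
      exact Submodule.fg_iSup _ fun s => Module.Finite.iff_fg.1 (h s)
    obtain ⟨s, hs⟩ := hone
    set F := LinearMap.range (cfcHom hx (e s)).toLinearMap
    let b := Module.Basis.ofVectorSpace ℂ F
    have : Infinite (Module.Basis.ofVectorSpaceIndex ℂ F) := by
      by_contra h
      rw [not_infinite_iff_finite] at h
      exact hs (Module.Finite.of_basis b)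
    have hon := InnerProductSpace.gramSchmidtNormed_orthonormal (𝕜 := ℂ)
      (b.linearIndependent.comp _ (Infinite.natEmbedding _).injective)
    set g := InnerProductSpace.gramSchmidtNormed ℂ (b ∘ Infinite.natEmbedding _)
    have hxg : ∀ n, x (g n) = (s : ℝ) • (g n : H) := fun n => by
      obtain ⟨y, hy⟩ := (g n).2
      rw [← hy]
      exact congrArg (fun T : H →L[ℂ] H => T y) (hmul s)
    refine ⟨fun n => g n, fun n => ?_, fun m n hmn k => ?_⟩
    · exact fun h => hon.ne_zero n (Subtype.ext h)
    · have hpow : (x ^ k) (g n) = (s : ℝ) ^ k • (g n : H) := by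
        induction k with
        | zero => simp
        | succ k ih => rw [pow_succ, mul_apply_eq_comp, hxg,
          ContinuousLinearMap.map_smul_of_tower, ih, smul_smul, pow_succ']
      have h0 : ⟪g m, g n⟫_ℂ = 0 := hon.2 hmn
      rw [Submodule.coe_inner] at h0
      change ⟪(g m : H), (x ^ k) (g n)⟫_ℂ = 0
      rw [hpow, ← Complex.coe_smul, inner_smul_right, h0, mul_zero]
  · obtain ⟨U, hU, hUo, hUd⟩ := exists_seq_infinite_isOpen_pairwise_disjoint (spectrum ℝ x)
    let f : ℕ → C(spectrum ℝ x, ℝ) := fun n =>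
      ⟨fun t => Metric.infDist t (U n)ᶜ, Metric.continuous_infDist_pt _⟩
    have hf : ∀ n, f n ≠ 0 := fun n hn => by
      obtain ⟨t, ht⟩ := (hU n).nonempty
      obtain ⟨t', ht'⟩ := (hU (n + 1)).nonempty
      have hne : (U n)ᶜ.Nonempty :=
        ⟨t', fun h => Set.disjoint_left.1 (hUd (Nat.succ_ne_self n)) ht' h⟩
      exact ((hUo n).isClosed_compl.notMem_iff_infDist_pos hne).1 (by simpa using ht)
        |>.ne' (DFunLike.congr_fun hn t)
    have hff : ∀ m n, m ≠ n → f m * f n = 0 := fun m n hmn => by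
      ext t
      by_cases ht : t ∈ U m
      · have : f n t = 0 :=
          Metric.infDist_zero_of_mem fun h => Set.disjoint_left.1 (hUd hmn) ht h
        simp [this]
      · have : f m t = 0 := Metric.infDist_zero_of_mem ht
        simp [this]
    have hne : ∀ n, ∃ a, cfcHom hx (f n) a ≠ 0 := fun n => by
      by_contra! h
      exact hf n (hinj ((ContinuousLinearMap.ext h).trans (map_zero (cfcHom hx)).symm))
    choose a ha using hne
    refine ⟨fun n => cfcHom hx (f n) (a n), ha, fun m n hmn k => ?_⟩
    have hzero : cfcHom hx (f m) * (x ^ k * cfcHom hx (f n)) = 0 := by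
      have hid := cfcHom_id (R := ℝ) hx
      rw [← congrArg (· ^ k) hid, ← map_pow, ← map_mul, ← map_mul, mul_left_comm,
        hff m n hmn, mul_zero, map_zero]
    have := (ContinuousLinearMap.isSelfAdjoint_iff_isSymmetric.1 (hself (f m))) (a m)
      ((x ^ k) (cfcHom hx (f n) (a n)))
    refine this.trans ?_
    have h0 := congrArg (fun T : H →L[ℂ] H => T (a n)) hzero
    rw [show (cfcHom hx (f m)).toLinearMap ((x ^ k) (cfcHom hx (f n) (a n))) = 0 from h0,
      inner_zero_right]

end Cyclic
/-- The total space of a family of nonempty countable types over an infinite type `S` can be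
enumerated by `S × V`, with `V` countably infinite, so that fibers over the same point of `S` have
the same label in `V`. -/
theorem exists_equiv_prod_of_countable_fibers {S V : Type*} [Infinite S] [Countable V] [Infinite V]
    (B : S → Type*) [∀ s, Nonempty (B s)] [∀ s, Countable (B s)] :
    ∃ φ : S × V ≃ Σ s, B s, ∀ i j, (φ i).1 = (φ j).1 → i.2 = j.2 := by
  have hS : Nonempty (S ≃ S × V) := by
    refine Cardinal.lift_mk_eq'.1 ?_
    have hV : Cardinal.mk V = Cardinal.aleph0 := Cardinal.mk_eq_aleph0 V
    rw [Cardinal.mk_prod, hV]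
    simp [Cardinal.mul_aleph0_eq]
  obtain ⟨e⟩ := hS
  have hφ : ∀ n : V, Nonempty (S ≃ Σ s : S, B (e.symm (s, n))) := fun n => by
    choose g hg using fun s : S => exists_injective_nat (B s)
    obtain ⟨ι⟩ : Nonempty (S × ℕ ≃ S) := by
      refine Cardinal.lift_mk_eq'.1 ?_
      simp [Cardinal.mul_aleph0_eq]
    refine Function.Embedding.antisymm
      ⟨fun s => ⟨s, Classical.arbitrary _⟩, fun s t h => congrArg Sigma.fst h⟩
      ⟨fun p => ι (p.1, g _ p.2), ?_⟩
    rintro ⟨s, y⟩ ⟨t, z⟩ h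
    obtain ⟨rfl, h'⟩ := Prod.mk.inj (ι.injective h)
    exact congrArg (Sigma.mk s) (hg _ h')
  let φ := fun n => Classical.choice (hφ n)
  let ψ : S × V ≃ Σ s, B s :=
    (((((Equiv.prodComm S V).trans (Equiv.sigmaEquivProd V S).symm).trans
      (Equiv.sigmaCongrRight φ)).trans
      (Equiv.sigmaAssocProd (γ := fun n s => B (e.symm (s, n)))).symm).trans
      (Equiv.sigmaCongrLeft (β := fun p : S × V => B (e.symm p)) (Equiv.prodComm V S))).trans
      (Equiv.sigmaCongrLeft (β := B) e.symm)
  have hψ : ∀ i, (ψ i).1 = e.symm ((φ i.2 i.1).1, i.2) := fun _ => rfl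
  refine ⟨ψ, fun i j h => ?_⟩
  rw [hψ, hψ] at h
  exact (Prod.mk.inj (e.symm.injective h)).2

section Cyclic

variable {H : Type*} [NormedAddCommGroup H] [InnerProductSpace ℂ H]

open scoped InnerProductSpace

/-- An infinite-dimensional Hilbert space has an orthonormal basis, indexed by `S × V`, with respect
to which a given self-adjoint operator is block diagonal. -/
theorem exists_orthonormal_block_diagonal [CompleteSpace H] (hinf : ¬ FiniteDimensional ℂ H)
    {x : H →L[ℂ] H} (hx : IsSelfAdjoint x) (V : Type*) [Countable V] [Infinite V] :
    ∃ (S : Set H) (β : S × V → H), Orthonormal ℂ β ∧ (Submodule.span ℂ (Set.range β))ᗮ = ⊥ ∧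
      ∀ i j, i.2 ≠ j.2 → ⟪β i, x (β j)⟫_ℂ = 0 := by
  obtain ⟨u, hu0, hu⟩ := exists_seq_cyclic_orthogonal hinf hx
  let R : H → H → Prop := fun v w => ∀ k : ℕ, ⟪v, (x ^ k) w⟫_ℂ = 0
  have hRsymm : ∀ v w, R v w → R w v := fun v w h k => by
    rw [inner_pow_apply_comm hx, inner_eq_zero_symm, h k]
  have huinj : Function.Injective u := fun m n hmn => by
    by_contra hne
    have := hu m n hne 0
    rw [hmn, pow_zero, one_apply_eq_self, inner_self_eq_zero] at this
    exact hu0 n this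
  obtain ⟨S, huS, hS⟩ := zorn_subset_nonempty {S : Set H | 0 ∉ S ∧ S.Pairwise R}
    (fun c hc hcc _ => ⟨⋃₀ c, ⟨fun ⟨s, hs, h0⟩ => (hc hs).1 h0,
      (Set.pairwise_sUnion hcc.directedOn).2 fun s hs => (hc hs).2⟩,
      fun s hs => Set.subset_sUnion_of_mem hs⟩) (Set.range u) ⟨fun ⟨n, hn⟩ => hu0 n hn, by
        rintro _ ⟨m, rfl⟩ _ ⟨n, rfl⟩ hmn
        exact hu m n fun h => hmn (congrArg u h)⟩
  have : Infinite S := ((Set.infinite_range_of_injective huinj).mono huS).to_subtype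
  let M : H → Submodule ℂ H := fun v => Submodule.span ℂ (Set.range fun k : ℕ => (x ^ k) v)
  have hM : ∀ v w : S, v ≠ w → ∀ y ∈ M v, ∀ z ∈ M w, ⟪y, z⟫_ℂ = 0 := fun v w hvw => by
    have hR : R v w := hS.prop.2 v.2 w.2 fun h => hvw (Subtype.ext h)
    refine Submodule.isOrtho_iff_inner_eq.1 (Submodule.isOrtho_span.2 ?_)
    rintro _ ⟨k, rfl⟩ _ ⟨l, rfl⟩
    rw [← inner_pow_apply_comm hx, ← mul_apply_eq_comp, ← pow_add]
    exact hR _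
  have hxM : ∀ v, ∀ y ∈ M v, x y ∈ M v := fun v y hy => by
    have : M v ≤ (M v).comap x.toLinearMap := by
      refine Submodule.span_le.2 ?_
      rintro _ ⟨k, rfl⟩
      refine Submodule.subset_span ⟨k + 1, congrArg (fun T : H →L[ℂ] H => T v) (pow_succ' x k)⟩
    exact this hy
  let g : H → ℕ → H := fun v => InnerProductSpace.gramSchmidtNormed ℂ fun k => (x ^ k) v
  have hgM : ∀ v, Submodule.span ℂ (Set.range (g v)) = M v := fun v =>
    (InnerProductSpace.span_gramSchmidtNormed_range _).trans
      (InnerProductSpace.span_gramSchmidt ℂ _)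
  have hg : ∀ v k, g v k ∈ M v := fun v k => by
    rw [← hgM]
    exact Submodule.subset_span ⟨k, rfl⟩
  let B : S → Type := fun v => {k : ℕ // g v k ≠ 0}
  have hB : ∀ v, Nonempty (B v) := fun v => by
    by_contra h
    have h0 : ∀ k, g v k = 0 := fun k => by
      by_contra hk
      exact h ⟨k, hk⟩
    have hv : (v : H) ∈ M v := Submodule.subset_span ⟨0, rfl⟩
    rw [← hgM, Submodule.span_eq_bot.2, Submodule.mem_bot] at hv
    · exact hS.prop.1 (hv ▸ v.2)
    · rintro _ ⟨k, rfl⟩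
      exact h0 k
  obtain ⟨φ, hφ⟩ := exists_equiv_prod_of_countable_fibers (V := V) B
  let γ : (Σ v, B v) → H := fun p => g p.1 p.2.1
  have hγM : ∀ p, γ p ∈ M p.1 := fun p => hg _ _
  have hγ : Orthonormal ℂ γ := by
    refine ⟨fun p => InnerProductSpace.gramSchmidtNormed_unit_length' p.2.2, ?_⟩
    rintro ⟨v, k⟩ ⟨w, l⟩ hne
    by_cases hvw : v = w
    · subst hvw
      exact (InnerProductSpace.gramSchmidtNormed_orthonormal' _).2 fun h =>
        hne (congrArg (Sigma.mk v) h)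
    · exact hM v w hvw _ (hγM ⟨v, k⟩) _ (hγM ⟨w, l⟩)
  refine ⟨S, γ ∘ φ, hγ.comp φ φ.injective, ?_, fun i j hij => ?_⟩
  · rw [φ.surjective.range_comp, eq_bot_iff]
    intro h hh
    have hMh : ∀ v : S, ∀ y ∈ M v, ⟪y, h⟫_ℂ = 0 := fun v y hy => by
      refine (Submodule.mem_orthogonal _ _).1 hh y ?_
      rw [← hgM] at hy
      refine Submodule.span_le.2 ?_ hy
      rintro _ ⟨k, rfl⟩
      by_cases hk : g v k = 0
      · rw [hk]
        exact zero_mem _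
      · exact Submodule.subset_span ⟨⟨v, k, hk⟩, rfl⟩
    by_contra hne
    have hR : ∀ v ∈ S, R h v := fun v hv k => by
      rw [inner_eq_zero_symm]
      exact hMh ⟨v, hv⟩ _ (Submodule.subset_span ⟨k, rfl⟩)
    have hmem : h ∈ S := hS.le_of_ge
      (y := insert h S) ⟨by
        rw [Set.mem_insert_iff, not_or]
        exact ⟨fun h0 => hne h0.symm, hS.prop.1⟩,
        hS.prop.2.insert fun v hv _ => ⟨hR v hv, hRsymm _ _ (hR v hv)⟩⟩
      (Set.subset_insert _ _) (Set.mem_insert _ _)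
    exact hne (inner_self_eq_zero.1 (hR h hmem 0))
  · exact hM (φ i).1 (φ j).1 (fun h => hij (hφ i j h)) _ (hγM (φ i)) _ (hxM _ _ (hγM (φ j)))

end Cyclic

section BlockDiagonal

variable {H : Type*} [NormedAddCommGroup H] [InnerProductSpace ℂ H] [CompleteSpace H]

open scoped InnerProductSpace

theorem inner_linearIsometry_eq_zero {S : Type*} {β : S → H} (hβ : Orthonormal ℂ β) {z : H}
    (hz : ∀ s, ⟪z, β s⟫_ℂ = 0) (f : lp (fun _ : S => ℂ) 2) :
    ⟪z, hβ.orthogonalFamily.linearIsometry f⟫_ℂ = 0 := by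
  have h := (hβ.orthogonalFamily.hasSum_linearIsometry f).mapL (innerSL ℂ z)
  refine h.unique ?_
  convert hasSum_zero using 2 with s
  simp [hz]

/-- A self-adjoint operator on an infinite-dimensional Hilbert space is unitarily equivalent to a
block diagonal one, with blocks indexed by an arbitrary countably infinite type. -/
theorem exists_linearIsometryEquiv_block_diagonal (hinf : ¬ FiniteDimensional ℂ H)
    {x : H →L[ℂ] H} (hx : IsSelfAdjoint x) (V : Type*) [Countable V] [Infinite V] :
    ∃ (S : Set H) (W : H ≃ₗᵢ[ℂ] lp (fun _ : V => lp (fun _ : S => ℂ) 2) 2)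
      (y : V → lp (fun _ : S => ℂ) 2 →L[ℂ] lp (fun _ : S => ℂ) 2),
      (∀ v, IsSelfAdjoint (y v)) ∧ (∀ v, ‖y v‖ ≤ ‖x‖) ∧
      ∀ f v, W (x (W.symm f)) v = y v (f v) := by
  classical
  obtain ⟨S, β, hβ, htotal, hdiag⟩ := exists_orthonormal_block_diagonal hinf hx V
  have hβv : ∀ v, Orthonormal ℂ fun s => β (s, v) := fun v =>
    hβ.comp (fun s => (s, v)) fun s t h => (Prod.mk.inj h).1
  let w : V → lp (fun _ : S => ℂ) 2 →ₗᵢ[ℂ] H := fun v => (hβv v).orthogonalFamily.linearIsometry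
  have hw : OrthogonalFamily ℂ (fun _ : V => lp (fun _ : S => ℂ) 2) w := fun v v' hv f g => by
    refine inner_linearIsometry_eq_zero (hβv v') (fun s => ?_) g
    rw [inner_eq_zero_symm]
    refine inner_linearIsometry_eq_zero (hβv v) (fun t => ?_) f
    exact hβ.2 fun h => hv (Prod.mk.inj h).2.symm
  have hxw : ∀ v v', v ≠ v' → ∀ f g, ⟪w v f, x (w v' g)⟫_ℂ = 0 := fun v v' hv f g => by
    have hsymm := ContinuousLinearMap.isSelfAdjoint_iff_isSymmetric.1 hx
    refine (hsymm _ _).symm.trans ?_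
    refine inner_linearIsometry_eq_zero (hβv v') (fun s => ?_) g
    refine (hsymm _ _).trans ?_
    rw [inner_eq_zero_symm]
    refine inner_linearIsometry_eq_zero (hβv v) (fun t => ?_) f
    refine (hsymm _ _).trans ?_
    exact hdiag _ _ hv.symm
  have hsum : IsHilbertSum ℂ (fun _ : V => lp (fun _ : S => ℂ) 2) w := by
    refine IsHilbertSum.mk hw ?_
    rw [top_le_iff, Submodule.topologicalClosure_eq_top_iff, eq_bot_iff, ← htotal]
    refine Submodule.orthogonal_le (Submodule.span_le.2 ?_)
    rintro _ ⟨⟨s, v⟩, rfl⟩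
    refine Submodule.mem_iSup_of_mem v ⟨lp.single 2 s 1, ?_⟩
    exact ((hβv v).orthogonalFamily.linearIsometry_apply_single _).trans (by simp)
  let W := hsum.linearIsometryEquiv
  have hW : ∀ h v, W h v = (w v).toContinuousLinearMap.adjoint h := fun h v => by
    refine ext_inner_left ℂ fun k => ?_
    rw [ContinuousLinearMap.adjoint_inner_right, ← lp.inner_single_left
      (G := fun _ : V => lp (fun _ : S => ℂ) 2), ← W.symm.inner_map_map, W.symm_apply_apply]
    exact congrArg (⟪·, h⟫_ℂ) (hsum.linearIsometryEquiv_symm_apply_single k)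
  refine ⟨S, W, fun v => (w v).toContinuousLinearMap.adjoint ∘L x ∘L (w v).toContinuousLinearMap,
    fun v => hx.adjoint_conj _, fun v => ?_, fun f v => ?_⟩
  · refine (ContinuousLinearMap.opNorm_comp_le _ _).trans ?_
    rw [LinearIsometryEquiv.norm_map]
    have h1 := (w v).norm_toContinuousLinearMap_le
    exact (mul_le_of_le_one_left (norm_nonneg _) h1).trans
      ((ContinuousLinearMap.opNorm_comp_le _ _).trans (mul_le_of_le_one_right (norm_nonneg _) h1))
  · rw [hW]
    refine ext_inner_left ℂ fun k => ?_
    simp only [ContinuousLinearMap.comp_apply]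
    rw [ContinuousLinearMap.adjoint_inner_right, ContinuousLinearMap.adjoint_inner_right]
    have h := (hsum.hasSum_linearIsometryEquiv_symm f).mapL (innerSL ℂ (w v k) ∘L x)
    refine h.unique (hasSum_single v fun v' hv' => ?_)
    exact hxw v v' hv'.symm _ _

end BlockDiagonal

/-- On an infinite-dimensional complex Hilbert space, every self-adjoint `x`
with `‖x‖ ≤ c` is a sum of `n = 2⌈2 + 2c + 2√(c² + 2c)⌉` compositions of pairs of orthogonal
projections. -/
theorem representation_with_explicit_n
    {H : Type*} [NormedAddCommGroup H] [InnerProductSpace ℂ H] [CompleteSpace H]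
    (hinf : ¬ FiniteDimensional ℂ H)
    (c : ℝ) (hc : 0 < c)
    (n : ℕ) (hn : n = 2 * ⌈2 + 2 * c + 2 * Real.sqrt (c ^ 2 + 2 * c)⌉₊)
    (x : H →L[ℂ] H) (hx : ContinuousLinearMap.adjoint x = x) (hxc : ‖x‖ ≤ c) :
    ∃ P Q : Fin n → H →L[ℂ] H,
      (∀ i, ContinuousLinearMap.adjoint (P i) = P i ∧ P i ∘L P i = P i) ∧
      (∀ i, ContinuousLinearMap.adjoint (Q i) = Q i ∧ Q i ∘L Q i = Q i) ∧
      x = ∑ i, Q i ∘L P i := by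
  have hs := Real.sqrt_nonneg (c ^ 2 + 2 * c)
  have hs2 := Real.sq_sqrt (show 0 ≤ c ^ 2 + 2 * c by positivity)
  set r := Real.sqrt (c ^ 2 + 2 * c)
  have hle := Nat.le_ceil (2 + 2 * c + 2 * r)
  obtain ⟨N, hN⟩ : ∃ N, ⌈2 + 2 * c + 2 * r⌉₊ = N + 1 :=
    Nat.exists_eq_succ_of_ne_zero (Nat.ceil_pos.2 (by linarith)).ne'
  rw [hN] at hn hle
  push_cast at hle
  have hN2 : 2 ≤ N := by
    have : (1 : ℝ) < N := by linarith
    exact_mod_cast this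
  have hNc : 4 * ((N : ℝ) + 1) * c ≤ ((N : ℝ) + 1 - 2) ^ 2 := by
    nlinarith [mul_nonneg (sub_nonneg.2 hle) (sub_nonneg.2 hle),
      mul_nonneg (sub_nonneg.2 hle) hs]
  obtain ⟨S, W, y, hy, hyx, hWy⟩ :=
    exists_linearIsometryEquiv_block_diagonal hinf (x := x) hx (List (Fin (N + 1)))
  obtain ⟨p, q, hp, hq, hpq⟩ := exists_sum_jordan_products hN2 hNc y hy
    (fun v => (hyx v).trans hxc) (W.conjStarAlgEquiv x) hWy
  let T := W.conjStarAlgEquiv.symm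
  have hT : ∀ z, star z = z ∧ z * z = z →
      ContinuousLinearMap.adjoint (T z) = T z ∧ T z ∘L T z = T z := fun z hz =>
    ⟨(map_star T z).symm.trans (congrArg T hz.1), (map_mul T z z).symm.trans (congrArg T hz.2)⟩
  let pq : Fin (N + 1) × Fin 2 → H →L[ℂ] H := fun i => T (![p i.1, q i.1] i.2)
  let qp : Fin (N + 1) × Fin 2 → H →L[ℂ] H := fun i => T (![q i.1, p i.1] i.2)
  obtain rfl : n = (N + 1) * 2 := hn.trans (mul_comm _ _)
  refine ⟨fun i => qp (finProdFinEquiv.symm i), fun i => pq (finProdFinEquiv.symm i),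
    fun i => hT _ ?_, fun i => hT _ ?_, ?_⟩
  · generalize finProdFinEquiv.symm i = j
    obtain ⟨k, l⟩ := j
    fin_cases l
    exacts [hq k, hp k]
  · generalize finProdFinEquiv.symm i = j
    obtain ⟨k, l⟩ := j
    fin_cases l
    exacts [hp k, hq k]
  · rw [finProdFinEquiv.symm.sum_comp fun j => pq j ∘L qp j, Fintype.sum_prod_type]
    have hx' : x = T (∑ k, (p k * q k + q k * p k)) := by
      rw [← hpq]
      exact (W.conjStarAlgEquiv.symm_apply_apply x).symm
    rw [hx', map_sum]
    refine Finset.sum_congr rfl fun k _ => ?_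
    rw [Fin.sum_univ_two, map_add, map_mul, map_mul]
    rfl
end

section
/- Let H be an infinite-dimensional complex Hilbert space, let c > 0, and let n be a positive integer with n < 2 + 4c + 4·√(c² + c). Then there exists a self-adjoint bounded operator x on H with ‖x‖ ≤ c (for instance x = −c·1) which cannot be written as ∑_{i=1}^n Q_i P_i for any orthogonal projections P_1,…,P_n, Q_1,…,Q_n on H. -/
section CStarAlgebra

variable {A : Type*} [CStarAlgebra A] [PartialOrder A] [StarOrderedRing A]

/-- If every point of the real spectrum of a self-adjoint `a` has square at least `s`, then
`s ≤ a ^ 2`. -/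
lemma IsSelfAdjoint.algebraMap_le_sq {a : A} (ha : IsSelfAdjoint a) {s : ℝ}
    (hs : ∀ t ∈ spectrum ℝ a, s ≤ t ^ 2) : algebraMap ℝ A s ≤ a ^ 2 := by
  rw [← cfc_pow_id (R := ℝ) a 2 ha, algebraMap_le_cfc_iff (fun x : ℝ => x ^ 2) s a]
  exact hs

/-- For projections `p`, `q`, an upper bound `M` for the square of `2 * (p + q) - 1` forces every
spectral value `t` of that element, apart from the extreme ones, to satisfy `(2 - t) ^ 2 ≤ M`. -/
lemma two_sub_sq_le_of_mem_spectrum {p q : A} (hp : IsStarProjection p) (hq : IsStarProjection q)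
    {M t : ℝ} (hM : (2 * (p + q) - 1) ^ 2 ≤ algebraMap ℝ A M)
    (ht : t ∈ spectrum ℝ (2 * (p + q) - 1)) (h₁ : -1 < t) (h₂ : t < 3) :
    (2 - t) ^ 2 ≤ M := by
  set f : A := 2 * (p + q) - 1 with hf
  set d : A := 2 * (p - q) with hd
  have hpp : p * p = p := hp.isIdempotentElem
  have hqq : q * q = q := hq.isIdempotentElem
  have hds : star d = d := by
    rw [hd, star_mul, star_sub, hp.isSelfAdjoint.star_eq, hq.isSelfAdjoint.star_eq, star_ofNat]
    noncomm_ring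
  have hfd : f * d = d * (2 - f) := by
    rw [hf, hd]
    noncomm_ring
    simp only [hpp, hqq]
    abel
  have hdf : d * f = (2 - f) * d := by
    rw [hf, hd]
    noncomm_ring
    simp only [hpp, hqq]
    abel
  have hdd : d * d = (3 - f) * (1 + f) := by
    rw [hf, hd]
    noncomm_ring
    simp only [hpp, hqq]
    abel
  have hpos : 0 ≤ star d * (algebraMap ℝ A M - f ^ 2) * d :=
    star_left_conjugate_nonneg (sub_nonneg.mpr hM) d
  let g : Polynomial ℝ := (3 - .X) * (1 + .X) * (.C M - (2 - .X) ^ 2)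
  have hg : star d * (algebraMap ℝ A M - f ^ 2) * d = Polynomial.aeval f g := by
    have h : d * f ^ 2 * d = Polynomial.aeval f
        ((2 - .X) * ((3 - .X) * (1 + .X)) * (2 - .X) : Polynomial ℝ) := by
      calc d * f ^ 2 * d = (d * f) * (f * d) := by noncomm_ring
        _ = (2 - f) * (d * d) * (2 - f) := by rw [hdf, hfd]; noncomm_ring
        _ = _ := by rw [hdd]; simp [map_ofNat]
    have h' : d * algebraMap ℝ A M * d = Polynomial.aeval f
        ((3 - .X) * (1 + .X) * .C M : Polynomial ℝ) := by
      rw [mul_assoc, Algebra.commutes, ← mul_assoc, hdd]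
      simp [map_ofNat]
    rw [hds, mul_sub, sub_mul, h, h', ← map_sub]
    congr 1
    ring
  have hmem : g.eval t ∈ spectrum ℝ (Polynomial.aeval f g) :=
    spectrum.subset_polynomial_aeval f g ⟨t, ht, rfl⟩
  have hge : 0 ≤ g.eval t := spectrum_nonneg_of_nonneg (hg ▸ hpos) hmem
  have heval : g.eval t = (3 - t) * (1 + t) * (M - (2 - t) ^ 2) := by simp [g]
  rw [heval] at hge
  have := nonneg_of_mul_nonneg_right hge (mul_pos (by linarith) (by linarith))
  linarith

/-- If the negative scalar `-c` is a sum of `n` products of two projections, then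
`2 ≤ n` and `8 * c * n ≤ (n - 2) ^ 2`. -/
lemma le_sq_of_sum_mul_eq_neg [Nontrivial A] {n : ℕ} (hn : 0 < n) {c : ℝ} (hc : 0 < c)
    {p q : Fin n → A} (hp : ∀ i, IsStarProjection (p i)) (hq : ∀ i, IsStarProjection (q i))
    (hsum : ∑ i, q i * p i = algebraMap ℝ A (-c)) :
    2 ≤ n ∧ 8 * c * n ≤ ((n : ℝ) - 2) ^ 2 := by
  let f : Fin n → A := fun i => 2 * (p i + q i) - 1
  have hfs (i) : IsSelfAdjoint (f i) := by
    have := (hp i).isSelfAdjoint.star_eq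
    have := (hq i).isSelfAdjoint.star_eq
    simp only [IsSelfAdjoint, f, star_sub, star_mul, star_add, star_ofNat, star_one, *]
    noncomm_ring
  have hsum' : ∑ i, p i * q i = algebraMap ℝ A (-c) := by
    have h := congrArg star hsum
    rw [star_sum, (IsSelfAdjoint.algebraMap A (.all (-c))).star_eq] at h
    rw [← h]
    refine Finset.sum_congr rfl fun i _ => ?_
    rw [star_mul, (hp i).isSelfAdjoint.star_eq, (hq i).isSelfAdjoint.star_eq]
  have hsq (i) : f i ^ 2 = 4 * (p i * q i) + 4 * (q i * p i) + 1 := by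
    have hpp : p i * p i = p i := (hp i).isIdempotentElem
    have hqq : q i * q i = q i := (hq i).isIdempotentElem
    simp only [f]
    noncomm_ring
    simp only [hpp, hqq]
    abel
  have hfsum : ∑ i, f i ^ 2 = algebraMap ℝ A (n - 8 * c) := by
    simp only [hsq, Finset.sum_add_distrib, ← Finset.mul_sum, hsum, hsum']
    simp only [Finset.sum_const, Finset.card_univ, Fintype.card_fin, nsmul_eq_mul, map_neg,
      map_sub, map_mul, map_natCast, map_ofNat]
    noncomm_ring
  have : NeZero n := ⟨hn.ne'⟩
  have hcompact : IsCompact (⋃ i, spectrum ℝ (f i)) :=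
    isCompact_iUnion fun i => spectrum.isCompact (𝕜 := ℝ) (f i)
  have hnonempty : (⋃ i, spectrum ℝ (f i)).Nonempty :=
    Set.nonempty_iUnion.mpr ⟨0, ContinuousFunctionalCalculus.spectrum_nonempty _ (hfs 0)⟩
  obtain ⟨t, htmem, htmin⟩ := hcompact.exists_isMinOn hnonempty
    (f := fun x : ℝ => x ^ 2) (by fun_prop)
  obtain ⟨j, htj⟩ := Set.mem_iUnion.mp htmem
  have hlow (i) : algebraMap ℝ A (t ^ 2) ≤ f i ^ 2 :=
    (hfs i).algebraMap_le_sq fun s hs => htmin (Set.mem_iUnion.mpr ⟨i, hs⟩)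
  have hup : f j ^ 2 ≤ algebraMap ℝ A (n - 8 * c - (n - 1) * t ^ 2) := by
    have h₁ := Finset.card_nsmul_le_sum (Finset.univ.erase j) (fun i => f i ^ 2)
      (algebraMap ℝ A (t ^ 2)) fun i _ => hlow i
    rw [Finset.card_erase_of_mem (Finset.mem_univ j), Finset.card_univ, Fintype.card_fin,
      ← map_nsmul, nsmul_eq_mul, Nat.cast_pred hn] at h₁
    rw [map_sub, ← hfsum, ← Finset.add_sum_erase _ _ (Finset.mem_univ j), add_sub_assoc]
    exact le_add_of_nonneg_right (sub_nonneg.mpr h₁)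
  have hmul : n * t ^ 2 ≤ n - 8 * c := by
    have := algebraMap_le_algebraMap.mp ((hlow j).trans hup)
    linarith
  have hn' : (1 : ℝ) ≤ n := by exact_mod_cast hn
  have ht : t ^ 2 < 1 := by
    by_contra! h
    nlinarith
  obtain ⟨ht₁, ht₂⟩ := abs_lt.mp ((sq_lt_one_iff_abs_lt_one t).mp ht)
  have hkey := two_sub_sq_le_of_mem_spectrum (hp j) (hq j) hup htj ht₁ (by linarith)
  constructor
  · by_contra! h
    obtain rfl : n = 1 := by omega
    push_cast at hkey
    nlinarith
  · nlinarith [sq_nonneg (n * t - 2)]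

end CStarAlgebra


/-- If `n < 2 + 4c + 4√(c² + c)`, then some self-adjoint operator `x` with
`‖x‖ ≤ c` on an infinite-dimensional complex Hilbert space is not a sum of `n` compositions of
pairs of orthogonal projections. -/
theorem no_representation_with_small_n
    {H : Type*} [NormedAddCommGroup H] [InnerProductSpace ℂ H] [CompleteSpace H]
    (hinf : ¬ FiniteDimensional ℂ H)
    (c : ℝ) (hc : 0 < c)
    (n : ℕ) (hn : 0 < n) (hlt : (n : ℝ) < 2 + 4 * c + 4 * Real.sqrt (c ^ 2 + c)) :
    ∃ x : H →L[ℂ] H, ContinuousLinearMap.adjoint x = x ∧ ‖x‖ ≤ c ∧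
      ¬ ∃ P Q : Fin n → H →L[ℂ] H,
          (∀ i, ContinuousLinearMap.adjoint (P i) = P i ∧ P i ∘L P i = P i) ∧
          (∀ i, ContinuousLinearMap.adjoint (Q i) = Q i ∧ Q i ∘L Q i = Q i) ∧
          x = ∑ i, Q i ∘L P i := by
  have : Nontrivial H := by
    by_contra h
    rw [not_nontrivial_iff_subsingleton] at h
    exact hinf inferInstance
  refine ⟨algebraMap ℝ (H →L[ℂ] H) (-c), ?_, ?_, ?_⟩
  · exact (IsSelfAdjoint.algebraMap (H →L[ℂ] H) (.all (-c))).star_eq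
  · rw [norm_algebraMap', norm_neg, Real.norm_of_nonneg hc.le]
  rintro ⟨P, Q, hP, hQ, hsum⟩
  obtain ⟨h₂, hsq⟩ := le_sq_of_sum_mul_eq_neg hn hc (p := P) (q := Q)
    (fun i => ⟨(hP i).2, (hP i).1⟩) (fun i => ⟨(hQ i).2, (hQ i).1⟩) hsum.symm
  have h₂' : (2 : ℝ) ≤ n := by exact_mod_cast h₂
  have hroot : Real.sqrt (c ^ 2 + c) ^ 2 = c ^ 2 + c := Real.sq_sqrt (by positivity)
  have hroot_nonneg := Real.sqrt_nonneg (c ^ 2 + c)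
  rcases le_or_gt 0 ((n : ℝ) - 2 - 4 * c) with h | h
  · nlinarith
  · nlinarith
end

section
/- Let P and Q be one-dimensional orthogonal projections on ℂ², let e₁ = (1,0) and e₂ = (0,1), and set x = Re ⟨Q P e₁, e₁⟩ and y = Re ⟨Q P e₂, e₂⟩. Then (x − y)² ≤ x + y ≤ 1. -/
/-- Real coordinates of a rank-one Hermitian idempotent `2×2` matrix. -/
theorem exists_coords_of_rank_one_projection (P : Matrix (Fin 2) (Fin 2) ℂ)
    (hP : P.IsHermitian) (hP2 : P * P = P) (hPrank : P.rank = 1) :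
    ∃ a u v : ℝ, P = !![(a : ℂ), ⟨u, v⟩; ⟨u, -v⟩, ((1 - a : ℝ) : ℂ)] ∧
      u ^ 2 + v ^ 2 = a - a ^ 2 := by
  have hdet : P.det = 0 := by
    by_contra h
    have h2 := Matrix.rank_of_isUnit P ((Matrix.isUnit_iff_isUnit_det P).2 (Ne.isUnit h))
    simp [hPrank] at h2
  have hne : P ≠ 0 := by
    rintro rfl
    simp at hPrank
  rw [Matrix.det_fin_two] at hdet
  have hmul (i j : Fin 2) : P i 0 * P 0 j + P i 1 * P 1 j = P i j := by
    simpa [Matrix.mul_apply, Fin.sum_univ_two] using congrFun (congrFun hP2 i) j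
  have htr : P 0 0 + P 1 1 = 1 := by
    by_contra h
    have h' : P 0 0 + P 1 1 - 1 ≠ 0 := sub_ne_zero.2 h
    apply hne
    ext i j
    refine (mul_eq_zero.1 (?_ : (P 0 0 + P 1 1 - 1) * P i j = 0)).resolve_left h'
    fin_cases i <;> fin_cases j <;> simp only [Fin.zero_eta, Fin.mk_one]
    · linear_combination hmul 0 0 + hdet
    · linear_combination hmul 0 1
    · linear_combination hmul 1 0
    · linear_combination hmul 1 1 + hdet
  have h00 : ((P 0 0).re : ℂ) = P 0 0 := Complex.conj_eq_iff_re.1 (hP.apply 0 0)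
  have h10 : P 1 0 = star (P 0 1) := (hP.apply 1 0).symm
  refine ⟨(P 0 0).re, (P 0 1).re, (P 0 1).im, ?_, ?_⟩
  · ext i j
    fin_cases i <;> fin_cases j
    · simp [h00]
    · simp
    · simp [h10, Complex.ext_iff]
    · simp [h00, ← htr]
  · have h := hmul 0 0
    rw [h10, ← h00] at h
    have h' := congrArg Complex.re h
    simp at h'
    linarith


/-- For one-dimensional orthogonal projections `P, Q` on `ℂ²` (Hermitian
idempotent `2×2` matrices of rank 1), the numbers `x = Re⟨QPe₁, e₁⟩` and `y = Re⟨QPe₂, e₂⟩`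
(the real parts of the diagonal entries of `QP`) satisfy `(x - y)² ≤ x + y ≤ 1`. -/
theorem diagonal_entries_in_A
    (P Q : Matrix (Fin 2) (Fin 2) ℂ)
    (hP : P.IsHermitian) (hP2 : P * P = P) (hPrank : P.rank = 1)
    (hQ : Q.IsHermitian) (hQ2 : Q * Q = Q) (hQrank : Q.rank = 1)
    (x y : ℝ) (hx : x = ((Q * P) 0 0).re) (hy : y = ((Q * P) 1 1).re) :
    (x - y) ^ 2 ≤ x + y ∧ x + y ≤ 1 := by
  obtain ⟨a, u, v, rfl, hz⟩ := exists_coords_of_rank_one_projection P hP hP2 hPrank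
  obtain ⟨b, s, t, rfl, hw⟩ := exists_coords_of_rank_one_projection Q hQ hQ2 hQrank
  have hx' : x = b * a + (s * u + t * v) := by
    simp [hx, Matrix.mul_apply, Fin.sum_univ_two]
  have hy' : y = (s * u + t * v) + (1 - b) * (1 - a) := by
    simp [hy, Matrix.mul_apply, Fin.sum_univ_two]
  rw [hx', hy']
  constructor
  · linarith [sq_nonneg (u + s), sq_nonneg (v + t)]
  · linarith [sq_nonneg (u - s), sq_nonneg (v - t), sq_nonneg (a - b)]
end

section
/- Let (x, y) ∈ ℝ² satisfy (x − y)² ≤ x + y ≤ 1. Then there exist one-dimensional orthogonal projections P and Q on ℝ² (real symmetric idempotent 2×2 matrices of rank 1) such that ⟨Q P e₁, e₁⟩ = x and ⟨Q P e₂, e₂⟩ = y, where e₁ = (1,0) and e₂ = (0,1). -/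
open Matrix in
/-- The matrix `v vᵀ` of a unit vector `v` is an orthogonal projection of rank one. -/
theorem vecMulVec_self_projection {n : Type*} [Fintype n] {v : n → ℝ} (hv : v ⬝ᵥ v = 1) :
    (vecMulVec v v).transpose = vecMulVec v v ∧
      vecMulVec v v * vecMulVec v v = vecMulVec v v ∧ (vecMulVec v v).rank = 1 := by
  have hidem : vecMulVec v v * vecMulVec v v = vecMulVec v v := by
    rw [vecMulVec_mul_vecMulVec, hv, one_smul]
  refine ⟨transpose_vecMulVec v v, hidem, le_antisymm (rank_vecMulVec_le v v) ?_⟩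
  rw [Nat.one_le_iff_ne_zero]
  intro h0
  rw [rank, Submodule.finrank_eq_zero, LinearMap.range_eq_bot] at h0
  have hv0 : vecMulVec v v *ᵥ v = 0 := LinearMap.congr_fun h0 v
  rw [vecMulVec_mulVec, hv, MulOpposite.op_one, one_smul] at hv0
  simp [hv0] at hv

/-- A point of the region `(x - y)² ≤ x + y ≤ 1` has the form
`x = cos (a - b) cos a cos b`, `y = cos (a - b) sin a sin b`. -/
theorem exists_angles_of_sq_sub_le_add {x y : ℝ} (h1 : (x - y) ^ 2 ≤ x + y) (h2 : x + y ≤ 1) :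
    ∃ a b : ℝ,
      (Real.cos a * Real.cos b + Real.sin a * Real.sin b) * (Real.cos a * Real.cos b) = x ∧
      (Real.cos a * Real.cos b + Real.sin a * Real.sin b) * (Real.sin a * Real.sin b) = y := by
  have hs : 0 ≤ x + y := (sq_nonneg _).trans h1
  obtain ⟨c, d, hc, hd, hcc, hcd⟩ : ∃ c d : ℝ, |c| ≤ 1 ∧ |d| ≤ 1 ∧ c * c = x + y ∧
      c * d = x - y := by
    have hcc := Real.mul_self_sqrt hs
    refine ⟨√(x + y), (x - y) / √(x + y), ?_, ?_, hcc, ?_⟩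
    · rw [abs_of_nonneg (Real.sqrt_nonneg _)]
      exact Real.sqrt_le_one.mpr h2
    · rw [abs_div, abs_of_nonneg (Real.sqrt_nonneg _)]
      exact div_le_one_of_le₀ (Real.abs_le_sqrt h1) (Real.sqrt_nonneg _)
    · refine mul_div_cancel_of_imp' fun h => ?_
      rw [h, mul_zero] at hcc
      rw [← hcc] at h1
      exact pow_eq_zero_iff two_ne_zero |>.mp (le_antisymm h1 (sq_nonneg _))
  have hcosc := Real.cos_arccos (abs_le.mp hc).1 (abs_le.mp hc).2
  have hcosd := Real.cos_arccos (abs_le.mp hd).1 (abs_le.mp hd).2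
  refine ⟨(Real.arccos d + Real.arccos c) / 2, (Real.arccos d - Real.arccos c) / 2, ?_⟩
  set a := (Real.arccos d + Real.arccos c) / 2 with ha
  set b := (Real.arccos d - Real.arccos c) / 2 with hb
  have hsub : Real.cos a * Real.cos b + Real.sin a * Real.sin b = c := by
    rw [← Real.cos_sub, ← hcosc, ha, hb]
    ring_nf
  have hadd : Real.cos a * Real.cos b - Real.sin a * Real.sin b = d := by
    rw [← Real.cos_add, ← hcosd, ha, hb]
    ring_nf
  rw [hsub]
  constructor
  · linear_combination (c / 2) * (hsub + hadd) + (hcc + hcd) / 2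
  · linear_combination (c / 2) * (hsub - hadd) + (hcc - hcd) / 2


/-- If `(x, y) ∈ ℝ²` satisfies `(x - y)² ≤ x + y ≤ 1`, then there exist
one-dimensional orthogonal projections `P, Q` on `ℝ²` (symmetric idempotent `2×2` matrices of
rank 1) with `⟨QPe₁, e₁⟩ = x` and `⟨QPe₂, e₂⟩ = y`, i.e. `(QP)₁₁ = x` and `(QP)₂₂ = y`. -/
theorem point_of_A_realized_by_projections
    (x y : ℝ) (h1 : (x - y) ^ 2 ≤ x + y) (h2 : x + y ≤ 1) :
    ∃ P Q : Matrix (Fin 2) (Fin 2) ℝ,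
      P.transpose = P ∧ P * P = P ∧ P.rank = 1 ∧
      Q.transpose = Q ∧ Q * Q = Q ∧ Q.rank = 1 ∧
      (Q * P) 0 0 = x ∧ (Q * P) 1 1 = y := by
  obtain ⟨a, b, hx, hy⟩ := exists_angles_of_sq_sub_le_add h1 h2
  have hunit (t : ℝ) : ![Real.cos t, Real.sin t] ⬝ᵥ ![Real.cos t, Real.sin t] = 1 := by
    simp [← sq]
  obtain ⟨hPt, hPi, hPr⟩ := vecMulVec_self_projection (hunit b)
  obtain ⟨hQt, hQi, hQr⟩ := vecMulVec_self_projection (hunit a)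
  refine ⟨_, _, hPt, hPi, hPr, hQt, hQi, hQr, ?_, ?_⟩
  · rw [← hx]
    simp [Matrix.mul_apply]
    ring
  · rw [← hy]
    simp [Matrix.mul_apply]
    ring
end

section
/- Let (x, y) ∈ ℝ² satisfy (x − y)² ≤ x + y ≤ 1 and (x, y) ≠ (0, 0). Set s = x + y and d = x − y. Then the 2×2 real matrices P = (1/2)·[[1 + d + √((s − d²)(1/s − 1)), √(s − d²) − d·√(1/s − 1)], [√(s − d²) − d·√(1/s − 1), 1 − d − √((s − d²)(1/s − 1))]] and Q = (1/2)·[[1 + d − √((s − d²)(1/s − 1)), √(s − d²) + d·√(1/s − 1)], [√(s − d²) + d·√(1/s − 1), 1 − d + √((s − d²)(1/s − 1))]] are symmetric, satisfy P² = P, Q² = Q, trace P = trace Q = 1 (hence are one-dimensional orthogonal projections), and the diagonal entries of Q P are (QP)₁₁ = x and (QP)₂₂ = y. -/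
/-- For `(x, y) ≠ (0, 0)` with `(x - y)² ≤ x + y ≤ 1`, the explicit matrices
`P^{x,y}` and `Q^{x,y}` from Lemma 1 of the paper (with `s = x + y`, `d = x - y`) are symmetric
idempotents of trace 1 (one-dimensional orthogonal projections), and the diagonal entries of
`Q^{x,y} P^{x,y}` are `x` and `y`. -/
theorem explicit_projection_formulas
    (x y : ℝ) (h1 : (x - y) ^ 2 ≤ x + y) (h2 : x + y ≤ 1) (h0 : (x, y) ≠ (0, 0))
    (s d : ℝ) (hs : s = x + y) (hd : d = x - y)
    (P Q : Matrix (Fin 2) (Fin 2) ℝ)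
    (hPdef : P = (1 / 2 : ℝ) •
      !![1 + d + Real.sqrt ((s - d ^ 2) * (1 / s - 1)),
           Real.sqrt (s - d ^ 2) - d * Real.sqrt (1 / s - 1);
         Real.sqrt (s - d ^ 2) - d * Real.sqrt (1 / s - 1),
           1 - d - Real.sqrt ((s - d ^ 2) * (1 / s - 1))])
    (hQdef : Q = (1 / 2 : ℝ) •
      !![1 + d - Real.sqrt ((s - d ^ 2) * (1 / s - 1)),
           Real.sqrt (s - d ^ 2) + d * Real.sqrt (1 / s - 1);
         Real.sqrt (s - d ^ 2) + d * Real.sqrt (1 / s - 1),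
           1 - d + Real.sqrt ((s - d ^ 2) * (1 / s - 1))]) :
    P.transpose = P ∧ Q.transpose = Q ∧ P * P = P ∧ Q * Q = Q ∧
      P.trace = 1 ∧ Q.trace = 1 ∧ (Q * P) 0 0 = x ∧ (Q * P) 1 1 = y := by
  have hspos : 0 < s := by
    rw [hs]
    refine lt_of_le_of_ne (le_trans (sq_nonneg _) h1) fun h => h0 ?_
    have hxy : x - y = 0 := by
      rw [← h] at h1
      exact pow_eq_zero_iff two_ne_zero |>.mp (le_antisymm h1 (sq_nonneg _))
    exact Prod.ext (by linarith : x = 0) (by linarith : y = 0)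
  have hsd : 0 ≤ s - d ^ 2 := by rw [hs, hd]; linarith
  have hinv : 0 ≤ 1 / s - 1 := by
    rw [sub_nonneg, le_div_iff₀ hspos]
    linarith
  rw [Real.sqrt_mul hsd] at hPdef hQdef
  have ha := Real.sq_sqrt hsd
  have hb : s * Real.sqrt (1 / s - 1) ^ 2 = 1 - s := by
    rw [Real.sq_sqrt hinv]
    field_simp
  generalize Real.sqrt (s - d ^ 2) = a at *
  generalize Real.sqrt (1 / s - 1) = b at *
  have hx : x = (s + d) / 2 := by linarith
  have hy : y = (s - d) / 2 := by linarith
  subst hPdef hQdef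
  refine ⟨?_, ?_, ?_, ?_, ?_, ?_, ?_, ?_⟩
  · ext i j
    fin_cases i <;> fin_cases j <;> simp
  · ext i j
    fin_cases i <;> fin_cases j <;> simp
  · ext i j
    fin_cases i <;> fin_cases j <;> simp [Matrix.mul_apply, Fin.sum_univ_two] <;>
      first | ring1 | linear_combination (1 + b ^ 2) / 4 * ha + hb / 4
  · ext i j
    fin_cases i <;> fin_cases j <;> simp [Matrix.mul_apply, Fin.sum_univ_two] <;>
      first | ring1 | linear_combination (1 + b ^ 2) / 4 * ha + hb / 4
  · simp [Matrix.trace_fin_two]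
    ring
  · simp [Matrix.trace_fin_two]
    ring
  · simp [Matrix.mul_apply, Fin.sum_univ_two]
    linear_combination (1 - b ^ 2) / 4 * ha - hb / 4 - hx
  · simp [Matrix.mul_apply, Fin.sum_univ_two]
    linear_combination (1 - b ^ 2) / 4 * ha - hb / 4 - hy
end

section
/- Let e ∈ ℂ² be a unit vector and let P, Q be one-dimensional orthogonal projections on ℂ². Then −1/8 ≤ Re ⟨Q P e, e⟩ ≤ 1. -/
open scoped ComplexInnerProductSpace

section

variable {𝕜 E : Type*} [RCLike 𝕜] [NormedAddCommGroup E] [InnerProductSpace 𝕜 E] {S T : E →ₗ[𝕜] E}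

theorem LinearMap.IsSymmetricProjection.re_inner_apply_self (hS : S.IsSymmetricProjection) (x : E) :
    RCLike.re (inner 𝕜 (S x) x) = ‖S x‖ ^ 2 := by
  have h : S (S x) = S x := LinearMap.congr_fun hS.isIdempotentElem.eq x
  rw [← inner_self_eq_norm_sq (𝕜 := 𝕜), ← hS.isSymmetric (S x) x, h]

theorem LinearMap.IsSymmetricProjection.norm_apply_sq_le (hS : S.IsSymmetricProjection) (x : E) :
    ‖S x‖ ^ 2 ≤ ‖x‖ ^ 2 := by
  have h := norm_sub_sq (𝕜 := 𝕜) (S x) x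
  rw [hS.re_inner_apply_self] at h
  nlinarith [sq_nonneg ‖S x - x‖]

theorem LinearMap.IsSymmetricProjection.re_inner_comp_le
    (hS : S.IsSymmetricProjection) (hT : T.IsSymmetricProjection) (x : E) :
    RCLike.re (inner 𝕜 (T (S x)) x) ≤ ‖x‖ ^ 2 := by
  rw [hT.isSymmetric (S x) x]
  have h := norm_sub_sq (𝕜 := 𝕜) (S x) (T x)
  nlinarith [sq_nonneg ‖S x - T x‖, hS.norm_apply_sq_le x, hT.norm_apply_sq_le x]

/-- The bound comes from expanding `0 ≤ ‖2 • (S x + T x) - x‖ ^ 2`. -/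
theorem LinearMap.IsSymmetricProjection.le_re_inner_comp
    (hS : S.IsSymmetricProjection) (hT : T.IsSymmetricProjection) (x : E) :
    -(1 / 8 : ℝ) * ‖x‖ ^ 2 ≤ RCLike.re (inner 𝕜 (T (S x)) x) := by
  rw [hT.isSymmetric (S x) x]
  have h := norm_sub_sq (𝕜 := 𝕜) ((2 : 𝕜) • (S x + T x)) x
  rw [norm_smul, mul_pow, norm_add_sq (𝕜 := 𝕜), inner_smul_left, inner_add_left,
    RCLike.norm_ofNat, map_ofNat, RCLike.mul_re, RCLike.ofNat_re, RCLike.ofNat_im,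
    zero_mul, sub_zero, map_add, hS.re_inner_apply_self,
    hT.re_inner_apply_self] at h
  nlinarith [sq_nonneg ‖(2 : 𝕜) • (S x + T x) - x‖]

end

theorem Matrix.IsHermitian.isSymmetricProjection_toEuclideanLin {𝕜 n : Type*} [RCLike 𝕜]
    [Fintype n] [DecidableEq n] {A : Matrix n n 𝕜} (hA : A.IsHermitian) (hA2 : A * A = A) :
    (Matrix.toEuclideanLin A).IsSymmetricProjection where
  isIdempotentElem := by
    rw [IsIdempotentElem, Module.End.mul_eq_comp, ← Matrix.toLpLin_mul_same, hA2]
  isSymmetric := Matrix.isSymmetric_toEuclideanLin_iff.mpr hA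

/-- If `e ∈ ℂ²` is a unit vector and `P, Q` are one-dimensional orthogonal
projections on `ℂ²`, then `-1/8 ≤ Re⟨QPe, e⟩ ≤ 1`. -/
theorem re_inner_QP_bounds_unit
    (e : EuclideanSpace ℂ (Fin 2)) (he : ‖e‖ = 1)
    (P Q : Matrix (Fin 2) (Fin 2) ℂ)
    (hP : P.IsHermitian) (hP2 : P * P = P) (hPrank : P.rank = 1)
    (hQ : Q.IsHermitian) (hQ2 : Q * Q = Q) (hQrank : Q.rank = 1) :
    -(1 / 8 : ℝ) ≤ (⟪Matrix.toEuclideanLin (Q * P) e, e⟫).re ∧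
      (⟪Matrix.toEuclideanLin (Q * P) e, e⟫).re ≤ 1 := by
  have hPp := hP.isSymmetricProjection_toEuclideanLin hP2
  have hQp := hQ.isSymmetricProjection_toEuclideanLin hQ2
  have hlow := hPp.le_re_inner_comp hQp e
  have hup := hPp.re_inner_comp_le hQp e
  rw [he] at hlow hup
  rw [Matrix.toLpLin_mul_same, LinearMap.comp_apply]
  exact ⟨by simpa using hlow, by simpa using hup⟩
end

section
/- Let H be a complex Hilbert space, let e ∈ H, and let P and Q be orthogonal projections on H (of arbitrary rank). Then −(1/8)·‖e‖² ≤ Re ⟨Q P e, e⟩ ≤ ‖e‖². -/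
open scoped ComplexInnerProductSpace

/-- An orthogonal projection `T` satisfies `‖T x‖² = Re ⟪T x, x⟫`. -/
lemma norm_sq_apply_eq_re_inner_of_adjoint_eq_of_comp_self
    {H : Type*} [NormedAddCommGroup H] [InnerProductSpace ℂ H] [CompleteSpace H]
    {T : H →L[ℂ] H} (hT : ContinuousLinearMap.adjoint T = T) (hT2 : T ∘L T = T) (x : H) :
    ‖T x‖ ^ 2 = (⟪T x, x⟫).re := by
  have h : ⟪T x, T x⟫ = ⟪T x, x⟫ := by
    rw [← ContinuousLinearMap.adjoint_inner_left, hT, ← ContinuousLinearMap.comp_apply, hT2]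
  rw [← h]
  exact norm_sq_eq_re_inner (𝕜 := ℂ) (T x)

/-- For orthogonal projections `P, Q` on a complex Hilbert space `H` and any
`e ∈ H`, `-(1/8)·‖e‖² ≤ Re⟨QPe, e⟩ ≤ ‖e‖²`. -/
theorem re_inner_QP_bounds
    {H : Type*} [NormedAddCommGroup H] [InnerProductSpace ℂ H] [CompleteSpace H]
    (P Q : H →L[ℂ] H)
    (hP : ContinuousLinearMap.adjoint P = P) (hP2 : P ∘L P = P)
    (hQ : ContinuousLinearMap.adjoint Q = Q) (hQ2 : Q ∘L Q = Q)
    (e : H) :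
    -(1 / 8 : ℝ) * ‖e‖ ^ 2 ≤ (⟪Q (P e), e⟫).re ∧ (⟪Q (P e), e⟫).re ≤ ‖e‖ ^ 2 := by
  have hPe := norm_sq_apply_eq_re_inner_of_adjoint_eq_of_comp_self hP hP2 e
  have hQe := norm_sq_apply_eq_re_inner_of_adjoint_eq_of_comp_self hQ hQ2 e
  have hQP : ⟪Q (P e), e⟫ = ⟪P e, Q e⟫ := by
    rw [← ContinuousLinearMap.adjoint_inner_left, hQ]
  rw [hQP]
  have sub_sq (x y : H) : ‖x - y‖ ^ 2 = ‖x‖ ^ 2 - 2 * (⟪x, y⟫).re + ‖y‖ ^ 2 :=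
    norm_sub_sq (𝕜 := ℂ) x y
  have add_sq (x y : H) : ‖x + y‖ ^ 2 = ‖x‖ ^ 2 + 2 * (⟪x, y⟫).re + ‖y‖ ^ 2 :=
    norm_add_sq (𝕜 := ℂ) x y
  constructor
  · have h := sub_sq ((2 : ℂ) • (P e + Q e)) e
    rw [norm_smul, mul_pow, add_sq, inner_smul_left, inner_add_left] at h
    norm_num [smul_add] at h
    linarith [sq_nonneg ‖(2 : ℂ) • P e + (2 : ℂ) • Q e - e‖]
  · have h₁ := sub_sq (P e) e
    have h₂ := sub_sq (Q e) e
    have h₃ := sub_sq (P e) (Q e)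
    linarith [sq_nonneg ‖P e - e‖, sq_nonneg ‖Q e - e‖, sq_nonneg ‖P e - Q e‖]
end

section
/- Let K be a complex Hilbert space and let z₁, z₂ be commuting self-adjoint bounded operators on K satisfying the operator inequalities (z₁ − z₂)² ≤ z₁ + z₂ ≤ 1. Then there exist orthogonal projections P, Q, P′, Q′ on the Hilbert space K ⊕ K such that 2·(z₁ ⊕ z₂) = Q P + Q′ P′, where z₁ ⊕ z₂ denotes the block-diagonal operator acting as z₁ on the first summand and z₂ on the second. -/
open scoped ComplexInnerProductSpace

theorem ContinuousLinearMap.ext_of_comp_eq_of_ker_adjoint {E F G : Type*}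
    [NormedAddCommGroup E] [InnerProductSpace ℂ E] [CompleteSpace E]
    [NormedAddCommGroup F] [InnerProductSpace ℂ F] [CompleteSpace F]
    [NormedAddCommGroup G] [NormedSpace ℂ G]
    {s : E →L[ℂ] F} {a b : F →L[ℂ] G}
    (h : a ∘L s = b ∘L s) (hker : ∀ x, adjoint s x = 0 → a x = b x) : a = b := by
  let M : Submodule ℂ F := LinearMap.eqLocus (a : F →ₗ[ℂ] G) (b : F →ₗ[ℂ] G)
  have hM : IsClosed (M : Set F) := isClosed_eq a.continuous b.continuous
  have hrange : s.range ≤ M := by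
    rintro _ ⟨x, rfl⟩
    exact congr($h x)
  have : CompleteSpace M := hM.completeSpace_coe
  have hbot : Mᗮ = ⊥ := by
    rw [Submodule.eq_bot_iff]
    intro x hx
    have hx' : x ∈ s.rangeᗮ := Submodule.orthogonal_le hrange hx
    rw [ContinuousLinearMap.orthogonal_range] at hx'
    have : x ∈ M := hker x hx'
    exact inner_self_eq_zero.1 (hx x this)
  rw [Submodule.orthogonal_eq_bot_iff] at hbot
  ext x
  exact (hbot ▸ Submodule.mem_top : x ∈ M)

/-- Douglas' factorization lemma, for a contractive factor. -/
theorem ContinuousLinearMap.exists_comp_eq_of_norm_le {E F G : Type*}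
    [NormedAddCommGroup E] [InnerProductSpace ℂ E] [CompleteSpace E]
    [NormedAddCommGroup F] [InnerProductSpace ℂ F] [CompleteSpace F]
    [NormedAddCommGroup G] [NormedSpace ℂ G] [CompleteSpace G]
    (s : E →L[ℂ] F) (d : E →L[ℂ] G)
    (h : ∀ x, ‖d x‖ ≤ ‖s x‖) :
    ∃ c : F →L[ℂ] G, (∀ x, ‖c x‖ ≤ ‖x‖) ∧ c ∘L s = d ∧ ∀ x, adjoint s x = 0 → c x = 0 := by
  let N : Submodule ℂ F := s.range.topologicalClosure
  have : CompleteSpace N := s.range.isClosed_topologicalClosure.completeSpace_coe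
  let e : E →L[ℂ] N := s.codRestrict N
    fun x => s.range.le_topologicalClosure (LinearMap.mem_range_self _ x)
  have hdense : DenseRange (e : E →ₗ[ℂ] N) := by
    rw [DenseRange, Subtype.dense_iff]
    intro x hx
    rw [← Set.range_comp]
    exact hx
  have hnorm : ∀ x, ‖(d : E →ₗ[ℂ] G) x‖ ≤ 1 * ‖(e : E →ₗ[ℂ] N) x‖ := by
    simpa using! h
  let c₀ : N →L[ℂ] G := (d : E →ₗ[ℂ] G).extendOfNorm (e : E →ₗ[ℂ] N)
  refine ⟨c₀ ∘L N.orthogonalProjectionOnto, fun x => ?_, ?_, fun x hx => ?_⟩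
  · refine (LinearMap.norm_extendOfNorm_apply_le hdense 1 hnorm _).trans ?_
    rw [one_mul]
    exact N.norm_orthogonalProjectionOnto_apply_le x
  · ext x
    have : N.orthogonalProjectionOnto (s x) = e x :=
      N.orthogonalProjectionOnto_mem_subspace_eq_self (e x)
    simp only [comp_apply, this]
    exact LinearMap.extendOfNorm_eq hdense ⟨1, hnorm⟩ x
  · have : N.orthogonalProjectionOnto x = 0 := by
      rw [Submodule.orthogonalProjectionOnto_eq_zero_iff, Submodule.orthogonal_closure,
        orthogonal_range]
      exact hx
    simp [this]

theorem ContinuousLinearMap.exists_isSelfAdjoint_mul_eq {E : Type*}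
    [NormedAddCommGroup E] [InnerProductSpace ℂ E] [CompleteSpace E] {s d : E →L[ℂ] E}
    (hs : IsSelfAdjoint s) (hd : IsSelfAdjoint d) (hsd : Commute s d)
    (h : ∀ x, ‖d x‖ ≤ ‖s x‖) :
    ∃ c : E →L[ℂ] E, IsSelfAdjoint c ∧ (∀ x, ‖c x‖ ≤ ‖x‖) ∧ c * s = d ∧ s * c = d := by
  obtain ⟨c, hc, hcs, hker⟩ := exists_comp_eq_of_norm_le s d h
  have hs' : adjoint s = s := hs
  have hd_ker : ∀ x, s x = 0 → d x = 0 := fun x hx => by simpa [hx] using h x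
  have hsc : s * c = d := by
    refine ext_of_comp_eq_of_ker_adjoint (s := s) ?_ fun x hx => ?_
    · change s * c * s = d * s
      rw [mul_assoc, show c * s = d from hcs, hsd.eq]
    · change s (c x) = d x
      rw [hker x hx, map_zero, hd_ker x (by rwa [hs'] at hx)]
  have hadj : adjoint c * s = d := by
    have := congr(adjoint $hsc)
    rwa [← star_eq_adjoint, ← star_eq_adjoint, star_mul, hs.star_eq, hd.star_eq] at this
  refine ⟨c, ?_, hc, hcs, hsc⟩
  refine ext_of_comp_eq_of_ker_adjoint (s := s) (hadj.trans hcs.symm) fun x hx => ?_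
  rw [hker x hx]
  have : innerSL ℂ x ∘L c = 0 := by
    refine ext_of_comp_eq_of_ker_adjoint (s := s) ?_ fun y hy => by simp [hker y hy]
    ext y
    have := congr($hcs y)
    simp only [comp_apply] at this
    simp only [comp_apply, innerSL_apply_apply, this, zero_apply]
    have h2 := adjoint_inner_left d y x
    rw [show adjoint d = d from hd, hd_ker x (by rwa [hs'] at hx), inner_zero_left] at h2
    exact h2.symm
  apply ext_inner_right ℂ
  intro y
  have := congr($this y)
  simpa [star_eq_adjoint, adjoint_inner_left] using this

theorem exists_isMulCommutative_subring {R : Type*} [Ring R] {c s p q : R} (hcs : Commute c s)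
    (hcp : Commute c p) (hcq : Commute c q) (hsp : Commute s p) (hsq : Commute s q)
    (hpq : Commute p q) :
    ∃ S : Subring R, IsMulCommutative S ∧ c ∈ S ∧ s ∈ S ∧ p ∈ S ∧ q ∈ S := by
  refine ⟨Subring.closure {c, s, p, q}, Subring.isMulCommutative_closure ?_, ?_⟩
  · rintro x (rfl | rfl | rfl | rfl) y (rfl | rfl | rfl | rfl) <;>
      first | rfl | exact Commute.eq ‹_› | exact (Commute.eq ‹_›).symm
  · refine ⟨?_, ?_, ?_, ?_⟩ <;> exact Subring.subset_closure (by simp)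

open scoped IsMulCommutative in
/-- Identities for `cos (x ± y)` and `sin (x ± y)`, where `c, p` and `s, q` play the roles of
`cos x, sin x` and `cos y, sin y`. -/
theorem angle_addition_identities {R : Type*} [Ring R] {c s p q : R} (hcs : Commute c s)
    (hcp : Commute c p) (hcq : Commute c q) (hsp : Commute s p) (hsq : Commute s q)
    (hpq : Commute p q) (hc : c * c + p * p = 1) (hs : s * s + q * q = 1) :
    Commute (c * s - p * q) (p * s + c * q) ∧
    (c * s - p * q) * (c * s - p * q) + (p * s + c * q) * (p * s + c * q) = 1 ∧
    (1 + (c * s + p * q)) * (1 + (c * s - p * q)) + (p * s - c * q) * (p * s + c * q) =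
      (s * s + c * s) + (s * s + c * s) ∧
    (1 - (c * s + p * q)) * (1 - (c * s - p * q)) + (p * s - c * q) * (p * s + c * q) =
      (s * s - c * s) + (s * s - c * s) := by
  obtain ⟨S, hS, hcS, hsS, hpS, hqS⟩ := exists_isMulCommutative_subring hcs hcp hcq hsp hsq hpq
  lift c to S using hcS
  lift s to S using hsS
  lift p to S using hpS
  lift q to S using hqS
  have hc' : c * c + p * p = 1 := by exact_mod_cast hc
  have hs' : s * s + q * q = 1 := by exact_mod_cast hs
  refine ⟨?_, ?_, ?_, ?_⟩
  · have h := mul_comm (c * s - p * q) (p * s + c * q)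
    exact congrArg (Subtype.val : S → R) h
  · have h : (c * s - p * q) * (c * s - p * q) + (p * s + c * q) * (p * s + c * q) = 1 := by
      linear_combination (s * s + q * q) * hc' + hs'
    exact congrArg (Subtype.val : S → R) h
  · have h : (1 + (c * s + p * q)) * (1 + (c * s - p * q)) + (p * s - c * q) * (p * s + c * q) =
        (s * s + c * s) + (s * s + c * s) := by
      linear_combination (s * s - q * q) * hc' - hs'
    exact congrArg (Subtype.val : S → R) h
  · have h : (1 - (c * s + p * q)) * (1 - (c * s - p * q)) + (p * s - c * q) * (p * s + c * q) =
        (s * s - c * s) + (s * s - c * s) := by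
      linear_combination (s * s - q * q) * hc' - hs'
    exact congrArg (Subtype.val : S → R) h

section BlockOperators

variable {K : Type*} [NormedAddCommGroup K] [InnerProductSpace ℂ K]

/-- The bounded operator on `K ⊕ K` with the given `2 × 2` matrix of operators on `K`. -/
noncomputable def blockOp (a b c d : K →L[ℂ] K) : WithLp 2 (K × K) →L[ℂ] WithLp 2 (K × K) :=
  ((WithLp.prodContinuousLinearEquiv 2 ℂ K K).symm : (K × K) →L[ℂ] WithLp 2 (K × K)) ∘L
    ((a ∘L .fst ℂ K K + b ∘L .snd ℂ K K).prod (c ∘L .fst ℂ K K + d ∘L .snd ℂ K K)) ∘L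
    ((WithLp.prodContinuousLinearEquiv 2 ℂ K K) : WithLp 2 (K × K) →L[ℂ] (K × K))

theorem blockOp_apply (a b c d : K →L[ℂ] K) (x : WithLp 2 (K × K)) :
    blockOp a b c d x = WithLp.toLp 2 (a x.fst + b x.snd, c x.fst + d x.snd) := rfl

theorem blockOp_comp (a b c d a' b' c' d' : K →L[ℂ] K) :
    blockOp a b c d ∘L blockOp a' b' c' d' =
      blockOp (a * a' + b * c') (a * b' + b * d') (c * a' + d * c') (c * b' + d * d') := by
  refine ContinuousLinearMap.ext fun x => congrArg (WithLp.toLp 2) (Prod.ext ?_ ?_) <;>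
  · simp [blockOp_apply]
    abel

theorem blockOp_add (a b c d a' b' c' d' : K →L[ℂ] K) :
    blockOp a b c d + blockOp a' b' c' d' = blockOp (a + a') (b + b') (c + c') (d + d') := by
  refine ContinuousLinearMap.ext fun x => congrArg (WithLp.toLp 2) (Prod.ext ?_ ?_) <;>
    exact add_add_add_comm _ _ _ _

theorem blockOp_smul (r : ℂ) (a b c d : K →L[ℂ] K) :
    r • blockOp a b c d = blockOp (r • a) (r • b) (r • c) (r • d) := by
  refine ContinuousLinearMap.ext fun x => congrArg (WithLp.toLp 2) (Prod.ext ?_ ?_) <;>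
    exact smul_add _ _ _

theorem adjoint_blockOp [CompleteSpace K] (a b c d : K →L[ℂ] K) :
    ContinuousLinearMap.adjoint (blockOp a b c d) =
      blockOp (ContinuousLinearMap.adjoint a) (ContinuousLinearMap.adjoint c)
        (ContinuousLinearMap.adjoint b) (ContinuousLinearMap.adjoint d) := by
  symm
  rw [ContinuousLinearMap.eq_adjoint_iff]
  intro x y
  simp only [blockOp_apply, WithLp.prod_inner_apply, inner_add_left, inner_add_right,
    ContinuousLinearMap.adjoint_inner_left]
  exact add_add_add_comm _ _ _ _

theorem blockOp_isProjection [CompleteSpace K] {u v : K →L[ℂ] K} (hu : IsSelfAdjoint u)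
    (hv : IsSelfAdjoint v) (huv : Commute u v) (h : u * u + v * v = 1) :
    ContinuousLinearMap.adjoint ((1 / 2 : ℂ) • blockOp (1 + u) v v (1 - u)) =
      (1 / 2 : ℂ) • blockOp (1 + u) v v (1 - u) ∧
    ((1 / 2 : ℂ) • blockOp (1 + u) v v (1 - u)) ∘L ((1 / 2 : ℂ) • blockOp (1 + u) v v (1 - u)) =
      (1 / 2 : ℂ) • blockOp (1 + u) v v (1 - u) := by
  have hu' : ContinuousLinearMap.adjoint u = u := hu
  have hv' : ContinuousLinearMap.adjoint v = v := hv
  have h1 : ContinuousLinearMap.adjoint (1 : K →L[ℂ] K) = 1 := star_one (K →L[ℂ] K)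
  have h' : v * v = 1 - u * u := eq_sub_of_add_eq' h
  constructor
  · rw [map_smulₛₗ, adjoint_blockOp, map_add, map_sub, hu', hv', h1]
    congr 1
    simp [Complex.conj_ofNat]
  · rw [ContinuousLinearMap.smul_comp, ContinuousLinearMap.comp_smul, blockOp_comp]
    have e : blockOp ((1 + u) * (1 + u) + v * v) ((1 + u) * v + v * (1 - u))
        (v * (1 + u) + (1 - u) * v) (v * v + (1 - u) * (1 - u)) =
        (2 : ℂ) • blockOp (1 + u) v v (1 - u) := by
      rw [blockOp_smul]
      simp only [two_smul]
      congr 1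
      · rw [h']; noncomm_ring
      · rw [mul_sub, ← huv.eq]; noncomm_ring
      · rw [mul_add, ← huv.eq]; noncomm_ring
      · rw [h']; noncomm_ring
    rw [e]
    simp [smul_smul]

end BlockOperators

theorem exists_isSelfAdjoint_mul_self_eq {A : Type*} [CStarAlgebra A] [PartialOrder A]
    [StarOrderedRing A] {a : A} (ha : 0 ≤ a) :
    ∃ r : A, IsSelfAdjoint r ∧ r * r = a ∧ ∀ b, Commute a b → Commute r b :=
  ⟨CFC.sqrt a, (CFC.sqrt_nonneg a).isSelfAdjoint, CFC.sqrt_mul_sqrt_self a ha,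
    fun _ hb => hb.cfcₙ_nnreal _⟩

/-- If `z₁, z₂` are commuting self-adjoint bounded operators on a complex
Hilbert space `K` with `(z₁ - z₂)² ≤ z₁ + z₂ ≤ 1`, then `2(z₁ ⊕ z₂) = QP + Q′P′` for some
orthogonal projections `P, Q, P′, Q′` on the Hilbert direct sum `K ⊕ K`. -/
theorem direct_sum_two_compositions
    {K : Type*} [NormedAddCommGroup K] [InnerProductSpace ℂ K] [CompleteSpace K]
    (z₁ z₂ : K →L[ℂ] K)
    (hz₁ : ContinuousLinearMap.adjoint z₁ = z₁)
    (hz₂ : ContinuousLinearMap.adjoint z₂ = z₂)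
    (hcomm : z₁ ∘L z₂ = z₂ ∘L z₁)
    (hA1 : ∀ e : K, 0 ≤ (⟪((z₁ + z₂) - (z₁ - z₂) ∘L (z₁ - z₂)) e, e⟫).re)
    (hA2 : ∀ e : K, 0 ≤ (⟪((1 : K →L[ℂ] K) - (z₁ + z₂)) e, e⟫).re)
    (z : WithLp 2 (K × K) →L[ℂ] WithLp 2 (K × K))
    (hz : z = ((WithLp.prodContinuousLinearEquiv 2 ℂ K K).symm :
          (K × K) →L[ℂ] WithLp 2 (K × K)) ∘L (z₁.prodMap z₂) ∘L
        ((WithLp.prodContinuousLinearEquiv 2 ℂ K K) :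
          WithLp 2 (K × K) →L[ℂ] (K × K))) :
    ∃ P Q P' Q' : WithLp 2 (K × K) →L[ℂ] WithLp 2 (K × K),
      (ContinuousLinearMap.adjoint P = P ∧ P ∘L P = P) ∧
      (ContinuousLinearMap.adjoint Q = Q ∧ Q ∘L Q = Q) ∧
      (ContinuousLinearMap.adjoint P' = P' ∧ P' ∘L P' = P') ∧
      (ContinuousLinearMap.adjoint Q' = Q' ∧ Q' ∘L Q' = Q') ∧
      (2 : ℂ) • z = Q ∘L P + Q' ∘L P' := by
  have hs1 : IsSelfAdjoint z₁ := hz₁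
  have hs2 : IsSelfAdjoint z₂ := hz₂
  have h12 : Commute z₁ z₂ := hcomm
  have nonneg_of {T : K →L[ℂ] K} (hT : IsSelfAdjoint T) (h : ∀ e, 0 ≤ (⟪T e, e⟫).re) : 0 ≤ T := by
    rw [ContinuousLinearMap.nonneg_iff_isPositive, ContinuousLinearMap.isPositive_def']
    exact ⟨hT, h⟩
  have norm_sq {T : K →L[ℂ] K} (hT : IsSelfAdjoint T) (e : K) :
      (⟪(T * T) e, e⟫).re = ‖T e‖ ^ 2 := by
    have := ContinuousLinearMap.adjoint_inner_left T e (T e)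
    rw [show ContinuousLinearMap.adjoint T = T from hT] at this
    change (⟪T (T e), e⟫).re = _
    rw [this]
    exact inner_self_eq_norm_sq (𝕜 := ℂ) (T e)
  have sa_mul {a b : K →L[ℂ] K} (ha : IsSelfAdjoint a) (hb : IsSelfAdjoint b)
      (hab : Commute a b) : IsSelfAdjoint (a * b) := (ha.commute_iff hb).1 hab
  have hd : IsSelfAdjoint (z₁ - z₂) := hs1.sub hs2
  have hsum : 0 ≤ z₁ + z₂ := by
    refine nonneg_of (hs1.add hs2) fun e => ?_
    have h := hA1 e
    have h' := norm_sq hd e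
    rw [sub_apply, inner_sub_left, Complex.sub_re] at h
    change (⟪((z₁ - z₂) ∘L (z₁ - z₂)) e, e⟫).re = _ at h'
    nlinarith [sq_nonneg ‖(z₁ - z₂) e‖]
  obtain ⟨s, hs, hss, hscomm⟩ := exists_isSelfAdjoint_mul_self_eq hsum
  have hsd : Commute s (z₁ - z₂) :=
    hscomm _ (((Commute.refl z₁).add_left h12.symm).sub_right (h12.add_left (Commute.refl z₂)))
  obtain ⟨c, hc, hc_norm, hcs, hsc⟩ :=
    ContinuousLinearMap.exists_isSelfAdjoint_mul_eq hs hd hsd fun e => by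
      have h := hA1 e
      rw [sub_apply, inner_sub_left, Complex.sub_re, ← hss, norm_sq hs] at h
      have h' := norm_sq hd e
      change (⟪((z₁ - z₂) ∘L (z₁ - z₂)) e, e⟫).re = _ at h'
      exact le_of_sq_le_sq (by linarith) (norm_nonneg _)
  have hc_comm : Commute c s := hcs.trans hsc.symm
  obtain ⟨p, hp, hpp, hpcomm⟩ := exists_isSelfAdjoint_mul_self_eq (a := 1 - c * c) <|
    nonneg_of ((IsSelfAdjoint.one _).sub (sa_mul hc hc (Commute.refl c))) fun e => by
      rw [sub_apply, inner_sub_left, Complex.sub_re, norm_sq hc]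
      have := inner_self_eq_norm_sq (𝕜 := ℂ) e
      change (⟪e, e⟫).re = _ at this
      change 0 ≤ (⟪e, e⟫).re - _
      rw [this]
      have := pow_le_pow_left₀ (norm_nonneg _) (hc_norm e) 2
      linarith
  obtain ⟨q, hq, hqq, hqcomm⟩ := exists_isSelfAdjoint_mul_self_eq (a := 1 - s * s) <|
    nonneg_of ((IsSelfAdjoint.one _).sub (sa_mul hs hs (Commute.refl s))) fun e => by
      rw [hss]
      exact hA2 e
  have comm_sub {a b : K →L[ℂ] K} (h : Commute a b) : Commute (1 - a * a) b :=
    (Commute.one_left b).sub_left (h.mul_left h)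
  have hpc : Commute p c := hpcomm c (comm_sub (Commute.refl c))
  have hps : Commute p s := hpcomm s (comm_sub hc_comm)
  have hqs : Commute q s := hqcomm s (comm_sub (Commute.refl s))
  have hqc : Commute q c := hqcomm c (comm_sub hc_comm.symm)
  have hqp : Commute q p := hqcomm p (comm_sub hps.symm)
  have hcp1 : c * c + p * p = 1 := by rw [hpp]; abel
  have hsq1 : s * s + q * q = 1 := by rw [hqq]; abel
  obtain ⟨huv, hu2, h11, h22⟩ := angle_addition_identities hc_comm hpc.symm hqc.symm hps.symm
    hqs.symm hqp.symm hcp1 hsq1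
  obtain ⟨htw, ht2, -, -⟩ := angle_addition_identities (q := -q) hc_comm hpc.symm
    hqc.symm.neg_right hps.symm hqs.symm.neg_right hqp.symm.neg_right hcp1 (by rwa [neg_mul_neg])
  simp only [mul_neg, sub_neg_eq_add, ← sub_eq_add_neg] at htw ht2
  have hcs_sa := sa_mul hc hs hc_comm
  have hpq_sa := sa_mul hp hq hqp.symm
  have hps_sa := sa_mul hp hs hps
  have hcq_sa := sa_mul hc hq hqc.symm
  have hu_sa := hcs_sa.sub hpq_sa
  have hv_sa := hps_sa.add hcq_sa
  have ht_sa := hcs_sa.add hpq_sa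
  have hw_sa := hps_sa.sub hcq_sa
  have hx : s * s + c * s = z₁ + z₁ := by rw [hss, hcs]; abel
  have hy : s * s - c * s = z₂ + z₂ := by rw [hss, hcs]; abel
  have hz' : z = blockOp z₁ 0 0 z₂ := by
    rw [hz]
    refine ContinuousLinearMap.ext fun x => congrArg (WithLp.toLp 2) (Prod.ext ?_ ?_)
    · exact (add_zero (z₁ x.fst)).symm
    · exact (zero_add (z₂ x.snd)).symm
  rw [hx] at h11
  rw [hy] at h22
  generalize c * s - p * q = u at *
  generalize p * s + c * q = v at *
  generalize c * s + p * q = t at *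
  generalize p * s - c * q = w at *
  refine ⟨_, _, _, _, blockOp_isProjection hu_sa hv_sa huv hu2,
    blockOp_isProjection ht_sa hw_sa htw ht2,
    blockOp_isProjection hu_sa hv_sa.neg huv.neg_right (by rwa [neg_mul_neg]),
    blockOp_isProjection ht_sa hw_sa.neg htw.neg_right (by rwa [neg_mul_neg]), ?_⟩
  simp only [ContinuousLinearMap.smul_comp, ContinuousLinearMap.comp_smul, blockOp_comp, smul_smul]
  have key : blockOp ((1 + t) * (1 + u) + w * v + ((1 + t) * (1 + u) + -w * -v))
      ((1 + t) * v + w * (1 - u) + ((1 + t) * -v + -w * (1 - u)))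
      (w * (1 + u) + (1 - t) * v + (-w * (1 + u) + (1 - t) * -v))
      (w * v + (1 - t) * (1 - u) + (-w * -v + (1 - t) * (1 - u))) =
      (8 : ℂ) • blockOp z₁ 0 0 z₂ := by
    have h8 (a : K →L[ℂ] K) : (8 : ℂ) • a = a + a + (a + a) + (a + a + (a + a)) := by
      module
    rw [blockOp_smul, smul_zero, h8, h8, ← h11, ← h22]
    congr 1 <;> noncomm_ring
  refine Eq.trans ?_ (smul_add _ _ _)
  rw [blockOp_add, key, hz', smul_smul]
  norm_num
end
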